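/- Let G be an abelian group, k a commutative G-ring, and n a positive odd integer. Then for any δ ∈ k (no invertibility assumed) there is an isomorphism of graded k-modules Tor_*^{GB_n(δ)}(𝟙,𝟙) ≅ Tor_*^{k[G^n ⋊ Σ_n]}(k,k) = H_*(G^n ⋊ Σ_n; k). More generally, for any positive integer n, if I_0 denotes the two-sided ideal of GB_n(δ) that is free as a k-module on the diagrams with no left-to-right connections, then Tor_*^{GB_n(δ)/I_0}(𝟙,𝟙) ≅ H_*(G^n ⋊ Σ_n; k). -/

import Mathlib

open scoped TensorProduct

noncomputable section

/-! ### Bar-complex homology of an augmented algebra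

For a `k`-algebra `A` with augmentation `ε : A →ₐ[k] k` (the algebra map corresponding to
the trivial module `𝟙 = k`), we form the (unnormalized) bar complex `C_q = A^{⊗ q}`
(tensors over `k`), with the usual differential
`d(a₁⊗…⊗a_q) = ε(a₁)(a₂⊗…) + Σ (-1)^i (…a_i a_{i+1}…) + (-1)^q ε(a_q)(a₁⊗…)`,
whose homology is `Tor_*^A(𝟙,𝟙)`. -/

/-- The modules `A^{⊗ q}` of the bar complex. -/
def barC (k : Type) [CommRing k] (A : Type) [Ring A] [Algebra k A] : ℕ → ModuleCat k
  | 0 => ModuleCat.of k k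
  | (q + 1) => ModuleCat.of k (A ⊗[k] (barC k A q))

variable (k : Type) [CommRing k] (A : Type) [Ring A] [Algebra k A] (ε : A →ₐ[k] k)

/-- Left multiplication of `A` on the leftmost bar factor (via `ε` in degree `0`). -/
def barAct : ∀ q : ℕ, A →ₗ[k] ((barC k A q : Type) →ₗ[k] (barC k A q : Type))
  | 0 => (LinearMap.lsmul k k).comp ε.toLinearMap
  | (q + 1) =>
    show A →ₗ[k] ((A ⊗[k] (barC k A q : Type)) →ₗ[k] (A ⊗[k] (barC k A q : Type))) from
    { toFun := fun a => TensorProduct.map (LinearMap.mulLeft k a) LinearMap.id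
      map_add' := by
        intro a b
        refine TensorProduct.ext' fun x y => ?_
        simp [add_mul, TensorProduct.add_tmul]
      map_smul' := by
        intro c a
        refine TensorProduct.ext' fun x y => ?_
        simp [TensorProduct.smul_tmul', smul_mul_assoc] }

/-- All terms of the bar differential except the first face. -/
def barB : ∀ q : ℕ, ((A ⊗[k] (barC k A q : Type)) →ₗ[k] (barC k A q : Type))
  | 0 => - TensorProduct.lift ((LinearMap.lsmul k (barC k A 0 : Type)).comp ε.toLinearMap)
  | (q + 1) =>
    show (A ⊗[k] (A ⊗[k] (barC k A q : Type))) →ₗ[k] (A ⊗[k] (barC k A q : Type)) from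
    TensorProduct.lift (LinearMap.mk₂ k
      (fun (a : A) (x : A ⊗[k] (barC k A q : Type)) =>
        -((show A →ₗ[k] ((A ⊗[k] (barC k A q : Type)) →ₗ[k] (A ⊗[k] (barC k A q : Type))) from
            barAct k A ε (q + 1)) a x) - a ⊗ₜ[k] (barB q x))
      (by intro a b x
          have h := LinearMap.map_add₂ (show A →ₗ[k] ((A ⊗[k] (barC k A q : Type)) →ₗ[k] (A ⊗[k] (barC k A q : Type))) from
            barAct k A ε (q + 1)) a b x
          simp only [TensorProduct.add_tmul]
          erw [h]
          abel)
      (by intro c a x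
          have h := LinearMap.map_smul₂ (show A →ₗ[k] ((A ⊗[k] (barC k A q : Type)) →ₗ[k] (A ⊗[k] (barC k A q : Type))) from
            barAct k A ε (q + 1)) c a x
          simp only [smul_sub, smul_neg,
            TensorProduct.smul_tmul']
          erw [h])
      (by intro a x y
          simp only [map_add, LinearMap.map_add, TensorProduct.tmul_add]
          try abel)
      (by intro c a x
          simp only [map_smul, LinearMap.map_smul, TensorProduct.tmul_smul, smul_sub, smul_neg]
          try abel))

/-- The bar differential `C_{q+1} = A ⊗ C_q → C_q`. -/
def bard (q : ℕ) : (A ⊗[k] (barC k A q : Type)) →ₗ[k] (barC k A q : Type) :=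
  TensorProduct.lift ((LinearMap.lsmul k (barC k A q : Type)).comp ε.toLinearMap)
  + barB k A ε q

/-- Cycles of the bar complex. -/
def barCycles : ∀ q : ℕ, Submodule k (barC k A q : Type)
  | 0 => ⊤
  | (q + 1) =>
    show Submodule k (barC k A (q + 1) : Type) from LinearMap.ker (bard k A ε q)

/-- `Tor_q^A(𝟙, 𝟙)`, the homology of the algebra `A` with augmentation (trivial module) `ε`,
computed by the bar complex. -/
def barTor (q : ℕ) : Type :=
  (barCycles k A ε q) ⧸
    (Submodule.comap (barCycles k A ε q).subtype (LinearMap.range (bard k A ε q)))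

instance (q : ℕ) : AddCommGroup (barTor k A ε q) :=
  inferInstanceAs (AddCommGroup ((barCycles k A ε q) ⧸
    (Submodule.comap (barCycles k A ε q).subtype (LinearMap.range (bard k A ε q)))))

instance (q : ℕ) : Module k (barTor k A ε q) :=
  inferInstanceAs (Module k ((barCycles k A ε q) ⧸
    (Submodule.comap (barCycles k A ε q).subtype (LinearMap.range (bard k A ε q)))))

/-- The augmentation of a group algebra `k[G]`, corresponding to the trivial action of `G`
on `k`. -/
def groupAug (G : Type) [Group G] : MonoidAlgebra k G →ₐ[k] k :=
  MonoidAlgebra.lift k k G 1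

/-- Group homology `H_*(G; k) = Tor_*^{k[G]}(k, k)` (with the trivial action on `k`). -/
abbrev groupTor (G : Type) [Group G] (q : ℕ) : Type :=
  barTor k (MonoidAlgebra k G) (groupAug k G) q

section Groups

/-- The action of the symmetric group on `G^n` by permuting the factors. -/
def permMulAut (G : Type) [Group G] (n : ℕ) :
    Equiv.Perm (Fin n) →* MulAut (Fin n → G) where
  toFun σ :=
    { toFun := fun f => f ∘ σ.symm
      invFun := fun f => f ∘ σ
      left_inv := fun f => by funext i; simp
      right_inv := fun f => by funext i; simp
      map_mul' := fun f g => rfl }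
  map_one' := by ext f i; rfl
  map_mul' := fun σ τ => by ext f i; rfl

/-- The Artin braid relations, on `m` generators (so for the braid group on `m+1` strands). -/
def braidRels (m : ℕ) : Set (FreeGroup (Fin m)) :=
  { x | ∃ i j : Fin m,
      ((i : ℕ) + 1 = (j : ℕ) ∧
        x = .of i * .of j * .of i * (.of j * .of i * .of j)⁻¹) ∨
      ((i : ℕ) + 1 < (j : ℕ) ∧
        x = .of i * .of j * (.of j * .of i)⁻¹) }

/-- The braid group `B_n` on `n` strands, presented by the Artin generators
`σ_1, …, σ_{n-1}` and the braid relations. -/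
abbrev BraidGroup (n : ℕ) : Type := PresentedGroup (braidRels (n - 1))

private lemma swap_braid {α : Type} [DecidableEq α] (a b c : α)
    (hab : a ≠ b) (hac : a ≠ c) (hbc : b ≠ c) :
    Equiv.swap a b * Equiv.swap b c * Equiv.swap a b
      = Equiv.swap b c * Equiv.swap a b * Equiv.swap b c := by
  have h1 : Equiv.swap b c * Equiv.swap a b * Equiv.swap b c = Equiv.swap c a :=
    Equiv.swap_mul_swap_mul_swap hab hac
  have h2 : Equiv.swap b a * Equiv.swap c b * Equiv.swap b a = Equiv.swap a c :=
    Equiv.swap_mul_swap_mul_swap hbc.symm hac.symm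
  rw [Equiv.swap_comm b a, Equiv.swap_comm c b] at h2
  rw [h1, h2, Equiv.swap_comm]

private lemma swap_swap_comm {α : Type} [DecidableEq α] (a b c d : α)
    (hac : a ≠ c) (had : a ≠ d) (hbc : b ≠ c) (hbd : b ≠ d) :
    Equiv.swap a b * Equiv.swap c d = Equiv.swap c d * Equiv.swap a b := by
  have h := Equiv.swap_apply_apply (Equiv.swap c d) a b
  rw [Equiv.swap_apply_of_ne_of_ne hac had, Equiv.swap_apply_of_ne_of_ne hbc hbd] at h
  exact eq_mul_inv_iff_mul_eq.mp h

/-- The transpositions which are the images of the braid generators. -/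
def braidGen (n : ℕ) (i : Fin (n - 1)) : Equiv.Perm (Fin n) :=
  Equiv.swap ⟨(i : ℕ), by have := i.2; omega⟩ ⟨(i : ℕ) + 1, by have := i.2; omega⟩

private lemma braidGen_braid (n : ℕ) (i j : Fin (n - 1)) (hij : (i : ℕ) + 1 = (j : ℕ)) :
    braidGen n i * braidGen n j * braidGen n i
      = braidGen n j * braidGen n i * braidGen n j := by
  obtain ⟨i, hi⟩ := i
  obtain ⟨j, hj⟩ := j
  simp only at hij
  subst hij
  unfold braidGen
  exact swap_braid _ _ _ (by simp only [ne_eq, Fin.mk.injEq]; omega)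
    (by simp only [ne_eq, Fin.mk.injEq]; omega) (by simp only [ne_eq, Fin.mk.injEq]; omega)

private lemma braidGen_comm (n : ℕ) (i j : Fin (n - 1)) (hij : (i : ℕ) + 1 < (j : ℕ)) :
    braidGen n i * braidGen n j = braidGen n j * braidGen n i := by
  unfold braidGen
  exact swap_swap_comm _ _ _ _ (by simp only [ne_eq, Fin.mk.injEq]; omega)
    (by simp only [ne_eq, Fin.mk.injEq]; omega) (by simp only [ne_eq, Fin.mk.injEq]; omega)
    (by simp only [ne_eq, Fin.mk.injEq]; omega)

/-- The canonical projection from the braid group to the symmetric group. -/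
def braidToPerm (n : ℕ) : BraidGroup n →* Equiv.Perm (Fin n) :=
  PresentedGroup.toGroup (f := braidGen n) (by
    rintro r ⟨i, j, (⟨hij, rfl⟩ | ⟨hij, rfl⟩)⟩ <;>
      simp only [map_mul, map_inv, FreeGroup.lift_apply_of] <;> rw [mul_inv_eq_one]
    · exact braidGen_braid n i j hij
    · exact braidGen_comm n i j hij)

end Groups

section GBsection

/-! The `G`-equivariant Brauer algebra `GB_n(δ)`: generators `s i` (transpositions),
`e i` (cap-cup hooks) and `t g j` (labels); a middle loop whose labels multiply to `g`
is deleted at the cost of the factor `(ρ g) δ = g•δ ∈ k`. -/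

inductive GBGen (n : ℕ) (G : Type) : Type
  | s : Fin (n - 1) → GBGen n G
  | e : Fin (n - 1) → GBGen n G
  | t : G → Fin n → GBGen n G

variable (k G : Type) [CommRing k] [CommGroup G] (ρ : G →* RingAut k) (n : ℕ) (δ : k)

abbrev GBs (i : Fin (n - 1)) : FreeAlgebra k (GBGen n G) := FreeAlgebra.ι k (GBGen.s i)
abbrev GBe (i : Fin (n - 1)) : FreeAlgebra k (GBGen n G) := FreeAlgebra.ι k (GBGen.e i)
abbrev GBt (g : G) (j : Fin n) : FreeAlgebra k (GBGen n G) := FreeAlgebra.ι k (GBGen.t g j)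

/-- The diagrammatic relations. -/
inductive GBRel : FreeAlgebra k (GBGen n G) → FreeAlgebra k (GBGen n G) → Prop
  | s_sq (i : Fin (n - 1)) :
      GBRel (GBs k G n i * GBs k G n i) (1)
  | s_braid (i j : Fin (n - 1)) (h : (j : ℕ) = (i : ℕ) + 1) :
      GBRel (GBs k G n i * GBs k G n j * GBs k G n i) (GBs k G n j * GBs k G n i * GBs k G n j)
  | ss_comm (i j : Fin (n - 1)) (h : (i : ℕ) + 1 < (j : ℕ)) :
      GBRel (GBs k G n i * GBs k G n j) (GBs k G n j * GBs k G n i)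
  | e_sq (i : Fin (n - 1)) :
      GBRel (GBe k G n i * GBe k G n i) (δ • GBe k G n i)
  | e_hook (i j : Fin (n - 1)) (h : (j : ℕ) = (i : ℕ) + 1 ∨ (i : ℕ) = (j : ℕ) + 1) :
      GBRel (GBe k G n i * GBe k G n j * GBe k G n i) (GBe k G n i)
  | ee_comm (i j : Fin (n - 1)) (h : (i : ℕ) + 1 < (j : ℕ)) :
      GBRel (GBe k G n i * GBe k G n j) (GBe k G n j * GBe k G n i)
  | se_absorb (i : Fin (n - 1)) :
      GBRel (GBs k G n i * GBe k G n i) (GBe k G n i)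
  | es_absorb (i : Fin (n - 1)) :
      GBRel (GBe k G n i * GBs k G n i) (GBe k G n i)
  | se_comm (i j : Fin (n - 1)) (h : (i : ℕ) + 1 < (j : ℕ) ∨ (j : ℕ) + 1 < (i : ℕ)) :
      GBRel (GBs k G n i * GBe k G n j) (GBe k G n j * GBs k G n i)
  | ese (i j : Fin (n - 1)) (h : (j : ℕ) = (i : ℕ) + 1 ∨ (i : ℕ) = (j : ℕ) + 1) :
      GBRel (GBe k G n i * GBs k G n j * GBe k G n i) (GBe k G n i)
  | sse (i j : Fin (n - 1)) (h : (j : ℕ) = (i : ℕ) + 1 ∨ (i : ℕ) = (j : ℕ) + 1) :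
      GBRel (GBs k G n i * GBs k G n j * GBe k G n i) (GBe k G n j * GBe k G n i)
  | ess (i j : Fin (n - 1)) (h : (j : ℕ) = (i : ℕ) + 1 ∨ (i : ℕ) = (j : ℕ) + 1) :
      GBRel (GBe k G n i * GBs k G n j * GBs k G n i) (GBe k G n i * GBe k G n j)
  | t_mul (g h' : G) (j : Fin n) :
      GBRel (GBt k G n g j * GBt k G n h' j) (GBt k G n (g * h') j)
  | t_one (j : Fin n) :
      GBRel (GBt k G n 1 j) (1)
  | tt_comm (g h' : G) (j l : Fin n) (h : j ≠ l) :
      GBRel (GBt k G n g j * GBt k G n h' l) (GBt k G n h' l * GBt k G n g j)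
  | st_comm (g : G) (i : Fin (n - 1)) (l : Fin n) (h : (l : ℕ) ≠ (i : ℕ) ∧ (l : ℕ) ≠ (i : ℕ) + 1) :
      GBRel (GBs k G n i * GBt k G n g l) (GBt k G n g l * GBs k G n i)
  | st_slide (g : G) (i : Fin (n - 1)) (j j' : Fin n) (h : (j : ℕ) = (i : ℕ)) (h' : (j' : ℕ) = (i : ℕ) + 1) :
      GBRel (GBs k G n i * GBt k G n g j) (GBt k G n g j' * GBs k G n i)
  | st_slide' (g : G) (i : Fin (n - 1)) (j j' : Fin n) (h : (j : ℕ) = (i : ℕ)) (h' : (j' : ℕ) = (i : ℕ) + 1) :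
      GBRel (GBs k G n i * GBt k G n g j') (GBt k G n g j * GBs k G n i)
  | et_comm (g : G) (i : Fin (n - 1)) (l : Fin n) (h : (l : ℕ) ≠ (i : ℕ) ∧ (l : ℕ) ≠ (i : ℕ) + 1) :
      GBRel (GBe k G n i * GBt k G n g l) (GBt k G n g l * GBe k G n i)
  | cap_slide_l (g : G) (i : Fin (n - 1)) (j j' : Fin n) (h : (j : ℕ) = (i : ℕ)) (h' : (j' : ℕ) = (i : ℕ) + 1) :
      GBRel (GBt k G n g j * GBe k G n i) (GBt k G n g j' * GBe k G n i)
  | cap_slide_r (g : G) (i : Fin (n - 1)) (j j' : Fin n) (h : (j : ℕ) = (i : ℕ)) (h' : (j' : ℕ) = (i : ℕ) + 1) :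
      GBRel (GBe k G n i * GBt k G n g j) (GBe k G n i * GBt k G n g j')
  | loop (g : G) (i : Fin (n - 1)) (j : Fin n) (h : (j : ℕ) = (i : ℕ)) :
      GBRel (GBe k G n i * GBt k G n g j * GBe k G n i) ((ρ g δ) • GBe k G n i)

/-- The diagram algebra: the quotient of the free algebra on the diagram generators by
the diagrammatic relations. -/
abbrev GBAlg : Type := RingQuot (GBRel k G ρ n δ)

/-- The augmentation corresponding to the trivial module `𝟙`: a diagram acts by `1`
if it has `n` left-to-right connections, and by `0` otherwise. -/
noncomputable def GBaug : GBAlg k G ρ n δ →ₐ[k] k :=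
  RingQuot.liftAlgHom k ⟨FreeAlgebra.lift k
      (fun x => match x with
        | GBGen.s _ => (1 : k)
        | GBGen.e _ => (0 : k)
        | GBGen.t _ _ => (1 : k)),
    by rintro x y h
       induction h <;>
         simp [GBs, GBe, GBt, FreeAlgebra.lift_ι_apply]⟩

end GBsection

section GBQsection

variable (k G : Type) [CommRing k] [CommGroup G] (ρ : G →* RingAut k) (n : ℕ) (δ : k)

/-- The relations of the quotient `GB_n(δ)/I₀`, where `I₀` is the two-sided ideal which is
free as a `k`-module on the diagrams with no left-to-right connections: we impose in
addition that the rank-`0` diagram `e_0 e_2 ⋯ e_{n-2}` (which exists exactly when `n` is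
even and positive, and which generates `I₀` as a two-sided ideal) is `0`. -/
inductive GBQRel : FreeAlgebra k (GBGen n G) → FreeAlgebra k (GBGen n G) → Prop
  | base {x y : FreeAlgebra k (GBGen n G)} (h : GBRel k G ρ n δ x y) : GBQRel x y
  | blank (h0 : 0 < n) (h1 : Even n) :
      GBQRel ((List.ofFn (fun i : Fin (n / 2) =>
        GBe k G n ⟨2 * (i : ℕ), by have h2 := i.2; obtain ⟨m, hm⟩ := h1; omega⟩)).prod) 0

/-- The quotient algebra `GB_n(δ)/I₀`. -/
abbrev GBQAlg : Type := RingQuot (GBQRel k G ρ n δ)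

/-- The augmentation (trivial module) of `GB_n(δ)/I₀`. -/
noncomputable def GBQaug : GBQAlg k G ρ n δ →ₐ[k] k :=
  RingQuot.liftAlgHom k ⟨FreeAlgebra.lift k
      (fun x => match x with
        | GBGen.s _ => (1 : k)
        | GBGen.e _ => (0 : k)
        | GBGen.t _ _ => (1 : k)),
    by rintro x y h
       induction h with
       | base h =>
         induction h <;> simp [GBs, GBe, GBt, FreeAlgebra.lift_ι_apply]
       | blank h0 h1 =>
         rw [map_zero, map_list_prod]
         apply List.prod_eq_zero
         simp only [List.map_ofFn]
         rw [List.mem_ofFn]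
         refine ⟨⟨0, by obtain ⟨m, hm⟩ := h1; omega⟩, ?_⟩
         simp [Function.comp, GBe, FreeAlgebra.lift_ι_apply]⟩

end GBQsection

/-! ### Part 1: bar complexes with coefficients -/

section BarCoeff

open CategoryTheory

variable {k : Type} [CommRing k] {A : Type} [Ring A] [Algebra k A] {B : Type} [Ring B] [Algebra k B]

section generic

variable {N : Type} [AddCommGroup N] [Module k N]

/-- the action map -/
def muL (r : A →ₐ[k] Module.End k N) : (A ⊗[k] N) →ₗ[k] N := TensorProduct.lift r.toLinearMap

@[simp] lemma muL_tmul (r : A →ₐ[k] Module.End k N) (a : A) (m : N) :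
    muL r (a ⊗ₜ m) = r a m := rfl

variable (k A N) in
/-- the left action of `A` on `A ⊗ N` -/
def tenAct : A →ₐ[k] Module.End k (A ⊗[k] N) :=
  (Module.End.rTensorAlgHom k A N).comp (Algebra.lmul k A)

@[simp] lemma tenAct_tmul (a b : A) (m : N) :
    tenAct k A N a (b ⊗ₜ[k] m) = (a * b) ⊗ₜ[k] m := rfl

variable (N) in
/-- the augmentation face -/
def etaL (ε : A →ₐ[k] k) : (A ⊗[k] N) →ₗ[k] N :=
  TensorProduct.lift ((LinearMap.lsmul k N).comp ε.toLinearMap)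

@[simp] lemma etaL_tmul (ε : A →ₐ[k] k) (a : A) (m : N) :
    etaL N ε (a ⊗ₜ m) = ε a • m := rfl

/-- next stage of the differential -/
def stepB (β : (A ⊗[k] N) →ₗ[k] N) : (A ⊗[k] (A ⊗[k] N)) →ₗ[k] (A ⊗[k] N) :=
  - muL (tenAct k A N) - LinearMap.lTensor A β

@[simp] lemma stepB_tmul (β : (A ⊗[k] N) →ₗ[k] N) (a : A) (x : A ⊗[k] N) :
    stepB β (a ⊗ₜ x) = - tenAct k A N a x - a ⊗ₜ β x := rfl

lemma stepB_act (β : (A ⊗[k] N) →ₗ[k] N) (a : A) (x : A ⊗[k] (A ⊗[k] N)) :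
    stepB β (tenAct k A _ a x) = tenAct k A _ a (stepB β x) := by
  induction x using TensorProduct.induction_on with
  | zero => simp only [map_zero]
  | add x y hx hy => simp only [map_add, hx, hy]
  | tmul b m => simp [map_mul]

lemma etaL_act (ε : A →ₐ[k] k) (a : A) (x : A ⊗[k] N) :
    etaL N ε (tenAct k A N a x) = ε a • etaL N ε x := by
  induction x using TensorProduct.induction_on with
  | zero => simp
  | add x y hx hy => simp only [map_add, hx, hy, smul_add]
  | tmul b m => simp [mul_smul]

lemma β_stepB (r : A →ₐ[k] Module.End k N) (β : (A ⊗[k] N) →ₗ[k] N)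
    (h1 : ∀ a x, β (tenAct k A N a x) = r a (β x))
    (h2 : ∀ a x, β (a ⊗ₜ β x) = - r a (β x)) (x : A ⊗[k] (A ⊗[k] N)) : β (stepB β x) = 0 := by
  induction x using TensorProduct.induction_on with
  | zero => simp
  | add x y hx hy => simp only [map_add, hx, hy, add_zero]
  | tmul b m => simp [h1, h2]

lemma d_d (ε : A →ₐ[k] k) (r : A →ₐ[k] Module.End k N) (β : (A ⊗[k] N) →ₗ[k] N)
    (h1 : ∀ a x, β (tenAct k A N a x) = r a (β x))
    (h2 : ∀ a x, β (a ⊗ₜ β x) = - r a (β x)) (x : A ⊗[k] (A ⊗[k] N)) :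
    (etaL N ε + β) ((etaL (A ⊗[k] N) ε + stepB β : (A ⊗[k] (A ⊗[k] N)) →ₗ[k] (A ⊗[k] N)) x) = 0 := by
  induction x using TensorProduct.induction_on with
  | zero => simp
  | add x y hx hy => rw [map_add, map_add, hx, hy, add_zero]
  | tmul a y =>
    simp only [LinearMap.add_apply, map_add, β_stepB r β h1 h2]
    simp [etaL_act]

lemma start_h1 (r : A →ₐ[k] Module.End k N) (a : A) (x : A ⊗[k] N) :
    (- muL r) (tenAct k A N a x) = r a ((- muL r) x) := by
  induction x using TensorProduct.induction_on with
  | zero => simp only [map_zero]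
  | add x y hx hy => simp only [map_add, hx, hy]
  | tmul b m => simp [map_mul]

lemma start_h2 (r : A →ₐ[k] Module.End k N) (a : A) (x : A ⊗[k] N) :
    (- muL r) (a ⊗ₜ ((- muL r) x)) = - r a ((- muL r) x) := by
  simp

lemma next_h2 (r : A →ₐ[k] Module.End k N) (β : (A ⊗[k] N) →ₗ[k] N)
    (h1 : ∀ a x, β (tenAct k A N a x) = r a (β x))
    (h2 : ∀ a x, β (a ⊗ₜ β x) = - r a (β x)) (a : A) (x : A ⊗[k] (A ⊗[k] N)) :
    stepB β (a ⊗ₜ stepB β x) = - tenAct k A N a (stepB β x) := by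
  rw [stepB_tmul, β_stepB r β h1 h2, TensorProduct.tmul_zero, sub_zero]

section maps

variable {N' : Type} [AddCommGroup N'] [Module k N'] (π : A →ₐ[k] B)

lemma map_start_β (r : A →ₐ[k] Module.End k N) (r' : B →ₐ[k] Module.End k N') (f : N →ₗ[k] N')
    (hf : ∀ a x, f (r a x) = r' (π a) (f x)) (x : A ⊗[k] N) :
    f ((- muL r) x) = (- muL r') (TensorProduct.map π.toLinearMap f x) := by
  induction x using TensorProduct.induction_on with
  | zero => simp only [map_zero]
  | add x y hx hy => simp only [map_add, hx, hy]
  | tmul b m => simp [hf]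

lemma map_next_r (f : N →ₗ[k] N') (a : A) (x : A ⊗[k] N) :
    TensorProduct.map π.toLinearMap f (tenAct k A N a x)
      = tenAct k B N' (π a) (TensorProduct.map π.toLinearMap f x) := by
  induction x using TensorProduct.induction_on with
  | zero => simp only [map_zero]
  | add x y hx hy => simp only [map_add, hx, hy]
  | tmul b m => simp

lemma map_next_β (f : N →ₗ[k] N') (β : (A ⊗[k] N) →ₗ[k] N) (β' : (B ⊗[k] N') →ₗ[k] N')
    (hβ : ∀ x, f (β x) = β' (TensorProduct.map π.toLinearMap f x)) (x : A ⊗[k] (A ⊗[k] N)) :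
    TensorProduct.map π.toLinearMap f (stepB β x)
      = stepB β' (TensorProduct.map π.toLinearMap (TensorProduct.map π.toLinearMap f) x) := by
  induction x using TensorProduct.induction_on with
  | zero => simp only [map_zero]
  | add x y hx hy => simp only [map_add, hx, hy]
  | tmul b m =>
    simp only [stepB_tmul, map_sub, map_neg, TensorProduct.map_tmul, hβ,
      AlgHom.toLinearMap_apply, map_next_r]

lemma map_d (ε : A →ₐ[k] k) (ε' : B →ₐ[k] k) (h : ∀ a, ε' (π a) = ε a)
    (f : N →ₗ[k] N') (β : (A ⊗[k] N) →ₗ[k] N) (β' : (B ⊗[k] N') →ₗ[k] N')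
    (hβ : ∀ x, f (β x) = β' (TensorProduct.map π.toLinearMap f x)) (x : A ⊗[k] N) :
    f ((etaL N ε + β) x) = (etaL N' ε' + β') (TensorProduct.map π.toLinearMap f x) := by
  rw [LinearMap.add_apply, LinearMap.add_apply, map_add, hβ]
  congr 1
  induction x using TensorProduct.induction_on with
  | zero => simp only [map_zero]
  | add x y hx hy => simp only [map_add, hx, hy]
  | tmul b m => simp [h]

end maps

lemma htpy_start (r : A →ₐ[k] Module.End k N)
    (s : N →ₗ[k] A ⊗[k] N) (hs : ∀ a x, s (r a x) = tenAct k A N a (s x))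
    (hs' : ∀ x, muL r (s x) = x) (x : A ⊗[k] N) :
    stepB (- muL r) (LinearMap.lTensor A s x) - s ((- muL r) x) = (1 : k) • x := by
  induction x using TensorProduct.induction_on with
  | zero => simp
  | add x y hx hy =>
    rw [smul_add, ← hx, ← hy]
    simp only [map_add]
    abel
  | tmul b m =>
    simp only [LinearMap.lTensor_tmul, stepB_tmul, LinearMap.neg_apply, muL_tmul, hs, hs', map_neg,
      TensorProduct.tmul_neg, one_smul]
    abel

lemma htpy_next_r (h : N →ₗ[k] A ⊗[k] N) (a : A) (x : A ⊗[k] N) :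
    LinearMap.lTensor A h (tenAct k A N a x) = tenAct k A _ a (LinearMap.lTensor A h x) := by
  induction x using TensorProduct.induction_on with
  | zero => simp only [map_zero]
  | add x y hx hy => simp only [map_add, hx, hy]
  | tmul b m => simp

lemma htpy_next_β (β : (A ⊗[k] N) →ₗ[k] N) (h : N →ₗ[k] A ⊗[k] N) (u : k)
    (hβ : ∀ x, stepB β (LinearMap.lTensor A h x) - h (β x) = u • x) (x : A ⊗[k] (A ⊗[k] N)) :
    stepB (stepB β) (LinearMap.lTensor A (LinearMap.lTensor A h) x)
      - LinearMap.lTensor A h (stepB β x) = (-u) • x := by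
  induction x using TensorProduct.induction_on with
  | zero => simp
  | add x y hx hy =>
    rw [smul_add, ← hx, ← hy]
    simp only [map_add]
    abel
  | tmul b m =>
    have h4 := congrArg (fun z => b ⊗ₜ[k] z) (hβ m)
    simp only [TensorProduct.tmul_sub, TensorProduct.tmul_smul] at h4
    have h5 : (-u) • b ⊗ₜ[k] m = - (u • b ⊗ₜ[k] m) :=
      neg_smul (R := k) (M := A ⊗[k] (A ⊗[k] N)) u _
    rw [h5, ← h4]
    simp only [stepB_tmul, map_sub, map_neg, LinearMap.lTensor_tmul, htpy_next_r]
    abel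

lemma htpy_d (ε : A →ₐ[k] k) (β : (A ⊗[k] N) →ₗ[k] N) (h : N →ₗ[k] A ⊗[k] N) (u : k)
    (hβ : ∀ x, stepB β (LinearMap.lTensor A h x) - h (β x) = u • x) (x : A ⊗[k] N) :
    (etaL (A ⊗[k] N) ε + stepB β : (A ⊗[k] (A ⊗[k] N)) →ₗ[k] (A ⊗[k] N)) (LinearMap.lTensor A h x)
      - h ((etaL N ε + β) x) = u • x := by
  have h5 : etaL (A ⊗[k] N) ε (LinearMap.lTensor A h x) = h (etaL N ε x) := by
    induction x using TensorProduct.induction_on with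
    | zero => simp only [map_zero]
    | add x y hx hy => simp only [map_add, hx, hy]
    | tmul b m => simp
  rw [← hβ x, LinearMap.add_apply, LinearMap.add_apply, h5, map_add]
  abel

end generic

/-- A stage of the bar complex. -/
structure Stage (k : Type) [CommRing k] (A : Type) [Ring A] [Algebra k A] where
  N : ModuleCat.{0} k
  r : A →ₐ[k] Module.End k N
  β : (A ⊗[k] N) →ₗ[k] N
  h1 : ∀ a x, β (tenAct k A N a x) = r a (β x)
  h2 : ∀ a x, β (a ⊗ₜ β x) = - r a (β x)

/-- the initial stage -/
def Stage.start {M : Type} [AddCommGroup M] [Module k M] (r : A →ₐ[k] Module.End k M) :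
    Stage k A where
  N := ModuleCat.of k M
  r := r
  β := - muL r
  h1 := start_h1 r
  h2 := start_h2 r

/-- the next stage -/
def Stage.next (S : Stage k A) : Stage k A where
  N := ModuleCat.of k (A ⊗[k] S.N)
  r := tenAct k A S.N
  β := stepB S.β
  h1 := stepB_act S.β
  h2 := next_h2 S.r S.β S.h1 S.h2

/-- the differential leaving the next stage -/
def Stage.d (ε : A →ₐ[k] k) (S : Stage k A) : (A ⊗[k] S.N) →ₗ[k] S.N := etaL S.N ε + S.β

/-- all the stages -/
def Stage.it (S : Stage k A) : ℕ → Stage k A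
  | 0 => S
  | (q + 1) => (Stage.it S q).next

/-- the bar complex -/
def Stage.cx (ε : A →ₐ[k] k) (S : Stage k A) : ChainComplex (ModuleCat.{0} k) ℕ :=
  ChainComplex.of (fun q => (S.it q).N) (fun q => ModuleCat.ofHom ((S.it q).d ε)) (fun q => by
    apply ModuleCat.hom_ext
    apply LinearMap.ext
    intro x
    exact d_d ε (S.it q).r (S.it q).β (S.it q).h1 (S.it q).h2 x)

lemma Stage.cx_d (ε : A →ₐ[k] k) (S : Stage k A) (q : ℕ) :
    (S.cx ε).d (q + 1) q = ModuleCat.ofHom ((S.it q).d ε) :=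
  ChainComplex.of_d (fun q => (S.it q).N) (fun q => ModuleCat.ofHom ((S.it q).d ε)) q

/-- morphisms of stages along an algebra map -/
structure SHom (π : A →ₐ[k] B) (S : Stage k A) (T : Stage k B) where
  f : S.N →ₗ[k] T.N
  hr : ∀ a x, f (S.r a x) = T.r (π a) (f x)
  hβ : ∀ x, f (S.β x) = T.β (TensorProduct.map π.toLinearMap f x)

/-- initial morphism -/
def SHom.start (π : A →ₐ[k] B) {M : Type} [AddCommGroup M] [Module k M]
    {M' : Type} [AddCommGroup M'] [Module k M']
    (r : A →ₐ[k] Module.End k M) (r' : B →ₐ[k] Module.End k M') (f : M →ₗ[k] M')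
    (hf : ∀ a x, f (r a x) = r' (π a) (f x)) : SHom π (Stage.start r) (Stage.start r') where
  f := f
  hr := hf
  hβ := map_start_β π r r' f hf

/-- next morphism -/
def SHom.next {π : A →ₐ[k] B} {S : Stage k A} {T : Stage k B} (F : SHom π S T) :
    SHom π S.next T.next where
  f := TensorProduct.map π.toLinearMap F.f
  hr := map_next_r π F.f
  hβ := map_next_β π F.f S.β T.β F.hβ

lemma SHom.d_comm {π : A →ₐ[k] B} {S : Stage k A} {T : Stage k B} (F : SHom π S T)
    (ε : A →ₐ[k] k) (ε' : B →ₐ[k] k) (h : ∀ a, ε' (π a) = ε a) (x : A ⊗[k] S.N) :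
    F.f (S.d ε x) = T.d ε' (TensorProduct.map π.toLinearMap F.f x) := map_d π ε ε' h F.f S.β T.β F.hβ x

/-- iterated morphisms -/
def SHom.it {π : A →ₐ[k] B} {S : Stage k A} {T : Stage k B} (F : SHom π S T) :
    ∀ q, SHom π (S.it q) (T.it q)
  | 0 => F
  | (q + 1) => (SHom.it F q).next

/-- induced map of complexes -/
def SHom.cx {π : A →ₐ[k] B} {S : Stage k A} {T : Stage k B} (F : SHom π S T)
    {ε : A →ₐ[k] k} {ε' : B →ₐ[k] k} (h : ∀ a, ε' (π a) = ε a) : S.cx ε ⟶ T.cx ε' :=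
  ChainComplex.ofHom (fun q => ModuleCat.ofHom (F.it q).f) (fun q => by
    rw [Stage.cx_d, Stage.cx_d]
    apply ModuleCat.hom_ext
    apply LinearMap.ext
    intro x
    exact ((F.it q).d_comm ε ε' h x).symm)

lemma SHom.cx_f {π : A →ₐ[k] B} {S : Stage k A} {T : Stage k B} (F : SHom π S T)
    {ε : A →ₐ[k] k} {ε' : B →ₐ[k] k} (h : ∀ a, ε' (π a) = ε a) (q : ℕ) :
    (F.cx h).f q = ModuleCat.ofHom (F.it q).f := rfl

/-- short exact sequences -/
structure SES {S T U : Stage k A} (f : SHom (AlgHom.id k A) S T) (g : SHom (AlgHom.id k A) T U) :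
    Prop where
  inj : Function.Injective f.f
  surj : Function.Surjective g.f
  exact : Function.Exact f.f g.f

lemma SES.next [Module.Flat k A] {S T U : Stage k A} {f : SHom (AlgHom.id k A) S T}
    {g : SHom (AlgHom.id k A) T U} (h : SES f g) : SES f.next g.next where
  inj := Module.Flat.lTensor_preserves_injective_linearMap (M := A) f.f h.inj
  surj := LinearMap.lTensor_surjective A h.surj
  exact := lTensor_exact A h.exact h.surj

lemma SES.it [Module.Flat k A] {S T U : Stage k A} {f : SHom (AlgHom.id k A) S T}
    {g : SHom (AlgHom.id k A) T U} (h : SES f g) : ∀ q, SES (f.it q) (g.it q)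
  | 0 => h
  | (q + 1) => (SES.it h q).next

/-- the short complex of bar complexes -/
def SES.sc (ε : A →ₐ[k] k) [Module.Flat k A] {S T U : Stage k A} {f : SHom (AlgHom.id k A) S T}
    {g : SHom (AlgHom.id k A) T U} (h : SES f g) :
    ShortComplex (ChainComplex (ModuleCat.{0} k) ℕ) :=
  ShortComplex.mk (f.cx (ε := ε) (ε' := ε) (fun _ => rfl)) (g.cx (fun _ => rfl)) (by
    ext q x
    exact ((h.it q).exact _).2 ⟨x, rfl⟩)

lemma SES.shortExact (ε : A →ₐ[k] k) [Module.Flat k A] {S T U : Stage k A}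
    {f : SHom (AlgHom.id k A) S T}
    {g : SHom (AlgHom.id k A) T U} (h : SES f g) : (h.sc ε).ShortExact := by
  apply HomologicalComplex.shortExact_of_degreewise_shortExact
  intro q
  exact
    { exact := by
        rw [ShortComplex.ShortExact.moduleCat_exact_iff_function_exact]
        exact (h.it q).exact
      mono_f := (ModuleCat.mono_iff_injective _).2 (h.it q).inj
      epi_g := (ModuleCat.epi_iff_surjective _).2 (h.it q).surj }

/-- homotopy data -/
structure SHtpy (S : Stage k A) (u : k) where
  h : S.N →ₗ[k] A ⊗[k] S.N
  hr : ∀ a x, h (S.r a x) = tenAct k A S.N a (h x)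
  hβ : ∀ x, stepB S.β (LinearMap.lTensor A h x) - h (S.β x) = u • x

/-- a section gives homotopy data in degree zero -/
def SHtpy.start {M : Type} [AddCommGroup M] [Module k M] (r : A →ₐ[k] Module.End k M)
    (s : M →ₗ[k] A ⊗[k] M) (hs : ∀ a x, s (r a x) = tenAct k A M a (s x))
    (hs' : ∀ x, muL r (s x) = x) : SHtpy (Stage.start r) 1 where
  h := s
  hr := hs
  hβ := htpy_start r s hs hs'

/-- next homotopy data -/
def SHtpy.next {S : Stage k A} {u : k} (H : SHtpy S u) : SHtpy S.next (-u) where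
  h := LinearMap.lTensor A H.h
  hr := htpy_next_r H.h
  hβ := htpy_next_β S.β H.h u H.hβ

/-- iterated homotopies -/
def SHtpy.it {S : Stage k A} {u : k} (H : SHtpy S u) : ∀ q, SHtpy (S.it q) ((-1) ^ q * u)
  | 0 => { h := H.h, hr := H.hr, hβ := by intro x; rw [pow_zero, one_mul]; exact H.hβ x }
  | (q + 1) =>
    { h := (SHtpy.it H q).next.h
      hr := (SHtpy.it H q).next.hr
      hβ := by
        intro x
        have h3 : ((-1 : k)) ^ (q + 1) * u = - ((-1) ^ q * u) := by ring
        rw [h3]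
        exact (SHtpy.it H q).next.hβ x }

lemma SHtpy.dh {S : Stage k A} {u : k} (H : SHtpy S u) (ε : A →ₐ[k] k) (x : A ⊗[k] S.N) :
    (show A ⊗[k] S.N from S.next.d ε (LinearMap.lTensor A H.h x)) - H.h (S.d ε x) = u • x := htpy_d ε S.β H.h u H.hβ x

lemma exactAt_iff_succ (ε : A →ₐ[k] k) (S : Stage k A) (q : ℕ) :
    (S.cx ε).ExactAt (q + 1) ↔ Function.Exact ((S.it (q + 1)).d ε) ((S.it q).d ε) := by
  rw [HomologicalComplex.exactAt_iff' _ (q + 2) (q + 1) q (by simp) (by simp),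
    ShortComplex.ShortExact.moduleCat_exact_iff_function_exact]
  change Function.Exact ((S.cx ε).d (q + 2) (q + 1)) ((S.cx ε).d (q + 1) q) ↔ _
  rw [Stage.cx_d, Stage.cx_d]
  rfl

lemma exactAt_iff_zero (ε : A →ₐ[k] k) (S : Stage k A) :
    (S.cx ε).ExactAt 0 ↔ Function.Surjective (S.d ε) := by
  rw [HomologicalComplex.exactAt_iff' _ 1 0 0 (by simp) (by simp),
    ShortComplex.ShortExact.moduleCat_exact_iff_function_exact]
  change Function.Exact ((S.cx ε).d 1 0) ((S.cx ε).d 0 0) ↔ _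
  rw [Stage.cx_d, (S.cx ε).shape 0 0 (by simp)]
  constructor
  · intro h x
    exact (h x).1 rfl
  · intro h x
    exact ⟨fun _ => h x, fun _ => rfl⟩

lemma htpy_exact (ε : A →ₐ[k] k) {N : Type} [AddCommGroup N] [Module k N]
    (r : A →ₐ[k] Module.End k N) (β : (A ⊗[k] N) →ₗ[k] N)
    (h1 : ∀ a x, β (tenAct k A N a x) = r a (β x))
    (h2 : ∀ a x, β (a ⊗ₜ β x) = - r a (β x))
    (h : N →ₗ[k] A ⊗[k] N) (u : k) (hu : u * u = 1)
    (hβ : ∀ x, stepB β (LinearMap.lTensor A h x) - h (β x) = u • x) :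
    Function.Exact (etaL (A ⊗[k] N) ε + stepB β : (A ⊗[k] (A ⊗[k] N)) →ₗ[k] (A ⊗[k] N))
      (etaL N ε + β : (A ⊗[k] N) →ₗ[k] N) := by
  intro x
  constructor
  · intro hx
    have h3 := htpy_d ε β h u hβ x
    rw [hx, map_zero, sub_zero] at h3
    refine ⟨u • LinearMap.lTensor A h x, ?_⟩
    rw [map_smul, h3, smul_smul, hu, one_smul]
  · rintro ⟨y, rfl⟩
    exact d_d ε r β h1 h2 y

lemma SHtpy.exactAt {S : Stage k A} (H : SHtpy S 1) (ε : A →ₐ[k] k) (q : ℕ) :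
    (S.cx ε).ExactAt (q + 1) := by
  rw [exactAt_iff_succ]
  refine htpy_exact ε (S.it q).r (S.it q).β (S.it q).h1 (S.it q).h2 (H.it q).h _ ?_ (H.it q).hβ
  rw [mul_one, ← mul_pow]
  simp

end BarCoeff

section Comparison

open CategoryTheory

variable {k : Type} [CommRing k] {A : Type} [Ring A] [Algebra k A] {Q : Type} [Ring Q] [Algebra k Q]

/-- the representation attached to a module -/
abbrev rp (k A M : Type) [CommRing k] [Ring A] [Algebra k A] [AddCommGroup M] [Module k M]
    [Module A M] [IsScalarTower k A M] : A →ₐ[k] Module.End k M := Algebra.lsmul k k M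

/-- the inclusion of a submodule, over `k` -/
abbrev subk (k : Type) {A M : Type} [CommRing k] [Ring A] [Algebra k A] [AddCommGroup M]
    [Module k M] [Module A M] [IsScalarTower k A M] (P : Submodule A M) : P →ₗ[k] M :=
  P.subtype.restrictScalars k

/-- the bar complex of a module -/
def barM (ε : A →ₐ[k] k) (M : Type) [AddCommGroup M] [Module k M] [Module A M]
    [IsScalarTower k A M] : ChainComplex (ModuleCat.{0} k) ℕ :=
  (Stage.start (Algebra.lsmul k k M : A →ₐ[k] Module.End k M)).cx ε

/-- the bar complex is acyclic -/
def Good (ε : A →ₐ[k] k) (M : Type) [AddCommGroup M] [Module k M] [Module A M]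
    [IsScalarTower k A M] : Prop := (barM ε M).Acyclic

section sesA

variable {M₁ M₂ M₃ : Type} [AddCommGroup M₁] [AddCommGroup M₂] [AddCommGroup M₃]
  [Module k M₁] [Module k M₂] [Module k M₃]

/-- the short exact sequence of stages associated with a short exact sequence of modules -/
lemma SES.start (r₁ : A →ₐ[k] Module.End k M₁) (r₂ : A →ₐ[k] Module.End k M₂)
    (r₃ : A →ₐ[k] Module.End k M₃) (f : M₁ →ₗ[k] M₂) (g : M₂ →ₗ[k] M₃)
    (hf : ∀ a x, f (r₁ a x) = r₂ a (f x)) (hg : ∀ a x, g (r₂ a x) = r₃ a (g x))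
    (h1 : Function.Injective f) (h2 : Function.Surjective g) (h3 : Function.Exact f g) :
    SES (SHom.start (AlgHom.id k A) r₁ r₂ f hf) (SHom.start (AlgHom.id k A) r₂ r₃ g hg) where
  inj := h1
  surj := h2
  exact := h3

end sesA

section mods

variable {M₁ M₂ M₃ : Type} [AddCommGroup M₁] [AddCommGroup M₂] [AddCommGroup M₃]
  [Module k M₁] [Module k M₂] [Module k M₃] [Module A M₁] [Module A M₂] [Module A M₃]
  [IsScalarTower k A M₁] [IsScalarTower k A M₂] [IsScalarTower k A M₃]

lemma modSES (f : M₁ →ₗ[A] M₂) (g : M₂ →ₗ[A] M₃)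
    (h1 : Function.Injective f) (h2 : Function.Surjective g) (h3 : Function.Exact f g) :
    SES (SHom.start (AlgHom.id k A) (Algebra.lsmul k k M₁ : A →ₐ[k] Module.End k M₁)
        (Algebra.lsmul k k M₂) (f.restrictScalars k) (fun a x => f.map_smul a x))
      (SHom.start (AlgHom.id k A) (Algebra.lsmul k k M₂ : A →ₐ[k] Module.End k M₂)
        (Algebra.lsmul k k M₃) (g.restrictScalars k) (fun a x => g.map_smul a x)) :=
  SES.start _ _ _ _ _ _ _ h1 h2 h3

lemma quasiIso_of_acyclic {X Y : ChainComplex (ModuleCat.{0} k) ℕ} (hX : X.Acyclic)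
    (hY : Y.Acyclic) (f : X ⟶ Y) : QuasiIso f := by
  rw [quasiIso_iff]
  intro i
  rw [quasiIsoAt_iff_exactAt f i (hX i)]
  exact hY i

lemma Good.of_ses₂ [Module.Flat k A] {ε : A →ₐ[k] k} (f : M₁ →ₗ[A] M₂) (g : M₂ →ₗ[A] M₃)
    (h1 : Function.Injective f) (h2 : Function.Surjective g) (h3 : Function.Exact f g)
    (g1 : Good ε M₁) (g3 : Good ε M₃) : Good ε M₂ :=
  ((modSES f g h1 h2 h3).shortExact ε).acyclic_X₂ g1 g3

lemma Good.of_ses₃ [Module.Flat k A] {ε : A →ₐ[k] k} (f : M₁ →ₗ[A] M₂) (g : M₂ →ₗ[A] M₃)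
    (h1 : Function.Injective f) (h2 : Function.Surjective g) (h3 : Function.Exact f g)
    (g1 : Good ε M₁) (g2 : Good ε M₂) : Good ε M₃ :=
  ((modSES f g h1 h2 h3).shortExact ε).acyclic_X₃ (quasiIso_of_acyclic g1 g2 _)

lemma Good.of_ses₁ [Module.Flat k A] {ε : A →ₐ[k] k} (f : M₁ →ₗ[A] M₂) (g : M₂ →ₗ[A] M₃)
    (h1 : Function.Injective f) (h2 : Function.Surjective g) (h3 : Function.Exact f g)
    (g2 : Good ε M₂) (g3 : Good ε M₃) : Good ε M₁ :=
  ((modSES f g h1 h2 h3).shortExact ε).acyclic_X₁ (quasiIso_of_acyclic g2 g3 _)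

/-- A module with a section of the action map, equal to its augmentation-ideal multiple. -/
lemma Good.of_section {ε : A →ₐ[k] k} (s : M₁ →ₗ[k] A ⊗[k] M₁)
    (hs : ∀ (a : A) (x : M₁), s (a • x) = tenAct k A M₁ a (s x))
    (hs' : ∀ x, muL (Algebra.lsmul k k M₁ : A →ₐ[k] Module.End k M₁) (s x) = x)
    (h0 : ∀ x : M₁, ∃ y : A ⊗[k] M₁,
      etaL M₁ ε y - muL (Algebra.lsmul k k M₁ : A →ₐ[k] Module.End k M₁) y = x) : Good ε M₁ := by
  intro q
  cases q with
  | zero =>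
    refine (exactAt_iff_zero ε _).2 ?_
    intro x
    obtain ⟨y, hy⟩ := h0 x
    refine ⟨y, ?_⟩
    rw [← hy, sub_eq_add_neg]
    rfl
  | succ q =>
    exact (SHtpy.start (Algebra.lsmul k k M₁ : A →ₐ[k] Module.End k M₁) s hs hs').exactAt ε q

lemma free_exactAt (ε : A →ₐ[k] k) (Y : Type) (q : ℕ) :
    (barM ε (Y →₀ A)).ExactAt (q + 1) := by
  classical
  let s : (Y →₀ A) →ₗ[k] A ⊗[k] (Y →₀ A) :=
    Finsupp.lsum k (fun y => (TensorProduct.mk k A (Y →₀ A)).flip (Finsupp.single y 1))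
  have hs1 : ∀ y a, s (Finsupp.single y a) = a ⊗ₜ Finsupp.single y 1 := by
    intro y a
    simp [s]
  refine (SHtpy.start (Algebra.lsmul k k (Y →₀ A) : A →ₐ[k] Module.End k (Y →₀ A))
    s ?_ ?_).exactAt ε q
  · intro a x
    change s (a • x) = _
    induction x using Finsupp.induction_linear with
    | zero => simp only [smul_zero, map_zero]
    | add x y hx hy => simp only [smul_add, map_add, hx, hy]
    | single y b => rw [Finsupp.smul_single, hs1, hs1, tenAct_tmul, smul_eq_mul]
  · intro x
    induction x using Finsupp.induction_linear with
    | zero => simp only [map_zero]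
    | add x y hx hy => simp only [map_add, hx, hy]
    | single y b =>
      rw [hs1, muL_tmul]
      simp

end mods

section theta

variable (π : A →ₐ[k] Q) (εA : A →ₐ[k] k) (εQ : Q →ₐ[k] k) (hε : ∀ a, εQ (π a) = εA a)

/-- the restricted bar complex -/
def barR (N : Type) [AddCommGroup N] [Module k N] [Module Q N] [IsScalarTower k Q N] :
    ChainComplex (ModuleCat.{0} k) ℕ :=
  (Stage.start ((Algebra.lsmul k k N : Q →ₐ[k] Module.End k N).comp π)).cx εA

/-- the comparison stage map -/
def thetaS (N : Type) [AddCommGroup N] [Module k N] [Module Q N] [IsScalarTower k Q N] :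
    SHom π (Stage.start ((Algebra.lsmul k k N : Q →ₐ[k] Module.End k N).comp π))
      (Stage.start (Algebra.lsmul k k N : Q →ₐ[k] Module.End k N)) :=
  SHom.start π _ _ LinearMap.id (fun _ _ => rfl)

/-- the comparison map -/
def theta (N : Type) [AddCommGroup N] [Module k N] [Module Q N] [IsScalarTower k Q N] :
    barR π εA N ⟶ barM εQ N := (thetaS π N).cx hε

lemma thetaS_surj (hπ : Function.Surjective π)
    (N : Type) [AddCommGroup N] [Module k N] [Module Q N] [IsScalarTower k Q N] :
    ∀ q, Function.Surjective ((thetaS π N).it q).f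
  | 0 => fun x => ⟨x, rfl⟩
  | (q + 1) => TensorProduct.map_surjective hπ (thetaS_surj hπ N q)

open Limits in
lemma theta_iso_zero (hπ : Function.Surjective π)
    (N : Type) [AddCommGroup N] [Module k N] [Module Q N] [IsScalarTower k Q N] :
    IsIso (HomologicalComplex.homologyMap (theta π εA εQ hε N) 0) := by
  have hepi : Epi (theta π εA εQ hε N) := by
    have : ∀ i, Epi ((theta π εA εQ hε N).f i) := fun i =>
      (ModuleCat.epi_iff_surjective _).2 (thetaS_surj π hπ N i)
    exact HomologicalComplex.epi_of_epi_f _ this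
  have h1 : Epi (HomologicalComplex.homologyMap (theta π εA εQ hε N) 0) :=
    HomologicalComplex.epi_homologyMap_of_epi_of_not_rel _ 0 (by simp)
  let S := ShortComplex.mk (kernel.ι (theta π εA εQ hε N)) (theta π εA εQ hε N)
    (kernel.condition _)
  have hS : S.ShortExact :=
    { exact := ShortComplex.exact_kernel _
      mono_f := by dsimp [S]; infer_instance
      epi_g := hepi }
  have hiso : IsIso ((theta π εA εQ hε N).f 0) := by
    rw [ConcreteCategory.isIso_iff_bijective]
    exact Function.bijective_id
  have hz : IsZero (S.X₁.X 0) := by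
    rw [IsZero.iff_id_eq_zero]
    have hm : Mono ((kernel.ι (theta π εA εQ hε N)).f 0) := inferInstance
    rw [← cancel_mono ((kernel.ι (theta π εA εQ hε N)).f 0),
      ← cancel_mono ((theta π εA εQ hε N).f 0)]
    have h0 : (kernel.ι (theta π εA εQ hε N)).f 0 ≫ (theta π εA εQ hε N).f 0 = 0 := by
      rw [← HomologicalComplex.comp_f, kernel.condition]
      rfl
    simp [h0]
  have hzh : IsZero (S.X₁.homology 0) := by
    rw [← HomologicalComplex.exactAt_iff_isZero_homology]
    exact ShortComplex.exact_of_isZero_X₂ _ hz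
  have h2 : Mono (HomologicalComplex.homologyMap (theta π εA εQ hε N) 0) :=
    (hS.homology_exact₂ 0).mono_g (hzh.eq_of_src _ _)
  exact isIso_of_mono_of_epi _

lemma theta_comm_it {S T : Stage k A} {S' T' : Stage k Q} (F : SHom (AlgHom.id k A) S T)
    (F' : SHom (AlgHom.id k Q) S' T') (θ₁ : SHom π S S') (θ₂ : SHom π T T')
    (h : ∀ x, θ₂.f (F.f x) = F'.f (θ₁.f x)) :
    ∀ q, ∀ x, (θ₂.it q).f ((F.it q).f x) = (F'.it q).f ((θ₁.it q).f x)
  | 0 => h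
  | (q + 1) => by
    have ih := theta_comm_it F F' θ₁ θ₂ h q
    have ih' : (θ₂.it q).f ∘ₗ (F.it q).f = (F'.it q).f ∘ₗ (θ₁.it q).f := LinearMap.ext ih
    intro x
    have h1 : (TensorProduct.map π.toLinearMap (θ₂.it q).f) ∘ₗ
        (TensorProduct.map (AlgHom.id k A).toLinearMap (F.it q).f)
      = (TensorProduct.map (AlgHom.id k Q).toLinearMap (F'.it q).f) ∘ₗ
        (TensorProduct.map π.toLinearMap (θ₁.it q).f) := by
      rw [← TensorProduct.map_comp, ← TensorProduct.map_comp, ih']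
      rfl
    exact LinearMap.congr_fun h1 x

lemma barR_free_exactAt (hπ : Function.Surjective π) [Module.Flat k A] (Y : Type)
    (P : Submodule A (Y →₀ A)) (hP : ∀ f : Y →₀ A, f ∈ P ↔ ∀ y, π (f y) = 0)
    (hJ : Good εA P) (q : ℕ) :
    (barR π εA (Y →₀ Q)).ExactAt (q + 1) := by
  let g : (Y →₀ A) →ₗ[k] (Y →₀ Q) := Finsupp.mapRange.linearMap π.toLinearMap
  have hSES := SES.start (M₁ := P) (rp k A P)
    (Algebra.lsmul k k (Y →₀ A))
    ((Algebra.lsmul k k (Y →₀ Q) : Q →ₐ[k] Module.End k (Y →₀ Q)).comp π)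
    (subk k P) g (fun a x => rfl)
    (by
      intro a x
      ext y
      simp [g])
    Subtype.val_injective
    (Finsupp.mapRange_surjective _ (map_zero π.toLinearMap) hπ)
    (by
      intro x
      constructor
      · intro hx
        refine ⟨⟨x, (hP x).2 fun y => ?_⟩, rfl⟩
        exact DFunLike.congr_fun hx y
      · rintro ⟨⟨x, hx⟩, rfl⟩
        ext y
        exact (hP x).1 hx y)
  have hS := hSES.shortExact εA
  have h2 : (hSES.sc εA).X₂.ExactAt (q + 1) := free_exactAt εA Y q
  have h1 : (hSES.sc εA).X₁.ExactAt q := hJ q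
  rw [HomologicalComplex.exactAt_iff_isZero_homology] at h1 h2
  refine hS.exactAt_X₃ (q + 1) ⟨fun _ _ _ => h2.eq_of_src _ _⟩ ?_
  intro j hj
  obtain rfl : j = q := by simpa using hj
  exact ⟨fun _ _ _ => h1.eq_of_tgt _ _⟩

lemma theta_free_iso (hπ : Function.Surjective π) [Module.Flat k A]
    (hJ : ∀ (Y : Type) (P : Submodule A (Y →₀ A)), (∀ f : Y →₀ A, f ∈ P ↔ ∀ y, π (f y) = 0) →
      Good εA P) (Y : Type) (q : ℕ) :
    IsIso (HomologicalComplex.homologyMap (theta π εA εQ hε (Y →₀ Q)) q) := by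
  cases q with
  | zero => exact theta_iso_zero π εA εQ hε hπ _
  | succ q =>
    let P : Submodule A (Y →₀ A) :=
      { carrier := {f | ∀ y, π (f y) = 0}
        zero_mem' := by intro y; simp
        add_mem' := by
          intro f g hf hg y
          rw [Finsupp.add_apply, map_add, hf y, hg y, add_zero]
        smul_mem' := by
          intro a f hf y
          rw [Finsupp.smul_apply, smul_eq_mul, map_mul, hf y, mul_zero] }
    have h1 := barR_free_exactAt π εA hπ Y P (fun f => Iff.rfl) (hJ Y P (fun f => Iff.rfl)) q
    have h2 : QuasiIsoAt (theta π εA εQ hε (Y →₀ Q)) (q + 1) := by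
      rw [quasiIsoAt_iff_exactAt _ _ h1]
      exact free_exactAt εQ Y q
    rwa [quasiIsoAt_iff_isIso_homologyMap] at h2

section cover

variable (N : Type) [AddCommGroup N] [Module k N] [Module Q N] [IsScalarTower k Q N]

/-- free cover -/
abbrev cov : (N →₀ Q) →ₗ[Q] N := Finsupp.linearCombination Q id

lemma cov_surj : Function.Surjective (cov (Q := Q) N) :=
  Finsupp.linearCombination_surjective Q Function.surjective_id

lemma covSESQ : SES (SHom.start (M := LinearMap.ker (cov (Q := Q) N)) (AlgHom.id k Q)
      (rp k Q (LinearMap.ker (cov (Q := Q) N)))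
        (rp k Q (N →₀ Q))
        (subk k (LinearMap.ker (cov (Q := Q) N))) (fun _ _ => rfl))
      (SHom.start (AlgHom.id k Q) (rp k Q (N →₀ Q))
        (rp k Q N) ((cov (Q := Q) N).restrictScalars k)
        (fun a x => (cov (Q := Q) N).map_smul a x)) :=
  SES.start _ _ _ _ _ _ _ Subtype.val_injective (cov_surj N)
    (LinearMap.exact_subtype_ker_map (cov (Q := Q) N))

lemma covSESA : SES (SHom.start (M := LinearMap.ker (cov (Q := Q) N)) (AlgHom.id k A)
      ((rp k Q (LinearMap.ker (cov (Q := Q) N))).comp π)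
        ((rp k Q (N →₀ Q)).comp π)
        (subk k (LinearMap.ker (cov (Q := Q) N))) (fun _ _ => rfl))
      (SHom.start (AlgHom.id k A) ((rp k Q (N →₀ Q)).comp π)
        ((rp k Q N).comp π) ((cov (Q := Q) N).restrictScalars k)
        (fun a x => (cov (Q := Q) N).map_smul (π a) x)) :=
  SES.start _ _ _ _ _ _ _ Subtype.val_injective (cov_surj N)
    (LinearMap.exact_subtype_ker_map (cov (Q := Q) N))

/-- morphism of short complexes of bar complexes -/
def covMap [Module.Flat k A] [Module.Flat k Q] :
    (covSESA π N).sc εA ⟶ (covSESQ (k := k) (Q := Q) N).sc εQ where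
  τ₁ := theta π εA εQ hε _
  τ₂ := theta π εA εQ hε _
  τ₃ := theta π εA εQ hε _
  comm₁₂ := by
    ext q x
    exact (theta_comm_it π _ _ (thetaS π _) (thetaS π _) (fun _ => rfl) q x).symm
  comm₂₃ := by
    ext q x
    exact (theta_comm_it π _ _ (thetaS π _) (thetaS π _) (fun _ => rfl) q x).symm

end cover

theorem theta_iso [Module.Flat k A] [Module.Flat k Q] (hπ : Function.Surjective π)
    (hJ : ∀ (Y : Type) (P : Submodule A (Y →₀ A)), (∀ f : Y →₀ A, f ∈ P ↔ ∀ y, π (f y) = 0) →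
      Good εA P) (q : ℕ) :
    ∀ (N : Type) [AddCommGroup N] [Module k N] [Module Q N] [IsScalarTower k Q N],
    IsIso (HomologicalComplex.homologyMap (theta π εA εQ hε N) q) := by
  induction q with
  | zero =>
    intro N _ _ _ _
    exact theta_iso_zero π εA εQ hε hπ N
  | succ q ih =>
    have hfree := theta_free_iso π εA εQ hε hπ hJ
    have hepi : ∀ (N : Type) [AddCommGroup N] [Module k N] [Module Q N] [IsScalarTower k Q N],
        Epi (HomologicalComplex.homologyMap (theta π εA εQ hε N) (q + 1)) := by
      intro N _ _ _ _
      refine HomologicalComplex.HomologySequence.epi_homologyMap_τ₃ (covMap π εA εQ hε N)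
        ((covSESA π N).shortExact εA) ((covSESQ (k := k) (Q := Q) N).shortExact εQ) (q + 1) ?_ ?_ ?_
      · have := hfree N (q + 1)
        exact inferInstanceAs (Epi (HomologicalComplex.homologyMap
          (theta π εA εQ hε (N →₀ Q)) (q + 1)))
      · intro j hj
        obtain rfl : j = q := by simpa using hj
        have := ih (LinearMap.ker (cov (Q := Q) N))
        exact inferInstanceAs (Epi (HomologicalComplex.homologyMap
          (theta π εA εQ hε (LinearMap.ker (cov (Q := Q) N))) j))
      · intro j hj
        have := hfree N j
        exact inferInstanceAs (Mono (HomologicalComplex.homologyMap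
          (theta π εA εQ hε (N →₀ Q)) j))
    intro N _ _ _ _
    refine HomologicalComplex.HomologySequence.isIso_homologyMap_τ₃ (covMap π εA εQ hε N)
        ((covSESA π N).shortExact εA) ((covSESQ (k := k) (Q := Q) N).shortExact εQ) (q + 1)
        (hepi _) (hfree N (q + 1)) ?_ ?_
    · intro j hj
      obtain rfl : j = q := by simpa using hj
      exact ih _
    · intro j hj
      have := hfree N j
      exact inferInstanceAs (Mono (HomologicalComplex.homologyMap
          (theta π εA εQ hε (N →₀ Q)) j))

end theta

end Comparison

section Link

open CategoryTheory

variable {k : Type} [CommRing k] {A : Type} [Ring A] [Algebra k A] {Q : Type} [Ring Q] [Algebra k Q]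

/-- homology of a short complex of modules as an explicit quotient -/
lemma homology_quot (S : ShortComplex (ModuleCat.{0} k)) {C D : Type} [AddCommGroup C] [Module k C]
    [AddCommGroup D] [Module k D] (Z : Submodule k C) (b : D →ₗ[k] C)
    (e : C ≃ₗ[k] S.X₂) (e' : D ≃ₗ[k] S.X₁)
    (hZ : ∀ x, x ∈ Z ↔ S.g.hom (e x) = 0) (hb : ∀ y, e (b y) = S.f.hom (e' y)) :
    Nonempty ((Z ⧸ Submodule.comap Z.subtype (LinearMap.range b)) ≃ₗ[k] S.homology) := by
  have hmap : Z.map (e : C →ₗ[k] S.X₂) = LinearMap.ker S.g.hom := by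
    ext x
    constructor
    · rintro ⟨y, hy, rfl⟩
      exact (hZ y).1 hy
    · intro hx
      refine ⟨e.symm x, (hZ _).2 ?_, ?_⟩
      · rw [e.apply_symm_apply]
        exact hx
      · exact e.apply_symm_apply x
  let e2 : Z ≃ₗ[k] LinearMap.ker S.g.hom := (e.submoduleMap Z).trans (LinearEquiv.ofEq _ _ hmap)
  have he2 : ∀ z : Z, ((e2 z : LinearMap.ker S.g.hom) : S.X₂) = e z := fun z => rfl
  have e3 : (Z ⧸ Submodule.comap Z.subtype (LinearMap.range b)) ≃ₗ[k]
      (LinearMap.ker S.g.hom ⧸ LinearMap.range S.moduleCatToCycles) := by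
    refine Submodule.Quotient.equiv _ _ e2 ?_
    ext x
    constructor
    · rintro ⟨y, hy, rfl⟩
      obtain ⟨d, hd⟩ := hy
      refine ⟨e' d, ?_⟩
      apply Subtype.ext
      change S.f.hom (e' d) = e y
      rw [← hb, hd]
      rfl
    · rintro ⟨y, rfl⟩
      refine ⟨e2.symm (S.moduleCatToCycles y), ?_, e2.apply_symm_apply _⟩
      refine ⟨e'.symm y, ?_⟩
      apply e.injective
      rw [hb, e'.apply_symm_apply]
      change _ = e ((e2.symm (S.moduleCatToCycles y) : Z) : C)
      rw [← he2, e2.apply_symm_apply]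
      rfl
  exact ⟨e3.trans (S.moduleCatHomologyIso.symm.toLinearEquiv)⟩

/-- the trivial module -/
def trivRep (ε : A →ₐ[k] k) : A →ₐ[k] Module.End k k := (Algebra.lsmul k k k : k →ₐ[k] _).comp ε

variable (k A) in
/-- comparison of the two models -/
def barE (ε : A →ₐ[k] k) : ∀ q, (barC k A q : Type) ≃ₗ[k] (((Stage.start (trivRep ε)).it q).N : Type)
  | 0 => LinearEquiv.refl k k
  | (q + 1) => LinearEquiv.lTensor A (barE ε q)

lemma tenAct_eq {N : Type} [AddCommGroup N] [Module k N] (a : A) (x : A ⊗[k] N) :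
    TensorProduct.map (LinearMap.mulLeft k a) LinearMap.id x = tenAct k A N a x := rfl

lemma barE_B (ε : A →ₐ[k] k) : ∀ q (x : A ⊗[k] (barC k A q : Type)),
    barE k A ε q (barB k A ε q x)
      = ((Stage.start (trivRep ε)).it q).β (LinearMap.lTensor A (barE k A ε q).toLinearMap x)
  | 0, x => by
    have : barB k A ε 0 = - muL (trivRep ε) := rfl
    have h2 : ∀ y : A ⊗[k] k, LinearMap.lTensor A (LinearEquiv.refl k k).toLinearMap y = y := by
      intro y
      rw [LinearEquiv.refl_toLinearMap, LinearMap.lTensor_id]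
      rfl
    rw [this]
    exact congrArg (- muL (trivRep ε)) (h2 x).symm
  | (q + 1), x => by
    have ih := barE_B ε q
    have key : ∀ (N N' : Type) [AddCommGroup N] [Module k N] [AddCommGroup N'] [Module k N']
        (f : N →ₗ[k] N') (β : A ⊗[k] N →ₗ[k] N) (β' : A ⊗[k] N' →ₗ[k] N')
        (_ : ∀ x, f (β x) = β' (LinearMap.lTensor A f x)) (x : A ⊗[k] (A ⊗[k] N)),
        LinearMap.lTensor A f (stepB β x)
          = stepB β' (LinearMap.lTensor A (LinearMap.lTensor A f) x) := by
      intro N N' _ _ _ _ f β β' h x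
      exact map_next_β (AlgHom.id k A) f β β' h x
    have h3 := key (barC k A q : Type) (((Stage.start (trivRep ε)).it q).N : Type)
      (barE k A ε q).toLinearMap (barB k A ε q) ((Stage.start (trivRep ε)).it q).β ih x
    have h4 : barB k A ε (q + 1) = stepB (barB k A ε q) := by
      refine TensorProduct.ext' fun a y => ?_
      rfl
    rw [h4]
    exact h3

lemma barE_d (ε : A →ₐ[k] k) (q : ℕ) (x : A ⊗[k] (barC k A q : Type)) :
    barE k A ε q (bard k A ε q x)
      = ((Stage.start (trivRep ε)).it q).d ε (barE k A ε (q + 1) x) :=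
  map_d (N := (barC k A q : Type)) (N' := (((Stage.start (trivRep ε)).it q).N : Type))
    (AlgHom.id k A) ε ε (fun _ => rfl) (barE k A ε q).toLinearMap (barB k A ε q)
    ((Stage.start (trivRep ε)).it q).β (barE_B ε q) x

lemma barTor_homology (ε : A →ₐ[k] k) (q : ℕ) :
    Nonempty (barTor k A ε q ≃ₗ[k] ((Stage.start (trivRep ε)).cx ε).homology q) := by
  let K := (Stage.start (trivRep ε)).cx ε
  cases q with
  | zero =>
    obtain ⟨e⟩ := homology_quot (K.sc' 1 0 0) (barCycles k A ε 0) (bard k A ε 0)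
      (barE k A ε 0) (barE k A ε 1) (by
        intro x
        refine ⟨fun _ => ?_, fun _ => trivial⟩
        change (K.d 0 0).hom _ = 0
        rw [K.shape 0 0 (by simp)]
        rfl) (by
        intro y
        change _ = (K.d 1 0).hom _
        rw [Stage.cx_d]
        exact barE_d ε 0 y)
    exact ⟨LinearEquiv.trans e (K.homologyIsoSc' 1 0 0 (by simp) (by simp)).symm.toLinearEquiv⟩
  | succ q =>
    obtain ⟨e⟩ := homology_quot (K.sc' (q + 2) (q + 1) q) (barCycles k A ε (q + 1))
      (bard k A ε (q + 1))
      (barE k A ε (q + 1)) (barE k A ε (q + 2)) (by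
        intro x
        change bard k A ε q x = 0 ↔ (K.d (q + 1) q).hom _ = 0
        rw [Stage.cx_d]
        have h5 := barE_d ε q x
        constructor
        · intro hx
          rw [hx, map_zero] at h5
          exact h5.symm
        · intro hx
          apply (barE k A ε q).injective
          rw [map_zero]
          exact h5.trans hx) (by
        intro y
        change _ = (K.d (q + 2) (q + 1)).hom _
        rw [Stage.cx_d]
        exact barE_d ε (q + 1) y)
    exact ⟨LinearEquiv.trans e
      (K.homologyIsoSc' (q + 2) (q + 1) q (by simp) (by simp)).symm.toLinearEquiv⟩

/-- The comparison theorem for bar homology. -/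
theorem barTor_compare (π : A →ₐ[k] Q) (εA : A →ₐ[k] k) (εQ : Q →ₐ[k] k)
    (hε : ∀ a, εQ (π a) = εA a) [Module.Flat k A] [Module.Flat k Q] (hπ : Function.Surjective π)
    (hJ : ∀ (Y : Type) (P : Submodule A (Y →₀ A)), (∀ f : Y →₀ A, f ∈ P ↔ ∀ y, π (f y) = 0) →
      Good εA P) (q : ℕ) :
    Nonempty (barTor k A εA q ≃ₗ[k] barTor k Q εQ q) := by
  let _ : Module Q k := Module.compHom k εQ.toRingHom
  have : IsScalarTower k Q k := ⟨fun c a x => by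
    change εQ (c • a) * x = c * (εQ a * x)
    rw [map_smul, smul_eq_mul, mul_assoc]⟩
  have h := theta_iso π εA εQ hε hπ hJ q k
  have hA : (Stage.start (trivRep εA)).cx εA = barR π εA k := by
    have : trivRep εA = (rp k Q k).comp π := by
      ext a
      change εA a * 1 = εQ (π a) * 1
      rw [hε]
    unfold barR
    rw [this]
  have hQ : (Stage.start (trivRep εQ)).cx εQ = barM εQ k := rfl
  obtain ⟨e1⟩ := barTor_homology εA q
  obtain ⟨e2⟩ := barTor_homology εQ q
  rw [hA] at e1
  rw [hQ] at e2
  exact ⟨(e1.trans (asIso (HomologicalComplex.homologyMap (theta π εA εQ hε k) q)).toLinearEquiv).trans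
    e2.symm⟩

end Link

section Filtration

variable {k : Type} [CommRing k] {A : Type} [Ring A] [Algebra k A]

/-- A basis filtered by finite sets, as for diagram algebras. -/
structure FiltBasis (ε : A →ₐ[k] k) (X κ : Type) where
  b : Module.Basis X k A
  T : X → Finset κ
  bound : ℕ
  card_le : ∀ x, (T x).card ≤ bound
  up : ∀ a x x', b.repr (a * b x) x' ≠ 0 → T x ⊆ T x'
  gen : ∀ x y, T y ⊆ T x → ∃ a, b x = a * b y
  idem : ∀ y, T y ≠ ∅ → ∃ c, b y * c * b y = b y
  aug : ∀ y, T y ≠ ∅ → ε (b y) = 0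

variable {ε : A →ₐ[k] k} {X κ : Type} (F : FiltBasis ε X κ)

/-- up-closed sets of indices -/
def UpC {Y : Type} (U : Set (Y × Finset κ)) : Prop :=
  ∀ y t t', (y, t) ∈ U → t ⊆ t' → (y, t') ∈ U

lemma FiltBasis.up' (a z : A) (x' : X) (h : F.b.repr (a * z) x' ≠ 0) :
    ∃ x, F.b.repr z x ≠ 0 ∧ F.T x ⊆ F.T x' := by
  by_contra hcon
  push Not at hcon
  apply h
  have hz : a * z = ∑ x ∈ (F.b.repr z).support, F.b.repr z x • (a * F.b x) := by
    conv_lhs => rw [← F.b.linearCombination_repr z]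
    rw [Finsupp.linearCombination_apply, Finsupp.sum, Finset.mul_sum]
    refine Finset.sum_congr rfl fun x _ => ?_
    rw [mul_smul_comm]
  rw [hz, map_sum, Finsupp.finsetSum_apply]
  refine Finset.sum_eq_zero fun x hx => ?_
  rw [map_smul, Finsupp.smul_apply]
  by_cases h0 : F.b.repr (a * F.b x) x' = 0
  · rw [h0, smul_zero]
  · exact absurd (F.up a x x' h0) (hcon x (Finsupp.mem_support_iff.1 hx))

/-- the submodule attached to an up-closed set -/
def FiltBasis.sub {Y : Type} (U : Set (Y × Finset κ)) (hU : UpC U) : Submodule A (Y →₀ A) where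
  carrier := {f | ∀ y x, F.b.repr (f y) x ≠ 0 → (y, F.T x) ∈ U}
  zero_mem' := by
    intro y x h
    simp at h
  add_mem' := by
    intro f g hf hg y x h
    by_cases h1 : F.b.repr (f y) x = 0
    · apply hg
      intro h2
      apply h
      rw [Finsupp.add_apply, map_add, Finsupp.add_apply, h1, h2, add_zero]
    · exact hf _ _ h1
  smul_mem' := by
    intro a f hf y x h
    obtain ⟨x', h1, h2⟩ := F.up' a (f y) x h
    exact hU _ _ _ (hf _ _ h1) h2

lemma FiltBasis.mem_sub {Y : Type} {U : Set (Y × Finset κ)} {hU : UpC U} {f : Y →₀ A} :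
    f ∈ F.sub U hU ↔ ∀ y x, F.b.repr (f y) x ≠ 0 → (y, F.T x) ∈ U := Iff.rfl

lemma FiltBasis.single_mem {Y : Type} {U : Set (Y × Finset κ)} {hU : UpC U} (y : Y) (x : X)
    (h : (y, F.T x) ∈ U) : Finsupp.single y (F.b x) ∈ F.sub U hU := by
  classical
  intro y' x' h'
  rw [Finsupp.single_apply] at h'
  split_ifs at h' with hy
  · subst hy
    rw [Module.Basis.repr_self, Finsupp.single_apply] at h'
    split_ifs at h' with hx
    · subst hx
      exact h
    · exact absurd rfl h'
  · simp at h'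

lemma FiltBasis.mem_span {Y : Type} {U : Set (Y × Finset κ)} {hU : UpC U} {f : Y →₀ A}
    (hf : f ∈ F.sub U hU) :
    f ∈ Submodule.span k {g | ∃ y x, (y, F.T x) ∈ U ∧ g = Finsupp.single y (F.b x)} := by
  rw [← Finsupp.sum_single f]
  refine Submodule.sum_mem _ fun y _ => ?_
  rw [← F.b.linearCombination_repr (f y), Finsupp.linearCombination_apply]
  rw [Finsupp.sum, Finsupp.single_finsetSum]
  refine Submodule.sum_mem _ fun x hx => ?_
  rw [← Finsupp.smul_single]
  exact Submodule.smul_mem _ _ (Submodule.subset_span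
    ⟨y, x, hf y x (Finsupp.mem_support_iff.1 hx), rfl⟩)

lemma good_of_subsingleton {M : Type} [AddCommGroup M] [Module k M] [Module A M]
    [IsScalarTower k A M] [Subsingleton M] : Good ε M := by
  refine Good.of_section 0 ?_ ?_ ?_
  · intro a x
    simp
  · intro x
    exact Subsingleton.elim _ _
  · intro x
    exact ⟨0, Subsingleton.elim _ _⟩

lemma Good.prod [Module.Flat k A] {M N : Type} [AddCommGroup M] [Module k M] [Module A M]
    [IsScalarTower k A M] [AddCommGroup N] [Module k N] [Module A N]
    [IsScalarTower k A N] (hM : Good ε M) (hN : Good ε N) : Good ε (M × N) :=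
  Good.of_ses₂ (LinearMap.inl A M N) (LinearMap.snd A M N) LinearMap.inl_injective
    LinearMap.snd_surjective .inl_snd hM hN

lemma FiltBasis.exists_gen {Y : Type} {U : Set (Y × Finset κ)} {hU : UpC U} {f : Y →₀ A}
    (hf : f ∈ F.sub U hU) (y : Y) (x₀ : X) (h : ∀ t, (y, t) ∈ U → F.T x₀ ⊆ t) :
    ∃ a, f y = a * F.b x₀ := by
  have h1 : f y ∈ LinearMap.range (LinearMap.mulRight k (F.b x₀)) := by
    rw [← F.b.linearCombination_repr (f y), Finsupp.linearCombination_apply]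
    refine Submodule.sum_mem _ fun x hx => Submodule.smul_mem _ _ ?_
    obtain ⟨a, ha⟩ := F.gen x x₀ (h _ (hf y x (Finsupp.mem_support_iff.1 hx)))
    exact ⟨a, ha.symm⟩
  obtain ⟨a, ha⟩ := h1
  exact ⟨a, ha.symm⟩

/-- Direct sums of the principal left ideals are good. -/
lemma FiltBasis.good_principal {Y : Type} (rep : Y → X)
    (hrep : ∀ y, F.T (rep y) ≠ ∅) (U : Set (Y × Finset κ)) (hU : UpC U)
    (hUr : ∀ y t, (y, t) ∈ U ↔ F.T (rep y) ⊆ t) : Good ε (F.sub U hU) := by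
  classical
  choose c hc using fun y => F.idem (rep y) (hrep y)
  have hmem : ∀ y, Finsupp.single y (F.b (rep y)) ∈ F.sub U hU := fun y =>
    F.single_mem y _ ((hUr _ _).2 subset_rfl)
  let s₀ : (Y →₀ A) →ₗ[k] A ⊗[k] (F.sub U hU) :=
    Finsupp.lsum k fun y => ((TensorProduct.mk k A (F.sub U hU)).flip ⟨_, hmem y⟩).comp
      (LinearMap.mulRight k (c y))
  have hs₀ : ∀ y a, s₀ (Finsupp.single y a) = (a * c y) ⊗ₜ ⟨_, hmem y⟩ := by
    intro y a
    simp [s₀]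
  have hgen : ∀ (f : F.sub U hU) y, ∃ a, (f : Y →₀ A) y = a * F.b (rep y) := fun f y =>
    F.exists_gen f.2 y _ fun t ht => (hUr _ _).1 ht
  have hsum : ∀ f : F.sub U hU, s₀ f.1 = ∑ y ∈ f.1.support, (f.1 y * c y) ⊗ₜ ⟨_, hmem y⟩ := by
    intro f
    conv_lhs => rw [← Finsupp.sum_single f.1]
    rw [Finsupp.sum, map_sum]
    exact Finset.sum_congr rfl fun y _ => hs₀ y _
  have hmu : ∀ f : F.sub U hU, muL (rp k A (F.sub U hU)) (s₀ f.1) = f := by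
    intro f
    rw [hsum, map_sum]
    apply Subtype.ext
    rw [AddSubmonoidClass.coe_finsetSum]
    conv_rhs => rw [← Finsupp.sum_single f.1]
    rw [Finsupp.sum]
    refine Finset.sum_congr rfl fun y _ => ?_
    change (f.1 y * c y) • Finsupp.single y (F.b (rep y)) = _
    obtain ⟨a, ha⟩ := hgen f y
    rw [Finsupp.smul_single, smul_eq_mul, ha, mul_assoc, mul_assoc, ← mul_assoc (F.b _), hc]
  have heta : ∀ f : F.sub U hU, etaL (F.sub U hU) ε (s₀ f.1) = 0 := by
    intro f
    rw [hsum, map_sum]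
    refine Finset.sum_eq_zero fun y _ => ?_
    obtain ⟨a, ha⟩ := hgen f y
    rw [etaL_tmul, ha, map_mul, map_mul, F.aug _ (hrep y), mul_zero, zero_mul, zero_smul]
  refine Good.of_section (s₀.comp (subk k (F.sub U hU))) ?_ hmu ?_
  · intro a f
    change s₀ (a • f.1) = tenAct k A (F.sub U hU) a (s₀ f.1)
    have : ∀ g : Y →₀ A, s₀ (a • g) = tenAct k A (F.sub U hU) a (s₀ g) := by
      intro g
      induction g using Finsupp.induction_linear with
      | zero => simp only [smul_zero, map_zero]
      | add x y hx hy => simp only [smul_add, map_add, hx, hy]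
      | single y b => rw [Finsupp.smul_single, hs₀, hs₀, tenAct_tmul, smul_eq_mul, mul_assoc]
    exact this _
  · intro f
    refine ⟨- s₀ f.1, ?_⟩
    rw [map_neg, map_neg, heta, hmu]
    simp

theorem FiltBasis.good_sub [Module.Flat k A] : ∀ (m r : ℕ) (_ : F.bound + 1 ≤ r + m) (_ : 1 ≤ r)
    (Y : Type) (U : Set (Y × Finset κ)) (hU : UpC U) (_ : ∀ y t, (y, t) ∈ U → r ≤ t.card),
    Good ε (F.sub U hU) := by
  classical
  intro m
  induction m with
  | zero =>
    intro r hr _ Y U hU hc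
    have : Subsingleton (F.sub U hU) := by
      refine ⟨fun f g => ?_⟩
      have h0 : ∀ f : F.sub U hU, f = 0 := by
        intro f
        apply Subtype.ext
        ext y
        change f.1 y = 0
        rw [← F.b.repr.map_eq_zero_iff]
        ext x
        by_contra h
        have h1 := hc _ _ (f.2 y x h)
        have h2 := F.card_le x
        omega
      rw [h0 f, h0 g]
    exact good_of_subsingleton
  | succ m ih =>
    intro r hr hr1 Y U hU hc
    have IH := ih (r + 1) (by omega) (by omega)
    -- the part of larger size
    let U1 : Set (Y × Finset κ) := {p | p ∈ U ∧ r + 1 ≤ p.2.card}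
    have hU1 : UpC U1 := fun y t t' h h' => ⟨hU _ _ _ h.1 h', h.2.trans (Finset.card_le_card h')⟩
    have g1 : Good ε (F.sub U1 hU1) := IH Y U1 hU1 fun y t h => h.2
    -- the minimal part
    let Y' : Type := {p : Y × X // (p.1, F.T p.2) ∈ U ∧ (F.T p.2).card = r ∧
      ∀ x, F.T x = F.T p.2 → p.2 = Classical.epsilon (h := ⟨x⟩) (fun x' => F.T x' = F.T x) }
    have hY'inj : ∀ y₁ y₂ : Y', y₁.1.1 = y₂.1.1 → F.T y₁.1.2 = F.T y₂.1.2 → y₁ = y₂ := by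
      intro y₁ y₂ h1 h2
      apply Subtype.ext
      refine Prod.ext h1 ?_
      rw [y₁.2.2.2 _ rfl, y₂.2.2.2 _ h2]
    have hY'ex : ∀ y x, (y, F.T x) ∈ U → (F.T x).card = r →
        ∃ y' : Y', y'.1.1 = y ∧ F.T y'.1.2 = F.T x := by
      intro y x h1 h2
      have h3 : F.T (Classical.epsilon (h := ⟨x⟩) (fun x' => F.T x' = F.T x)) = F.T x :=
        Classical.epsilon_spec (p := fun x' => F.T x' = F.T x) ⟨x, rfl⟩
      refine ⟨⟨(y, Classical.epsilon (h := ⟨x⟩) (fun x' => F.T x' = F.T x)), ?_, ?_, ?_⟩, rfl, h3⟩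
      · change (y, F.T _) ∈ U
        rw [h3]
        exact h1
      · change (F.T _).card = r
        rw [h3]
        exact h2
      · intro x' h4
        change F.T x' = F.T (Classical.epsilon (h := ⟨x⟩) (fun x' => F.T x' = F.T x)) at h4
        rw [h3] at h4
        change (Classical.epsilon (h := ⟨x⟩) (fun x' => F.T x' = F.T x)) = _
        rw [h4]
    let p : Y' → Y := fun y' => y'.1.1
    let V : Set (Y' × Finset κ) := {q | F.T q.1.1.2 ⊆ q.2}
    have hV : UpC V := fun y t t' h h' => h.trans h'
    let V1 : Set (Y' × Finset κ) := {q | q ∈ V ∧ r + 1 ≤ q.2.card}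
    have hV1 : UpC V1 := fun y t t' h h' => ⟨hV _ _ _ h.1 h', h.2.trans (Finset.card_le_card h')⟩
    have gV : Good ε (F.sub V hV) := by
      refine F.good_principal (fun y' => y'.1.2) ?_ V hV (fun y t => Iff.rfl)
      intro y' h
      have := y'.2.2.1
      rw [h, Finset.card_empty] at this
      omega
    have gV1 : Good ε (F.sub V1 hV1) := IH Y' V1 hV1 fun y t h => h.2
    let φ₀ : (Y' →₀ A) →ₗ[A] (Y →₀ A) := Finsupp.lmapDomain A A p
    -- coefficients of `φ₀`
    have hφ₀ : ∀ (f : Y' →₀ A) y x, F.b.repr (φ₀ f y) x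
        = ∑ y' ∈ f.support, if p y' = y then F.b.repr (f y') x else 0 := by
      intro f y x
      change F.b.repr (Finsupp.mapDomain p f y) x = _
      rw [Finsupp.mapDomain, Finsupp.sum, Finsupp.finsetSum_apply, map_sum,
        Finsupp.finsetSum_apply]
      refine Finset.sum_congr rfl fun y' _ => ?_
      rw [Finsupp.single_apply]
      split_ifs <;> simp
    have hφV : ∀ f ∈ F.sub V hV, φ₀ f ∈ F.sub U hU := by
      intro f hf y x h
      rw [hφ₀] at h
      obtain ⟨y', _, h2⟩ := Finset.exists_ne_zero_of_sum_ne_zero h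
      split_ifs at h2 with h3
      · rw [← h3]
        exact hU _ _ _ y'.2.1 (hf y' x h2)
      · exact absurd rfl h2
    have hφV1 : ∀ f ∈ F.sub V1 hV1, φ₀ f ∈ F.sub U1 hU1 := by
      intro f hf y x h
      rw [hφ₀] at h
      obtain ⟨y', _, h2⟩ := Finset.exists_ne_zero_of_sum_ne_zero h
      split_ifs at h2 with h3
      · rw [← h3]
        exact ⟨hU _ _ _ y'.2.1 (hf y' x h2).1, (hf y' x h2).2⟩
      · exact absurd rfl h2
    have hV1V : F.sub V1 hV1 ≤ F.sub V hV := fun f hf y x h => (hf y x h).1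
    have hU1U : F.sub U1 hU1 ≤ F.sub U hU := fun f hf y x h => (hf y x h).1
    let φ : F.sub V hV →ₗ[A] F.sub U hU := φ₀.restrict hφV
    let φ1 : F.sub V1 hV1 →ₗ[A] F.sub U1 hU1 :=
      { toFun := fun f => ⟨- φ₀ f.1, Submodule.neg_mem _ (hφV1 _ f.2)⟩
        map_add' := fun f g => Subtype.ext (by
          change - φ₀ (f.1 + g.1) = - φ₀ f.1 + - φ₀ g.1
          rw [map_add, neg_add])
        map_smul' := fun a f => Subtype.ext (by
          change - φ₀ (a • f.1) = a • - φ₀ f.1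
          rw [map_smul, smul_neg]) }
    let f1 : F.sub V1 hV1 →ₗ[A] (F.sub V hV × F.sub U1 hU1) :=
      LinearMap.prod (Submodule.inclusion hV1V) φ1
    let f2 : (F.sub V hV × F.sub U1 hU1) →ₗ[A] F.sub U hU :=
      LinearMap.coprod φ (Submodule.inclusion hU1U)
    refine Good.of_ses₃ f1 f2 ?_ ?_ ?_ gV1 (gV.prod g1)
    · intro x y h
      have h1 := congrArg (fun z => (z.1 : Y' →₀ A)) h
      exact Subtype.ext h1
    · intro z
      have hz := F.mem_span z.2
      have key : Submodule.span k {g | ∃ y x, (y, F.T x) ∈ U ∧ g = Finsupp.single y (F.b x)}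
          ≤ LinearMap.range (((F.sub U hU).subtype.comp f2).restrictScalars k) := by
        rw [Submodule.span_le]
        rintro _ ⟨y, x, hyx, rfl⟩
        by_cases hcard : (F.T x).card = r
        · obtain ⟨y', hy', hx'⟩ := hY'ex y x hyx hcard
          have hm : Finsupp.single y' (F.b x) ∈ F.sub V hV :=
            F.single_mem y' x (show F.T y'.1.2 ⊆ F.T x by rw [hx'])
          refine ⟨(⟨_, hm⟩, 0), ?_⟩
          change φ₀ (Finsupp.single y' (F.b x)) + 0 = _
          rw [add_zero]
          change Finsupp.mapDomain p _ = _
          rw [Finsupp.mapDomain_single]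
          change Finsupp.single y'.1.1 _ = _
          rw [hy']
        · have hm : Finsupp.single y (F.b x) ∈ F.sub U1 hU1 :=
            F.single_mem y x ⟨hyx, by have := hc _ _ hyx; change r + 1 ≤ (F.T x).card; omega⟩
          refine ⟨(0, ⟨_, hm⟩), ?_⟩
          change φ₀ 0 + _ = _
          rw [map_zero, zero_add]
          rfl
      obtain ⟨w, hw⟩ := key hz
      exact ⟨w, Subtype.ext hw⟩
    · intro w
      constructor
      · intro hw
        have hw1 : φ₀ w.1.1 + w.2.1 = 0 := congrArg Subtype.val hw
        have hmem : w.1.1 ∈ F.sub V1 hV1 := by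
          intro y' x h
          have hsub : F.T y'.1.2 ⊆ F.T x := w.1.2 y' x h
          refine ⟨hsub, ?_⟩
          by_contra hcon
          have hcon' : (F.T x).card ≤ r := by
            change ¬ (r + 1 ≤ (F.T x).card) at hcon
            omega
          have heq : F.T y'.1.2 = F.T x :=
            Finset.eq_of_subset_of_card_le hsub (by rw [y'.2.2.1]; exact hcon')
          have h3 : F.b.repr (φ₀ w.1.1 (p y')) x = F.b.repr (w.1.1 y') x := by
            rw [hφ₀, Finset.sum_eq_single y']
            · rw [if_pos rfl]
            · intro y₂ _ hne
              split_ifs with hp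
              · by_contra h4
                have h5 : F.T y₂.1.2 ⊆ F.T x := w.1.2 y₂ x h4
                apply hne
                apply hY'inj _ _ hp
                rw [heq]
                exact Finset.eq_of_subset_of_card_le h5 (by rw [y₂.2.2.1]; exact hcon')
              · rfl
            · intro h4
              rw [if_pos rfl, Finsupp.notMem_support_iff.1 h4]
              simp
          have h6 : φ₀ w.1.1 = - w.2.1 := eq_neg_of_add_eq_zero_left hw1
          have h7 : F.b.repr (w.2.1 (p y')) x ≠ 0 := by
            intro h8
            apply h
            rw [← h3, h6, Finsupp.neg_apply, map_neg, Finsupp.neg_apply, h8, neg_zero]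
          exact hcon (w.2.2 _ _ h7).2
        refine ⟨⟨w.1.1, hmem⟩, ?_⟩
        refine Prod.ext (Subtype.ext rfl) (Subtype.ext ?_)
        change - φ₀ w.1.1 = w.2.1
        exact (eq_neg_of_add_eq_zero_right hw1).symm
      · rintro ⟨z, rfl⟩
        apply Subtype.ext
        change φ₀ z.1 + - φ₀ z.1 = 0
        exact add_neg_cancel _

/-- The conclusion needed for the comparison theorem. -/
theorem FiltBasis.good [Module.Flat k A] (Y : Type) (P : Submodule A (Y →₀ A))
    (hP : ∀ f : Y →₀ A, f ∈ P ↔ ∀ y x, F.b.repr (f y) x ≠ 0 → F.T x ≠ ∅) : Good ε P := by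
  let U : Set (Y × Finset κ) := {p | p.2 ≠ ∅}
  have hU : UpC U := by
    intro y t t' h h' h0
    exact h (Finset.subset_empty.1 (h0 ▸ h'))
  have : P = F.sub U hU := by
    ext f
    exact hP f
  rw [this]
  exact F.good_sub F.bound 1 (by omega) le_rfl Y U hU fun y t h =>
    Finset.one_le_card.2 (Finset.nonempty_iff_ne_empty.2 h)

end Filtration

section Coxeter

lemma swap_braid₂ {α : Type} [DecidableEq α] (a b c : α)
    (hab : a ≠ b) (hac : a ≠ c) (hbc : b ≠ c) :
    Equiv.swap a b * Equiv.swap b c * Equiv.swap a b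
      = Equiv.swap b c * Equiv.swap a b * Equiv.swap b c := by
  have h1 : Equiv.swap b c * Equiv.swap a b * Equiv.swap b c = Equiv.swap c a :=
    Equiv.swap_mul_swap_mul_swap hab hac
  have h2 : Equiv.swap b a * Equiv.swap c b * Equiv.swap b a = Equiv.swap a c :=
    Equiv.swap_mul_swap_mul_swap hbc.symm hac.symm
  rw [Equiv.swap_comm b a, Equiv.swap_comm c b] at h2
  rw [h1, h2, Equiv.swap_comm]

lemma swap_swap_comm₂ {α : Type} [DecidableEq α] (a b c d : α)
    (hac : a ≠ c) (had : a ≠ d) (hbc : b ≠ c) (hbd : b ≠ d) :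
    Equiv.swap a b * Equiv.swap c d = Equiv.swap c d * Equiv.swap a b := by
  have h := Equiv.swap_apply_apply (Equiv.swap c d) a b
  rw [Equiv.swap_apply_of_ne_of_ne hac had, Equiv.swap_apply_of_ne_of_ne hbc hbd] at h
  exact eq_mul_inv_iff_mul_eq.mp h

/-- descending products of generators -/
def coxC {H : Type} [Group H] (s : ℕ → H) (m : ℕ) : ℕ → H
  | 0 => 1
  | d + 1 => coxC s m d * s (m - d)

lemma coxC_comm {H : Type} [Group H] (s : ℕ → H) (m : ℕ)
    (hc : ∀ i j, i + 1 < j → j ≤ m → s i * s j = s j * s i) (i : ℕ) :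
    ∀ d, i + d < m + 0 → coxC s m d * s i = s i * coxC s m d := by
  intro d
  induction d with
  | zero => intro _; simp [coxC]
  | succ d ih =>
    intro h
    rw [coxC, mul_assoc, ← hc i (m - d) (by omega) (by omega), ← mul_assoc, ih (by omega),
      mul_assoc]

lemma coxC_slide {H : Type} [Group H] (s : ℕ → H) (m : ℕ)
    (hb : ∀ i, i + 1 ≤ m → s i * s (i + 1) * s i = s (i + 1) * s i * s (i + 1))
    (hc : ∀ i j, i + 1 < j → j ≤ m → s i * s j = s j * s i) (i : ℕ) (hi : i + 1 ≤ m) :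
    ∀ d, m < i + d → d ≤ m + 1 → coxC s m d * s (i + 1) = s i * coxC s m d := by
  intro d
  induction d with
  | zero => intro h; omega
  | succ d ih =>
    intro h h'
    by_cases h1 : i + d = m
    · obtain ⟨d', rfl⟩ : ∃ d', d = d' + 1 := ⟨d - 1, by omega⟩
      have e1 : m - (d' + 1) = i := by omega
      have e2 : m - d' = i + 1 := by omega
      rw [coxC, coxC, e1, e2]
      have := coxC_comm s m hc i d' (by omega)
      calc coxC s m d' * s (i + 1) * s i * s (i + 1)
          = coxC s m d' * (s (i + 1) * s i * s (i + 1)) := by group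
        _ = coxC s m d' * s i * s (i + 1) * s i := by rw [← hb i hi]; group
        _ = _ := by rw [this]; group
    · rw [coxC, mul_assoc, hc (m - d) (i + 1) (by omega) hi, ← mul_assoc, ih (by omega) (by omega),
        mul_assoc]

theorem cox_card {H : Type} [Group H] (s : ℕ → H) : ∀ m,
    (∀ i, i < m → s i * s i = 1) →
    (∀ i, i + 1 < m → s i * s (i + 1) * s i = s (i + 1) * s i * s (i + 1)) →
    (∀ i j, i + 1 < j → j < m → s i * s j = s j * s i) →
    ∃ F : Finset H, F.card ≤ (m + 1).factorial ∧
      ((Subgroup.closure (s '' {i | i < m}) : Subgroup H) : Set H) ⊆ F := by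
  classical
  intro m
  induction m with
  | zero =>
    intro _ _ _
    refine ⟨{1}, by simp, ?_⟩
    simp
  | succ m ih =>
    intro h1 h2 h3
    obtain ⟨F, hF, hK⟩ := ih (fun i h => h1 i (by omega)) (fun i h => h2 i (by omega))
      (fun i j h h' => h3 i j h (by omega))
    set K := Subgroup.closure (s '' {i | i < m}) with hKdef
    have hs : ∀ i, i < m → s i ∈ K := fun i hi => Subgroup.subset_closure ⟨i, hi, rfl⟩
    refine ⟨(F ×ˢ Finset.range (m + 2)).image (fun p => p.1 * coxC s m p.2), ?_, ?_⟩
    · refine Finset.card_image_le.trans ?_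
      rw [Finset.card_product, Finset.card_range, Nat.factorial_succ (m + 1), mul_comm]
      exact Nat.mul_le_mul_left _ hF
    · have key : ∀ x ∈ Subgroup.closure (s '' {i | i < m + 1}),
          ∃ h ∈ K, ∃ d, d ≤ m + 1 ∧ x = h * coxC s m d := by
        have step : ∀ x, (∃ h ∈ K, ∃ d, d ≤ m + 1 ∧ x = h * coxC s m d) → ∀ i, i < m + 1 →
            ∃ h ∈ K, ∃ d, d ≤ m + 1 ∧ x * s i = h * coxC s m d := by
          rintro x ⟨h, hh, d, hd, rfl⟩ i hi
          rcases lt_trichotomy (i + d) m with hlt | heq | hgt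
          · refine ⟨h * s i, K.mul_mem hh (hs i (by omega)), d, hd, ?_⟩
            rw [mul_assoc, coxC_comm s m (fun i j a b => h3 i j a (by omega)) i d (by omega),
              mul_assoc]
          · refine ⟨h, hh, d + 1, by omega, ?_⟩
            have : m - d = i := by omega
            rw [coxC, this, mul_assoc]
          · by_cases he : i + d = m + 1
            · obtain ⟨d', rfl⟩ : ∃ d', d = d' + 1 := ⟨d - 1, by omega⟩
              have : m - d' = i := by omega
              refine ⟨h, hh, d', by omega, ?_⟩
              rw [coxC, this, mul_assoc, mul_assoc, h1 i hi, mul_one]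
            · obtain ⟨i', rfl⟩ : ∃ i', i = i' + 1 := ⟨i - 1, by omega⟩
              refine ⟨h * s i', K.mul_mem hh (hs i' (by omega)), d, hd, ?_⟩
              rw [mul_assoc, coxC_slide s m (fun i a => h2 i (by omega))
                (fun i j a b => h3 i j a (by omega)) i' (by omega) d (by omega) hd, mul_assoc]
        intro x hx
        induction hx using Subgroup.closure_induction_right with
        | one => exact ⟨1, K.one_mem, 0, by omega, by simp [coxC]⟩
        | mul_right x hx y hy ih =>
          obtain ⟨i, hi, rfl⟩ := hy
          exact step x ih i hi
        | mul_inv_cancel x hx y hy ih =>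
          obtain ⟨i, hi, rfl⟩ := hy
          rw [inv_eq_of_mul_eq_one_right (h1 i hi)]
          exact step x ih i hi
      intro x hx
      obtain ⟨h, hh, d, hd, rfl⟩ := key x hx
      rw [Finset.coe_image]
      exact ⟨(h, d), by simpa using ⟨hK hh, by omega⟩, rfl⟩

/-- The Coxeter presentation of the symmetric group, as an existence statement. -/
theorem cox_hom {H : Type} [Group H] (n : ℕ) (s : Fin (n - 1) → H)
    (h1 : ∀ i, s i * s i = 1)
    (h2 : ∀ i j : Fin (n - 1), (j : ℕ) = (i : ℕ) + 1 → s i * s j * s i = s j * s i * s j)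
    (h3 : ∀ i j : Fin (n - 1), (i : ℕ) + 1 < (j : ℕ) → s i * s j = s j * s i) :
    ∃ f : Equiv.Perm (Fin n) →* H, ∀ i, f (braidGen n i) = s i := by
  classical
  rcases n with _ | m
  · exact ⟨1, fun i => i.elim0⟩
  have hm : m + 1 - 1 = m := rfl
  let u : ℕ → H × Equiv.Perm (Fin (m + 1)) := fun i =>
    if h : i < m then (s ⟨i, h⟩, braidGen (m + 1) ⟨i, h⟩) else 1
  have hu : ∀ i (h : i < m), u i = (s ⟨i, h⟩, braidGen (m + 1) ⟨i, h⟩) := fun i h => dif_pos h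
  obtain ⟨F, hF, hK⟩ := cox_card u m
    (by
      intro i h
      rw [hu i h, Prod.mk_mul_mk, h1]
      simp [braidGen])
    (by
      intro i h
      rw [hu i (by omega), hu (i + 1) h]
      simp only [Prod.mk_mul_mk]
      rw [h2 ⟨i, by omega⟩ ⟨i + 1, h⟩ rfl]
      refine Prod.ext rfl ?_
      refine swap_braid₂ _ _ _ ?_ ?_ ?_ <;> simp [Fin.ext_iff] <;> omega)
    (by
      intro i j h h'
      rw [hu i (by omega), hu j h']
      simp only [Prod.mk_mul_mk]
      rw [h3 ⟨i, by omega⟩ ⟨j, h'⟩ h]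
      refine Prod.ext rfl ?_
      refine swap_swap_comm₂ _ _ _ _ ?_ ?_ ?_ ?_ <;> simp [Fin.ext_iff] <;> omega)
  set K := Subgroup.closure (u '' {i | i < m}) with hKdef
  let p : K →* Equiv.Perm (Fin (m + 1)) := (MonoidHom.snd _ _).comp K.subtype
  have hfin : Finite K := Set.Finite.subset F.finite_toSet hK
  have hcard : Nat.card K ≤ Nat.card (Equiv.Perm (Fin (m + 1))) := by
    rw [Nat.card_eq_fintype_card (α := Equiv.Perm _), Fintype.card_perm, Fintype.card_fin]
    refine le_trans ?_ hF
    have h5 := Set.ncard_le_ncard hK F.finite_toSet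
    rw [Set.ncard_coe_finset] at h5
    exact h5
  have hgen : ∀ i (h : i < m), braidGen (m + 1) ⟨i, h⟩ ∈ p.range := by
    intro i h
    refine ⟨⟨u i, Subgroup.subset_closure ⟨i, h, rfl⟩⟩, ?_⟩
    change (u i).2 = _
    rw [hu i h]
  have hsurj : Function.Surjective p := by
    have : (⊤ : Submonoid (Equiv.Perm (Fin (m + 1)))) ≤ p.range.toSubmonoid := by
      rw [← Equiv.Perm.mclosure_swap_castSucc_succ, Submonoid.closure_le]
      rintro _ ⟨i, rfl⟩
      exact hgen i.1 i.2
    intro σ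
    exact this (Submonoid.mem_top σ)
  have hbij : Function.Bijective p :=
    (Nat.bijective_iff_surjective_and_card p).2 ⟨hsurj, le_antisymm hcard
      (Nat.card_le_card_of_surjective p hsurj)⟩
  let P : K ≃* Equiv.Perm (Fin (m + 1)) := MulEquiv.ofBijective p hbij
  refine ⟨(MonoidHom.fst _ _).comp (K.subtype.comp P.symm.toMonoidHom), ?_⟩
  rintro ⟨i, hi⟩
  have : P.symm (braidGen (m + 1) ⟨i, hi⟩) = ⟨u i, Subgroup.subset_closure ⟨i, hi, rfl⟩⟩ := by
    rw [MulEquiv.symm_apply_eq]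
    change _ = (u i).2
    rw [hu i hi]
  change (P.symm (braidGen (m + 1) ⟨i, hi⟩)).1.1 = _
  rw [this]
  change (u i).1 = _
  rw [hu i hi]

end Coxeter

section BrauerData

/-- the wreath product -/
abbrev GW (G : Type) [CommGroup G] (n : ℕ) : Type :=
  (Fin n → G) ⋊[permMulAut G n] Equiv.Perm (Fin n)

/-- permutations in the wreath product -/
def wS (G : Type) [CommGroup G] {n : ℕ} (σ : Equiv.Perm (Fin n)) : GW G n :=
  SemidirectProduct.inr σ

/-- labels in the wreath product -/
def wT {G : Type} [CommGroup G] {n : ℕ} (l : Fin n) (g : G) : GW G n :=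
  SemidirectProduct.inl (Pi.mulSingle l g)

section
variable {G : Type} [CommGroup G] {n : ℕ}

lemma wS_mul (σ τ : Equiv.Perm (Fin n)) : wS G (σ * τ) = wS G σ * wS G τ := map_mul _ _ _
@[simp] lemma wS_one : wS G (1 : Equiv.Perm (Fin n)) = 1 := map_one _
lemma wT_mul (l : Fin n) (g h : G) : wT l (g * h) = wT l g * wT l h := by
  rw [wT, Pi.mulSingle_mul, map_mul]
  rfl
@[simp] lemma wT_one (l : Fin n) : wT l (1 : G) = 1 := by
  rw [wT, Pi.mulSingle_one, map_one]
lemma wT_comm (l m : Fin n) (g h : G) : wT l g * wT m h = wT m h * wT l g := by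
  rw [wT, wT, ← map_mul, mul_comm, map_mul]

lemma wS_wT (σ : Equiv.Perm (Fin n)) (l : Fin n) (g : G) :
    wS G σ * wT l g = wT (σ l) g * wS G σ := by
  have h : permMulAut G n σ (Pi.mulSingle l g) = Pi.mulSingle (σ l) g := by
    funext i
    change (Pi.mulSingle l g : Fin n → G) (σ.symm i) = _
    rw [Pi.mulSingle_apply, Pi.mulSingle_apply]
    simp only [Equiv.symm_apply_eq]
  rw [wS, wT, wT, ← h, SemidirectProduct.inl_aut, mul_assoc, ← map_mul, inv_mul_cancel, map_one,
    mul_one]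

lemma wS_swap_sq (p q : Fin n) : wS G (Equiv.swap p q) * wS G (Equiv.swap p q) = 1 := by
  rw [← wS_mul, Equiv.swap_mul_self, wS_one]

lemma wT_inv (l : Fin n) (g : G) : wT l g * wT l g⁻¹ = 1 := by
  rw [← wT_mul, mul_inv_cancel, wT_one]

lemma wT_inv' (l : Fin n) (g : G) : wT l g⁻¹ * wT l g = 1 := by
  rw [← wT_mul, inv_mul_cancel, wT_one]
end

variable (k G : Type) [CommRing k] [CommGroup G] (ρ : G →* RingAut k) (n : ℕ) (δ : k)

/-- An algebra with elements behaving like the hooks of the Brauer algebra. -/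
structure BrData (B : Type) [Ring B] [Algebra k B] where
  U : GW G n →* B
  e : Fin n → Fin n → B
  conj : ∀ σ p q, U (wS G σ) * e p q = e (σ p) (σ q) * U (wS G σ)
  symm : ∀ p q, e p q = e q p
  absorb : ∀ p q, p ≠ q → e p q * U (wS G (Equiv.swap p q)) = e p q
  comm : ∀ p q r s, p ≠ q → p ≠ r → p ≠ s → q ≠ r → q ≠ s → r ≠ s →
    e p q * e r s = e r s * e p q
  hook : ∀ p q r, p ≠ q → p ≠ r → q ≠ r → e p q * e p r = e p q * U (wS G (Equiv.swap q r))
  tcomm : ∀ l p q g, l ≠ p → l ≠ q → p ≠ q → U (wT l g) * e p q = e p q * U (wT l g)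
  tl : ∀ p q g, p ≠ q → U (wT p g) * e p q = U (wT q g) * e p q
  tr : ∀ p q g, p ≠ q → e p q * U (wT p g) = e p q * U (wT q g)
  loop : ∀ p q g, p ≠ q → e p q * U (wT p g) * e p q = (ρ g δ) • e p q

variable {k G ρ n δ} {B : Type} [Ring B] [Algebra k B]

namespace BrData
variable (D : BrData k G ρ n δ B)

lemma absorb_l (p q : Fin n) (h : p ≠ q) : D.U (wS G (Equiv.swap p q)) * D.e p q = D.e p q := by
  rw [D.conj, Equiv.swap_apply_left, Equiv.swap_apply_right, D.symm q p, D.absorb p q h]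

/-- `e_pq e_pr = s_qr e_pr` -/
lemma hook_l (p q r : Fin n) (h1 : p ≠ q) (h2 : p ≠ r) (h3 : q ≠ r) :
    D.e p q * D.e p r = D.U (wS G (Equiv.swap q r)) * D.e p r := by
  rw [D.hook p q r h1 h2 h3, D.conj, Equiv.swap_apply_of_ne_of_ne h1 h2, Equiv.swap_apply_right]

lemma ese (p q r : Fin n) (h1 : p ≠ q) (h2 : p ≠ r) (h3 : q ≠ r) :
    D.e p q * D.U (wS G (Equiv.swap q r)) * D.e p q = D.e p q := by
  rw [← D.hook p q r h1 h2 h3, mul_assoc, D.hook p r q h2 h1 h3.symm, ← mul_assoc,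
    D.hook p q r h1 h2 h3, Equiv.swap_comm r q, mul_assoc, ← map_mul, wS_swap_sq, map_one, mul_one]

lemma eee (p q r : Fin n) (h1 : p ≠ q) (h2 : p ≠ r) (h3 : q ≠ r) :
    D.e p q * D.e p r * D.e p q = D.e p q := by
  rw [D.hook p q r h1 h2 h3, D.ese p q r h1 h2 h3]

end BrData

/-- image of the generators -/
def genPos {n : ℕ} (i : Fin (n - 1)) : Fin n := ⟨i, by have := i.2; omega⟩
/-- image of the generators -/
def genPos' {n : ℕ} (i : Fin (n - 1)) : Fin n := ⟨i + 1, by have := i.2; omega⟩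

lemma genPos_ne (i : Fin (n - 1)) : genPos i ≠ genPos' i := by
  simp [genPos, genPos', Fin.ext_iff]

lemma braidGen_eq (i : Fin (n - 1)) : braidGen n i = Equiv.swap (genPos i) (genPos' i) := rfl

/-- images of the generators -/
def BrData.gen (D : BrData k G ρ n δ B) : GBGen n G → B
  | .s i => D.U (wS G (Equiv.swap (genPos i) (genPos' i)))
  | .e i => D.e (genPos i) (genPos' i)
  | .t g j => D.U (wT j g)

lemma BrData.gen_rel (D : BrData k G ρ n δ B) {x y : FreeAlgebra k (GBGen n G)}
    (h : GBRel k G ρ n δ x y) :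
    FreeAlgebra.lift k D.gen x = FreeAlgebra.lift k D.gen y := by
  have adj : ∀ i j : Fin (n - 1), (j : ℕ) = (i : ℕ) + 1 → genPos' i = genPos j := by
    intro i j h
    simp [genPos, genPos', h]
  have neq : ∀ i j : Fin (n - 1), (j : ℕ) = (i : ℕ) + 1 → genPos i ≠ genPos' j := by
    intro i j h
    simp [genPos, genPos', h, Fin.ext_iff]
    omega
  -- key facts for adjacent generators
  have key : ∀ i j : Fin (n - 1), ((j : ℕ) = (i : ℕ) + 1 ∨ (i : ℕ) = (j : ℕ) + 1) →
      ∃ p q r : Fin n, p ≠ q ∧ p ≠ r ∧ q ≠ r ∧ D.e (genPos i) (genPos' i) = D.e p q ∧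
        D.e (genPos j) (genPos' j) = D.e p r ∧
        Equiv.swap (genPos i) (genPos' i) = Equiv.swap p q ∧
        Equiv.swap (genPos j) (genPos' j) = Equiv.swap p r := by
    rintro i j (h | h)
    · refine ⟨genPos' i, genPos i, genPos' j, (genPos_ne i).symm, ?_, neq i j h, D.symm _ _, ?_,
        Equiv.swap_comm _ _, ?_⟩
      · rw [adj i j h]; exact genPos_ne j
      · rw [adj i j h]
      · rw [adj i j h]
    · refine ⟨genPos i, genPos' i, genPos j, genPos_ne i, ?_, (neq j i h).symm, rfl, ?_,
        rfl, ?_⟩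
      · rw [← adj j i h]; exact (genPos_ne j).symm
      · rw [← adj j i h, D.symm]
      · rw [← adj j i h, Equiv.swap_comm]
  have far : ∀ i j : Fin (n - 1), ((i : ℕ) + 1 < (j : ℕ) ∨ (j : ℕ) + 1 < (i : ℕ)) →
      genPos i ≠ genPos j ∧ genPos i ≠ genPos' j ∧ genPos' i ≠ genPos j ∧
        genPos' i ≠ genPos' j := by
    intro i j h
    simp only [genPos, genPos', ne_eq, Fin.mk.injEq]
    omega
  have hx : ∀ (i : Fin (n - 1)) (j : Fin n), (j : ℕ) = (i : ℕ) → j = genPos i := by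
    intro i j h
    simp [genPos, Fin.ext_iff, h]
  have hx' : ∀ (i : Fin (n - 1)) (j : Fin n), (j : ℕ) = (i : ℕ) + 1 → j = genPos' i := by
    intro i j h
    simp [genPos', Fin.ext_iff, h]
  have hs : ∀ i, FreeAlgebra.lift k D.gen (GBs k G n i)
      = D.U (wS G (Equiv.swap (genPos i) (genPos' i))) := fun i => FreeAlgebra.lift_ι_apply _ _
  have he : ∀ i, FreeAlgebra.lift k D.gen (GBe k G n i)
      = D.e (genPos i) (genPos' i) := fun i => FreeAlgebra.lift_ι_apply _ _
  have ht : ∀ g j, FreeAlgebra.lift k D.gen (GBt k G n g j)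
      = D.U (wT j g) := fun g j => FreeAlgebra.lift_ι_apply _ _
  cases h with
  | s_sq i =>
    simp only [map_mul, map_one, hs]
    rw [← map_mul, wS_swap_sq, map_one]
  | s_braid i j h =>
    simp only [map_mul, map_one, hs]
    rw [← map_mul, ← map_mul, ← map_mul, ← map_mul, ← wS_mul, ← wS_mul, ← wS_mul, ← wS_mul,
      ← adj i j h, swap_braid₂ _ _ _ (genPos_ne i) (neq i j h)]
    rw [adj i j h]
    exact genPos_ne j
  | ss_comm i j h =>
    simp only [map_mul, hs]
    obtain ⟨h1, h2, h3, h4⟩ := far i j (Or.inl h)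
    rw [← map_mul, ← wS_mul, swap_swap_comm₂ _ _ _ _ h1 h2 h3 h4, wS_mul, map_mul]
  | e_sq i =>
    simp only [map_mul, map_smul, he]
    have := D.loop _ _ 1 (genPos_ne i)
    rw [wT_one, map_one, map_one, mul_one] at this
    exact this
  | e_hook i j h =>
    simp only [map_mul, he]
    obtain ⟨p, q, r, h1, h2, h3, e1, e2, -, -⟩ := key i j h
    rw [e1, e2, D.eee p q r h1 h2 h3]
  | ee_comm i j h =>
    simp only [map_mul, he]
    obtain ⟨h1, h2, h3, h4⟩ := far i j (Or.inl h)
    exact D.comm _ _ _ _ (genPos_ne i) h1 h2 h3 h4 (genPos_ne j)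
  | se_absorb i =>
    simp only [map_mul, he, hs]
    exact D.absorb_l _ _ (genPos_ne i)
  | es_absorb i =>
    simp only [map_mul, he, hs]
    exact D.absorb _ _ (genPos_ne i)
  | se_comm i j h =>
    simp only [map_mul, he, hs]
    obtain ⟨h1, h2, h3, h4⟩ := far i j h
    rw [D.conj, Equiv.swap_apply_of_ne_of_ne h1.symm h3.symm,
      Equiv.swap_apply_of_ne_of_ne h2.symm h4.symm]
  | ese i j h =>
    simp only [map_mul, he, hs]
    obtain ⟨p, q, r, h1, h2, h3, e1, e2, e3, e4⟩ := key i j h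
    rw [e1, e4, D.symm p q, D.ese q p r h1.symm h3 h2]
  | sse i j h =>
    simp only [map_mul, he, hs]
    obtain ⟨p, q, r, h1, h2, h3, e1, e2, e3, e4⟩ := key i j h
    rw [e1, e2, e3, e4, D.hook_l p r q h2 h1 h3.symm]
    have h5 : Equiv.swap p q * Equiv.swap p r = Equiv.swap r q * Equiv.swap p q := by
      rw [Equiv.mul_swap_eq_swap_mul, Equiv.swap_apply_left,
        Equiv.swap_apply_of_ne_of_ne h2.symm h3.symm, Equiv.swap_comm q r]
    rw [← map_mul, ← wS_mul, h5, wS_mul, map_mul, mul_assoc, D.absorb_l p q h1]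
  | ess i j h =>
    simp only [map_mul, he, hs]
    obtain ⟨p, q, r, h1, h2, h3, e1, e2, e3, e4⟩ := key i j h
    rw [e1, e2, e3, e4, D.hook p q r h1 h2 h3]
    have h5 : Equiv.swap p r * Equiv.swap p q = Equiv.swap p q * Equiv.swap q r := by
      rw [Equiv.mul_swap_eq_swap_mul (Equiv.swap p q), Equiv.swap_apply_right,
        Equiv.swap_apply_of_ne_of_ne h2.symm h3.symm]
    rw [mul_assoc, ← map_mul, ← wS_mul, h5, wS_mul, map_mul, ← mul_assoc, D.absorb p q h1]
  | t_mul g h' j =>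
    simp only [map_mul, ht, wT_mul]
  | t_one j =>
    simp only [map_one, ht, wT_one]
  | tt_comm g h' j l h =>
    simp only [map_mul, ht]
    rw [← map_mul, wT_comm, map_mul]
  | st_comm g i l h =>
    simp only [map_mul, ht, hs]
    rw [← map_mul, wS_wT, map_mul, Equiv.swap_apply_of_ne_of_ne]
    · simp [genPos, Fin.ext_iff, h.1]
    · simp [genPos', Fin.ext_iff, h.2]
  | st_slide g i j j' h h' =>
    simp only [map_mul, ht, hs]
    rw [← map_mul, wS_wT, map_mul, hx i j h, hx' i j' h', Equiv.swap_apply_left]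
  | st_slide' g i j j' h h' =>
    simp only [map_mul, ht, hs]
    rw [← map_mul, wS_wT, map_mul, hx i j h, hx' i j' h', Equiv.swap_apply_right]
  | et_comm g i l h =>
    simp only [map_mul, ht, he]
    rw [D.tcomm _ _ _ _ _ _ (genPos_ne i)]
    · simp [genPos, Fin.ext_iff, h.1]
    · simp [genPos', Fin.ext_iff, h.2]
  | cap_slide_l g i j j' h h' =>
    simp only [map_mul, ht, he]
    rw [hx i j h, hx' i j' h']
    exact D.tl _ _ _ (genPos_ne i)
  | cap_slide_r g i j j' h h' =>
    simp only [map_mul, ht, he]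
    rw [hx i j h, hx' i j' h']
    exact D.tr _ _ _ (genPos_ne i)
  | loop g i j h =>
    simp only [map_mul, map_smul, ht, he]
    rw [hx i j h]
    exact D.loop _ _ _ (genPos_ne i)

/-- the standard blank product -/
def BrData.blk (D : BrData k G ρ n δ B) (h1 : Even n) : B :=
  (List.ofFn (fun i : Fin (n / 2) =>
        D.e ⟨2 * (i : ℕ), by have h2 := i.2; obtain ⟨m, hm⟩ := h1; omega⟩
          ⟨2 * (i : ℕ) + 1, by have h2 := i.2; obtain ⟨m, hm⟩ := h1; omega⟩)).prod

/-- The homomorphism from the quotient algebra attached to Brauer data. -/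
def BrData.hom (D : BrData k G ρ n δ B) (hD : ∀ h : Even n, 0 < n → D.blk h = 0) :
    GBQAlg k G ρ n δ →ₐ[k] B :=
  RingQuot.liftAlgHom k ⟨FreeAlgebra.lift k D.gen, by
    intro x y h
    cases h with
    | base h => exact D.gen_rel h
    | blank h0 h1 =>
      rw [map_zero, map_list_prod, List.map_ofFn, ← hD h1 h0]
      rw [BrData.blk]
      congr 2
      funext i
      exact FreeAlgebra.lift_ι_apply _ _⟩

/-- generators of the quotient algebra -/
def qgen (k G : Type) [CommRing k] [CommGroup G] (ρ : G →* RingAut k) (n : ℕ) (δ : k)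
    (x : GBGen n G) : GBQAlg k G ρ n δ :=
  RingQuot.mkAlgHom k (GBQRel k G ρ n δ) (FreeAlgebra.ι k x)

lemma BrData.hom_gen (D : BrData k G ρ n δ B) (hD : ∀ h : Even n, 0 < n → D.blk h = 0)
    (x : GBGen n G) : D.hom hD (qgen k G ρ n δ x) = D.gen x := by
  rw [qgen, BrData.hom, RingQuot.liftAlgHom_mkAlgHom_apply]
  exact FreeAlgebra.lift_ι_apply _ _

end BrauerData

section AlgData

lemma perm_ind {n : ℕ} (P : Submonoid (Equiv.Perm (Fin n))) (h : ∀ i, braidGen n i ∈ P)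
    (σ : Equiv.Perm (Fin n)) : σ ∈ P := by
  rcases n with _ | m
  · rw [Subsingleton.elim σ 1]
    exact P.one_mem
  · have : (⊤ : Submonoid (Equiv.Perm (Fin (m + 1)))) ≤ P := by
      rw [← Equiv.Perm.mclosure_swap_castSucc_succ, Submonoid.closure_le]
      rintro _ ⟨i, rfl⟩
      exact h ⟨i.1, i.2⟩
    exact this (Submonoid.mem_top σ)

lemma perm_stab {n : ℕ} (P : Submonoid (Equiv.Perm (Fin n)))
    (h : ∀ i : Fin (n - 1), 2 ≤ (i : ℕ) → braidGen n i ∈ P)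
    (σ : Equiv.Perm (Fin n)) (hσ : ∀ i : Fin n, (i : ℕ) < 2 → σ i = i) : σ ∈ P := by
  have hsw : ∀ (d a : ℕ) (h2 : 2 ≤ a) (hb : a + d < n),
      Equiv.swap (⟨a, by omega⟩ : Fin n) ⟨a + d, hb⟩ ∈ P := by
    intro d a h2
    induction d with
    | zero =>
      intro hb
      have : Equiv.swap (⟨a, by omega⟩ : Fin n) ⟨a + 0, hb⟩ = 1 := Equiv.swap_self _
      rw [this]
      exact P.one_mem
    | succ d ih =>
      intro hb
      have hg := h ⟨a + d, by omega⟩ (by simp; omega)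
      by_cases hd : d = 0
      · subst hd
        exact hg
      · have e1 : Equiv.swap (⟨a, by omega⟩ : Fin n) ⟨a + (d + 1), hb⟩
            = braidGen n ⟨a + d, by omega⟩ * Equiv.swap (⟨a, by omega⟩ : Fin n) ⟨a + d, by omega⟩
              * braidGen n ⟨a + d, by omega⟩ := by
          rw [Equiv.mul_swap_eq_swap_mul, braidGen_eq, mul_assoc, Equiv.swap_mul_self, mul_one]
          have : (⟨a + d, by omega⟩ : Fin n) = genPos ⟨a + d, by omega⟩ := rfl
          rw [this, Equiv.swap_apply_left, Equiv.swap_apply_of_ne_of_ne]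
          · rfl
          · simp [genPos, hd]
          · simp only [genPos', ne_eq, Fin.mk.injEq]
            omega
        rw [e1]
        exact P.mul_mem (P.mul_mem hg (ih (by omega))) hg
  have hsw' : ∀ a b : Fin n, 2 ≤ (a : ℕ) → 2 ≤ (b : ℕ) → Equiv.swap a b ∈ P := by
    rintro ⟨a, ha⟩ ⟨b, hb⟩ h1 h2
    simp only at h1 h2
    rcases le_total a b with h3 | h3
    · obtain ⟨d, rfl⟩ := Nat.exists_eq_add_of_le h3
      exact hsw d a h1 hb
    · obtain ⟨d, rfl⟩ := Nat.exists_eq_add_of_le h3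
      rw [Equiv.swap_comm]
      exact hsw d b h2 ha
  induction hm : σ.support.card using Nat.strong_induction_on generalizing σ with
  | _ m ih =>
    by_cases h1 : σ = 1
    · rw [h1]
      exact P.one_mem
    · obtain ⟨a, ha⟩ : ∃ a, σ a ≠ a := by
        by_contra hcon
        push Not at hcon
        exact h1 (Equiv.ext hcon)
      have ha2 : 2 ≤ (a : ℕ) := by
        by_contra hlt
        exact ha (hσ a (by omega))
      have hb2 : 2 ≤ (σ a : ℕ) := by
        by_contra hlt
        exact ha (σ.injective (hσ (σ a) (by omega)))
      have h3 := ih _ (hm ▸ Equiv.Perm.card_support_swap_mul ha) (Equiv.swap a (σ a) * σ) (by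
        intro i hi
        rw [Equiv.Perm.mul_apply, hσ i hi, Equiv.swap_apply_of_ne_of_ne]
        · rintro rfl; omega
        · rintro rfl; omega) rfl
      have h4 : σ = Equiv.swap a (σ a) * (Equiv.swap a (σ a) * σ) := by
        rw [← mul_assoc, Equiv.swap_mul_self, one_mul]
      rw [h4]
      exact P.mul_mem (hsw' _ _ ha2 hb2) h3

variable (k G : Type) [CommRing k] [CommGroup G] (ρ : G →* RingAut k) (n : ℕ) (δ : k)

lemma qrel {x y : FreeAlgebra k (GBGen n G)} (h : GBRel k G ρ n δ x y) :
    RingQuot.mkAlgHom k (GBQRel k G ρ n δ) x = RingQuot.mkAlgHom k (GBQRel k G ρ n δ) y :=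
  RingQuot.mkAlgHom_rel k (GBQRel.base h)

/-- unit attached to a transposition -/
def qsU (i : Fin (n - 1)) : (GBQAlg k G ρ n δ)ˣ where
  val := qgen k G ρ n δ (.s i)
  inv := qgen k G ρ n δ (.s i)
  val_inv := by
    have := qrel k G ρ n δ (.s_sq i)
    rwa [map_mul, map_one] at this
  inv_val := by
    have := qrel k G ρ n δ (.s_sq i)
    rwa [map_mul, map_one] at this

lemma qt_mul (g h : G) (j : Fin n) : qgen k G ρ n δ (.t (g * h) j)
    = qgen k G ρ n δ (.t g j) * qgen k G ρ n δ (.t h j) := by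
  have := qrel k G ρ n δ (.t_mul g h j)
  rw [map_mul] at this
  exact this.symm

lemma qt_one (j : Fin n) : qgen k G ρ n δ (.t 1 j) = 1 := by
  have := qrel k G ρ n δ (.t_one j)
  rw [map_one] at this
  exact this

/-- unit attached to a label -/
def qtU (j : Fin n) : G →* (GBQAlg k G ρ n δ)ˣ where
  toFun g :=
    { val := qgen k G ρ n δ (.t g j)
      inv := qgen k G ρ n δ (.t g⁻¹ j)
      val_inv := by rw [← qt_mul, mul_inv_cancel, qt_one]
      inv_val := by rw [← qt_mul, inv_mul_cancel, qt_one] }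
  map_one' := Units.ext (qt_one k G ρ n δ j)
  map_mul' g h := Units.ext (qt_mul k G ρ n δ g h j)

lemma exists_qperm : ∃ f : Equiv.Perm (Fin n) →* (GBQAlg k G ρ n δ)ˣ,
    ∀ i, f (braidGen n i) = qsU k G ρ n δ i := by
  refine cox_hom n (qsU k G ρ n δ) ?_ ?_ ?_
  · intro i
    apply Units.ext
    have := qrel k G ρ n δ (.s_sq i)
    rwa [map_mul, map_one] at this
  · intro i j h
    apply Units.ext
    have := qrel k G ρ n δ (.s_braid i j h)
    simp only [map_mul] at this
    exact this
  · intro i j h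
    apply Units.ext
    have := qrel k G ρ n δ (.ss_comm i j h)
    simp only [map_mul] at this
    exact this

lemma exists_qU : ∃ U : GW G n →* GBQAlg k G ρ n δ,
    (∀ i, U (wS G (braidGen n i)) = qgen k G ρ n δ (.s i)) ∧
    (∀ j g, U (wT j g) = qgen k G ρ n δ (.t g j)) := by
  classical
  obtain ⟨f, hf⟩ := exists_qperm k G ρ n δ
  have hcomm : Pairwise fun i j => ∀ x y : G,
      Commute (qtU k G ρ n δ i x) (qtU k G ρ n δ j y) := by
    intro i j hij x y
    apply Units.ext
    have := qrel k G ρ n δ (.tt_comm x y i j hij)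
    simp only [map_mul] at this
    exact this
  let T : (Fin n → G) →* (GBQAlg k G ρ n δ)ˣ :=
    MonoidHom.noncommPiCoprod (fun j => qtU k G ρ n δ j) hcomm
  have hT : ∀ j g, T (Pi.mulSingle j g) = qtU k G ρ n δ j g := fun j g =>
    MonoidHom.noncommPiCoprod_mulSingle _ _ _
  let P : Submonoid (Equiv.Perm (Fin n)) :=
    { carrier := {σ | ∀ l g, f σ * qtU k G ρ n δ l g = qtU k G ρ n δ (σ l) g * f σ}
      one_mem' := by
        intro l g
        simp
      mul_mem' := by
        intro σ τ hσ hτ l g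
        rw [map_mul, mul_assoc, hτ, ← mul_assoc, hσ, mul_assoc]
        rfl }
  have hP : ∀ σ, σ ∈ P := by
    refine perm_ind P ?_
    intro i l g
    rw [hf]
    apply Units.ext
    by_cases h1 : (l : ℕ) = (i : ℕ)
    · have := qrel k G ρ n δ (.st_slide g i l (genPos' i) h1 rfl)
      simp only [map_mul] at this
      have h2 : l = genPos i := Fin.ext h1
      have h3 : braidGen n i l = genPos' i := by
        rw [braidGen_eq, h2, Equiv.swap_apply_left]
      rw [h3]
      exact this
    by_cases h1' : (l : ℕ) = (i : ℕ) + 1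
    · have := qrel k G ρ n δ (.st_slide' g i (genPos i) l rfl h1')
      simp only [map_mul] at this
      have h2 : l = genPos' i := Fin.ext h1'
      have h3 : braidGen n i l = genPos i := by
        rw [braidGen_eq, h2, Equiv.swap_apply_right]
      rw [h3]
      exact this
    · have := qrel k G ρ n δ (.st_comm g i l ⟨h1, h1'⟩)
      simp only [map_mul] at this
      have h3 : braidGen n i l = l := by
        rw [braidGen_eq, Equiv.swap_apply_of_ne_of_ne]
        · exact fun h => h1 (congrArg Fin.val h)
        · exact fun h => h1' (congrArg Fin.val h)
      rw [h3]
      exact this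
  let F : GW G n →* (GBQAlg k G ρ n δ)ˣ := SemidirectProduct.lift T f (by
    intro σ
    refine MonoidHom.pi_ext fun l g => ?_
    have h : permMulAut G n σ (Pi.mulSingle l g) = Pi.mulSingle (σ l) g := by
      funext i
      change (Pi.mulSingle l g : Fin n → G) (σ.symm i) = _
      rw [Pi.mulSingle_apply, Pi.mulSingle_apply]
      simp only [Equiv.symm_apply_eq]
    change T (permMulAut G n σ (Pi.mulSingle l g)) = f σ * T (Pi.mulSingle l g) * (f σ)⁻¹
    rw [h, hT, hT, hP σ, mul_inv_cancel_right])
  refine ⟨(Units.coeHom _).comp F, ?_, ?_⟩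
  · intro i
    change ((F (SemidirectProduct.inr (braidGen n i)) : (GBQAlg k G ρ n δ)ˣ) : GBQAlg k G ρ n δ) = _
    rw [SemidirectProduct.lift_inr, hf]
    rfl
  · intro j g
    change ((F (SemidirectProduct.inl (Pi.mulSingle j g)) : (GBQAlg k G ρ n δ)ˣ) :
      GBQAlg k G ρ n δ) = _
    rw [SemidirectProduct.lift_inl, hT]
    rfl

end AlgData

section AlgData2

variable {k G : Type} [CommRing k] [CommGroup G] {ρ : G →* RingAut k} {n : ℕ} {δ : k}

lemma exists_perm2 {n : ℕ} {a b p q : Fin n} (h0 : a ≠ b) (h : p ≠ q) :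
    ∃ σ : Equiv.Perm (Fin n), σ a = p ∧ σ b = q := by
  obtain ⟨σ, hσ⟩ := Equiv.Perm.exists_extending_pair ![a, b] ![p, q]
    (by intro i j; fin_cases i <;> fin_cases j <;> simp [h0, h0.symm])
    (by intro i j; fin_cases i <;> fin_cases j <;> simp [h, h.symm])
  exact ⟨σ, hσ 0, hσ 1⟩

lemma exists_perm3 {n : ℕ} {a b c p q r : Fin n} (h1 : a ≠ b) (h2 : a ≠ c) (h3 : b ≠ c)
    (h1' : p ≠ q) (h2' : p ≠ r) (h3' : q ≠ r) :
    ∃ σ : Equiv.Perm (Fin n), σ a = p ∧ σ b = q ∧ σ c = r := by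
  obtain ⟨σ, hσ⟩ := Equiv.Perm.exists_extending_pair ![a, b, c] ![p, q, r]
    (by intro i j; fin_cases i <;> fin_cases j <;> simp [h1, h1.symm, h2, h2.symm, h3, h3.symm])
    (by intro i j; fin_cases i <;> fin_cases j <;>
          simp [h1', h1'.symm, h2', h2'.symm, h3', h3'.symm])
  exact ⟨σ, hσ 0, hσ 1, hσ 2⟩

lemma exists_perm4 {n : ℕ} {a b c d p q r s : Fin n}
    (h1 : a ≠ b) (h2 : a ≠ c) (h3 : a ≠ d) (h4 : b ≠ c) (h5 : b ≠ d) (h6 : c ≠ d)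
    (h1' : p ≠ q) (h2' : p ≠ r) (h3' : p ≠ s) (h4' : q ≠ r) (h5' : q ≠ s) (h6' : r ≠ s) :
    ∃ σ : Equiv.Perm (Fin n), σ a = p ∧ σ b = q ∧ σ c = r ∧ σ d = s := by
  obtain ⟨σ, hσ⟩ := Equiv.Perm.exists_extending_pair ![a, b, c, d] ![p, q, r, s]
    (by intro i j; fin_cases i <;> fin_cases j <;> simp [h1, h1.symm, h2, h2.symm, h3, h3.symm,
          h4, h4.symm, h5, h5.symm, h6, h6.symm])
    (by intro i j; fin_cases i <;> fin_cases j <;>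
          simp [h1', h1'.symm, h2', h2'.symm, h3', h3'.symm,
          h4', h4'.symm, h5', h5'.symm, h6', h6'.symm])
  exact ⟨σ, hσ 0, hσ 1, hσ 2, hσ 3⟩

/-- a permutation sending the first two points to `p` and `q` -/
def Sends {n : ℕ} (σ : Equiv.Perm (Fin n)) (p q : Fin n) : Prop :=
  ∀ i : Fin n, ((i : ℕ) = 0 → σ i = p) ∧ ((i : ℕ) = 1 → σ i = q)

lemma exists_sends {n : ℕ} {p q : Fin n} (h : p ≠ q) : ∃ σ, Sends σ p q := by
  have hn : 2 ≤ n := by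
    have h1 := p.2
    have h2 := q.2
    have h3 : (p : ℕ) ≠ q := fun h' => h (Fin.ext h')
    omega
  obtain ⟨σ, h1, h2⟩ := exists_perm2 (a := (⟨0, by omega⟩ : Fin n)) (b := ⟨1, by omega⟩)
    (by simp) h
  refine ⟨σ, fun i => ⟨fun h => ?_, fun h => ?_⟩⟩
  · rw [← h1]; congr 1; exact Fin.ext h
  · rw [← h2]; congr 1; exact Fin.ext h

lemma Sends.mul {n : ℕ} {σ : Equiv.Perm (Fin n)} {p q : Fin n} (h : Sends σ p q)
    (τ : Equiv.Perm (Fin n)) : Sends (τ * σ) (τ p) (τ q) := fun i =>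
  ⟨fun hi => by rw [Equiv.Perm.mul_apply, (h i).1 hi],
    fun hi => by rw [Equiv.Perm.mul_apply, (h i).2 hi]⟩

/-- the basic hook -/
def qe0 (k G : Type) [CommRing k] [CommGroup G] (ρ : G →* RingAut k) (n : ℕ) (δ : k) :
    GBQAlg k G ρ n δ :=
  if h : 0 < n - 1 then qgen k G ρ n δ (.e ⟨0, h⟩) else 0

open Classical in
/-- all hooks -/
def qee (U : GW G n →* GBQAlg k G ρ n δ) (p q : Fin n) : GBQAlg k G ρ n δ :=
  if h : p = q then 0 else
    U (wS G (exists_sends h).choose) * qe0 k G ρ n δ * U (wS G (exists_sends h).choose⁻¹)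

lemma U_inv (U : GW G n →* GBQAlg k G ρ n δ) (σ : Equiv.Perm (Fin n)) :
    U (wS G σ) * U (wS G σ⁻¹) = 1 := by
  rw [← map_mul, ← wS_mul, mul_inv_cancel, wS_one, map_one]

lemma U_inv' (U : GW G n →* GBQAlg k G ρ n δ) (σ : Equiv.Perm (Fin n)) :
    U (wS G σ⁻¹) * U (wS G σ) = 1 := by
  rw [← map_mul, ← wS_mul, inv_mul_cancel, wS_one, map_one]

lemma U_cancel (U : GW G n →* GBQAlg k G ρ n δ) (σ : Equiv.Perm (Fin n))
    {a b : GBQAlg k G ρ n δ} (h : a * U (wS G σ) = b * U (wS G σ)) : a = b := by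
  have := congrArg (fun z => z * U (wS G σ⁻¹)) h
  simpa only [mul_assoc, U_inv, mul_one] using this

lemma e0_comm (U : GW G n →* GBQAlg k G ρ n δ)
    (hs : ∀ i, U (wS G (braidGen n i)) = qgen k G ρ n δ (.s i))
    (σ : Equiv.Perm (Fin n)) (hσ : ∀ i : Fin n, (i : ℕ) < 2 → σ i = i) :
    U (wS G σ) * qe0 k G ρ n δ = qe0 k G ρ n δ * U (wS G σ) := by
  by_cases hn : 0 < n - 1
  swap
  · rw [qe0, dif_neg hn, mul_zero, zero_mul]
  let P : Submonoid (Equiv.Perm (Fin n)) :=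
    { carrier := {σ | U (wS G σ) * qe0 k G ρ n δ = qe0 k G ρ n δ * U (wS G σ)}
      one_mem' := by
        change U (wS G 1) * _ = _ * U (wS G 1)
        rw [wS_one, map_one, one_mul, mul_one]
      mul_mem' := by
        intro σ τ hσ hτ
        change U (wS G (σ * τ)) * _ = _ * U (wS G (σ * τ))
        change U (wS G σ) * _ = _ * U (wS G σ) at hσ
        change U (wS G τ) * _ = _ * U (wS G τ) at hτ
        rw [wS_mul, map_mul, mul_assoc, hτ, ← mul_assoc, hσ, mul_assoc] }
  refine perm_stab P ?_ σ hσ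
  intro i hi
  change U (wS G _) * _ = _ * U (wS G _)
  rw [hs, qe0, dif_pos hn]
  have := qrel k G ρ n δ (.se_comm i ⟨0, hn⟩ (Or.inr (by simp only; omega)))
  simp only [map_mul] at this
  exact this

lemma qee_spec (U : GW G n →* GBQAlg k G ρ n δ)
    (hs : ∀ i, U (wS G (braidGen n i)) = qgen k G ρ n δ (.s i))
    {σ : Equiv.Perm (Fin n)} {p q : Fin n} (h : p ≠ q) (hσ : Sends σ p q) :
    qee U p q * U (wS G σ) = U (wS G σ) * qe0 k G ρ n δ := by
  rw [qee, dif_neg h]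
  have hτ := (exists_sends h).choose_spec
  set τ := (exists_sends h).choose
  have := e0_comm U hs (τ⁻¹ * σ) (by
    intro i hi
    have h1 : σ i = τ i := by
      obtain h0 | h0 : (i : ℕ) = 0 ∨ (i : ℕ) = 1 := by omega
      · rw [(hσ i).1 h0, (hτ i).1 h0]
      · rw [(hσ i).2 h0, (hτ i).2 h0]
    rw [Equiv.Perm.mul_apply, h1]
    simp)
  rw [wS_mul, map_mul] at this
  rw [mul_assoc, mul_assoc, ← this, ← mul_assoc, ← mul_assoc, U_inv, one_mul]

lemma qee_conj (U : GW G n →* GBQAlg k G ρ n δ)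
    (hs : ∀ i, U (wS G (braidGen n i)) = qgen k G ρ n δ (.s i))
    (σ : Equiv.Perm (Fin n)) (p q : Fin n) :
    U (wS G σ) * qee U p q = qee U (σ p) (σ q) * U (wS G σ) := by
  by_cases h : p = q
  · subst h
    simp [qee]
  obtain ⟨τ, hτ⟩ := exists_sends h
  have h1 := qee_spec U hs h hτ
  have h2 := qee_spec U hs (fun h' => h (σ.injective h')) (hτ.mul σ)
  apply U_cancel U τ
  rw [mul_assoc, h1, mul_assoc, ← map_mul U (wS G σ), ← wS_mul, h2, wS_mul, map_mul, mul_assoc]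

lemma qee_gen (U : GW G n →* GBQAlg k G ρ n δ)
    (hs : ∀ i, U (wS G (braidGen n i)) = qgen k G ρ n δ (.s i)) :
    ∀ (i : ℕ) (hi : i < n - 1), qee U (genPos ⟨i, hi⟩) (genPos' ⟨i, hi⟩)
      = qgen k G ρ n δ (.e ⟨i, hi⟩) := by
  intro i
  induction i with
  | zero =>
    intro hi
    have := qee_spec U hs (σ := 1) (genPos_ne ⟨0, hi⟩) (by
      intro i
      exact ⟨fun h => Fin.ext h, fun h => Fin.ext h⟩)
    rw [wS_one, map_one, mul_one, one_mul, qe0, dif_pos hi] at this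
    exact this
  | succ i ih =>
    intro hi
    have hi' : i < n - 1 := by omega
    have h1 := qee_conj U hs (braidGen n ⟨i, hi'⟩ * braidGen n ⟨i + 1, hi⟩)
      (genPos ⟨i, hi'⟩) (genPos' ⟨i, hi'⟩)
    have e1 : (braidGen n ⟨i, hi'⟩ * braidGen n ⟨i + 1, hi⟩) (genPos ⟨i, hi'⟩)
        = genPos ⟨i + 1, hi⟩ := by
      rw [Equiv.Perm.mul_apply, braidGen_eq, braidGen_eq,
        Equiv.swap_apply_of_ne_of_ne (a := genPos ⟨i + 1, hi⟩), Equiv.swap_apply_left]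
      · rfl
      · simp [genPos]
      · simp only [genPos, genPos', ne_eq, Fin.mk.injEq]; omega
    have e2 : (braidGen n ⟨i, hi'⟩ * braidGen n ⟨i + 1, hi⟩) (genPos' ⟨i, hi'⟩)
        = genPos' ⟨i + 1, hi⟩ := by
      have : genPos' ⟨i, hi'⟩ = genPos ⟨i + 1, hi⟩ := rfl
      rw [Equiv.Perm.mul_apply, braidGen_eq, braidGen_eq, this, Equiv.swap_apply_left,
        Equiv.swap_apply_of_ne_of_ne]
      · simp only [genPos, genPos', ne_eq, Fin.mk.injEq]; omega
      · simp [genPos', genPos]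
    rw [e1, e2, ih hi', wS_mul, map_mul, hs, hs] at h1
    have r1 := qrel k G ρ n δ (.sse ⟨i, hi'⟩ ⟨i + 1, hi⟩ (Or.inl rfl))
    have r2 := qrel k G ρ n δ (.ess ⟨i + 1, hi⟩ ⟨i, hi'⟩ (Or.inr rfl))
    have r3 := qrel k G ρ n δ (.e_hook ⟨i + 1, hi⟩ ⟨i, hi'⟩ (Or.inr rfl))
    simp only [map_mul] at r1 r2 r3
    have r2' : qgen k G ρ n δ (.e ⟨i + 1, hi⟩) * qgen k G ρ n δ (.s ⟨i, hi'⟩)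
      * qgen k G ρ n δ (.s ⟨i + 1, hi⟩) = qgen k G ρ n δ (.e ⟨i + 1, hi⟩)
      * qgen k G ρ n δ (.e ⟨i, hi'⟩) := r2
    have r1' : qgen k G ρ n δ (.s ⟨i, hi'⟩) * qgen k G ρ n δ (.s ⟨i + 1, hi⟩)
      * qgen k G ρ n δ (.e ⟨i, hi'⟩) = qgen k G ρ n δ (.e ⟨i + 1, hi⟩)
      * qgen k G ρ n δ (.e ⟨i, hi'⟩) := r1
    rw [r1', ← r2', ← hs, ← hs, mul_assoc] at h1
    have hu : IsUnit (U (wS G (braidGen n ⟨i, hi'⟩)) * U (wS G (braidGen n ⟨i + 1, hi⟩))) := by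
      rw [← map_mul]
      exact (Group.isUnit _).map U
    exact (hu.mul_right_cancel h1).symm

end AlgData2

section AlgData3

variable {k G : Type} [CommRing k] [CommGroup G] {ρ : G →* RingAut k} {n : ℕ} {δ : k}

theorem exists_brData (k G : Type) [CommRing k] [CommGroup G] (ρ : G →* RingAut k) (n : ℕ) (δ : k) :
    ∃ D : BrData k G ρ n δ (GBQAlg k G ρ n δ), ∀ x, D.gen x = qgen k G ρ n δ x := by
  obtain ⟨U, hs, ht⟩ := exists_qU k G ρ n δ
  have conj := qee_conj U hs
  have gen := qee_gen U hs
  have hn2 : ∀ p q : Fin n, p ≠ q → 0 < n - 1 := by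
    intro p q h
    have h1 := p.2
    have h2 := q.2
    have h3 : (p : ℕ) ≠ q := fun h' => h (Fin.ext h')
    omega
  -- reduction to the first hook
  have red : ∀ p q : Fin n, p ≠ q → ∃ (h : 0 < n - 1) (σ : Equiv.Perm (Fin n)),
      σ (genPos ⟨0, h⟩) = p ∧ σ (genPos' ⟨0, h⟩) = q := by
    intro p q h
    have h0 := hn2 p q h
    obtain ⟨σ, h1, h2⟩ := exists_perm2 (genPos_ne ⟨0, h0⟩) h
    exact ⟨h0, σ, h1, h2⟩
  have Umul : ∀ σ τ : Equiv.Perm (Fin n), U (wS G σ) * U (wS G τ) = U (wS G (σ * τ)) := by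
    intro σ τ
    rw [wS_mul, map_mul]
  have UT : ∀ (σ : Equiv.Perm (Fin n)) l g, U (wT (σ l) g) * U (wS G σ)
      = U (wS G σ) * U (wT l g) := by
    intro σ l g
    rw [← map_mul, ← map_mul, wS_wT]
  have cmul : ∀ (σ : Equiv.Perm (Fin n)) (a b a' b' : GBQAlg k G ρ n δ),
      a * U (wS G σ) = U (wS G σ) * b → a' * U (wS G σ) = U (wS G σ) * b' →
      (a * a') * U (wS G σ) = U (wS G σ) * (b * b') := by
    intro σ a b a' b' h h'
    rw [mul_assoc, h', ← mul_assoc, h, mul_assoc]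
  have absorb : ∀ p q, p ≠ q → qee U p q * U (wS G (Equiv.swap p q)) = qee U p q := by
    intro p q h
    obtain ⟨h0, σ, rfl, rfl⟩ := red p q h
    apply U_cancel U σ
    rw [mul_assoc, Umul, ← Equiv.mul_swap_eq_swap_mul, ← Umul, ← mul_assoc, ← conj, mul_assoc,
      gen 0 h0, ← braidGen_eq, hs]
    have := qrel k G ρ n δ (.es_absorb ⟨0, h0⟩)
    simp only [map_mul] at this
    exact congrArg _ this
  have absorb_l : ∀ p q, p ≠ q → U (wS G (Equiv.swap p q)) * qee U p q = qee U p q := by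
    intro p q h
    obtain ⟨h0, σ, rfl, rfl⟩ := red p q h
    apply U_cancel U σ
    rw [mul_assoc, ← conj, ← mul_assoc, Umul, ← Equiv.mul_swap_eq_swap_mul, ← Umul, mul_assoc,
      gen 0 h0, ← braidGen_eq, hs]
    have := qrel k G ρ n δ (.se_absorb ⟨0, h0⟩)
    simp only [map_mul] at this
    exact congrArg _ this
  have symm : ∀ p q, qee U p q = qee U q p := by
    intro p q
    by_cases h : p = q
    · rw [h]
    have h1 := conj (Equiv.swap p q) p q
    rw [Equiv.swap_apply_left, Equiv.swap_apply_right, absorb_l p q h] at h1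
    rw [h1, Equiv.swap_comm, absorb q p (Ne.symm h)]
  refine ⟨{ U := U, e := qee U, conj := conj, symm := symm, absorb := absorb, comm := ?_, hook := ?_,
            tcomm := ?_, tl := ?_, tr := ?_, loop := ?_ }, ?_⟩
  · intro p q r s h1 h2 h3 h4 h5 h6
    have hn : 4 ≤ n := by
      have := p.2
      have := q.2
      have := r.2
      have := s.2
      simp only [ne_eq, Fin.ext_iff] at h1 h2 h3 h4 h5 h6
      omega
    have i0 : 0 < n - 1 := by omega
    have i2 : 2 < n - 1 := by omega
    obtain ⟨σ, rfl, rfl, rfl, rfl⟩ := exists_perm4 (a := genPos ⟨0, i0⟩) (b := genPos' ⟨0, i0⟩)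
      (c := genPos ⟨2, i2⟩) (d := genPos' ⟨2, i2⟩) (by simp [genPos, genPos'])
      (by simp [genPos]) (by simp [genPos, genPos']) (by simp [genPos, genPos'])
      (by simp [genPos']) (by simp [genPos, genPos']) h1 h2 h3 h4 h5 h6
    apply U_cancel U σ
    rw [cmul σ _ _ _ _ (conj σ _ _).symm (conj σ _ _).symm,
      cmul σ _ _ _ _ (conj σ _ _).symm (conj σ _ _).symm, gen 0 i0, gen 2 i2]
    have := qrel k G ρ n δ (.ee_comm ⟨0, i0⟩ ⟨2, i2⟩ (by simp))
    simp only [map_mul] at this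
    exact congrArg _ this
  · intro p q r h1 h2 h3
    have hn : 3 ≤ n := by
      have := p.2
      have := q.2
      have := r.2
      simp only [ne_eq, Fin.ext_iff] at h1 h2 h3
      omega
    have i0 : 0 < n - 1 := by omega
    have i1 : 1 < n - 1 := by omega
    obtain ⟨σ, hp, hq, rfl⟩ := exists_perm3 (a := genPos' ⟨0, i0⟩) (b := genPos ⟨0, i0⟩)
      (c := genPos' ⟨1, i1⟩) (by simp [genPos, genPos'])
      (by simp [genPos']) (by simp [genPos, genPos']) h1 h2 h3
    have e1 : genPos' ⟨0, i0⟩ = genPos ⟨1, i1⟩ := rfl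
    apply U_cancel U σ
    rw [symm p q, ← hp, ← hq, cmul σ _ _ _ _ (conj σ _ _).symm (conj σ _ _).symm,
      cmul σ _ _ _ (U (wS G (Equiv.swap (genPos ⟨0, i0⟩) (genPos' ⟨1, i1⟩)))) (conj σ _ _).symm
        (by rw [Umul, Umul, Equiv.mul_swap_eq_swap_mul])]
    congr 1
    rw [gen 0 i0]
    nth_rewrite 1 [e1]
    rw [gen 1 i1]
    have := qrel k G ρ n δ (.ess ⟨0, i0⟩ ⟨1, i1⟩ (Or.inl rfl))
    simp only [map_mul] at this
    refine Eq.trans this.symm ?_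
    change qgen k G ρ n δ (.e ⟨0, i0⟩) * qgen k G ρ n δ (.s ⟨1, i1⟩) * qgen k G ρ n δ (.s ⟨0, i0⟩) = _
    have h5 : braidGen n ⟨1, i1⟩ * braidGen n ⟨0, i0⟩
        = Equiv.swap (genPos ⟨0, i0⟩) (genPos' ⟨0, i0⟩)
          * Equiv.swap (genPos ⟨0, i0⟩) (genPos' ⟨1, i1⟩) := by
      rw [Equiv.mul_swap_eq_swap_mul, Equiv.swap_apply_left, Equiv.swap_apply_of_ne_of_ne]
      · rfl
      · simp [genPos, genPos']
      · simp [genPos']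
    rw [← hs, ← hs, mul_assoc, Umul, h5, ← Umul, ← mul_assoc, ← gen 0 i0, absorb _ _ (genPos_ne _)]
  · intro l p q g h1 h2 h
    obtain ⟨h0, σ, rfl, rfl⟩ := red p q h
    obtain ⟨l, rfl⟩ := σ.surjective l
    apply U_cancel U σ
    rw [cmul σ _ _ _ _ (UT σ _ _) (conj σ _ _).symm,
      cmul σ _ _ _ _ (conj σ _ _).symm (UT σ _ _), gen 0 h0, ht]
    have := qrel k G ρ n δ (.et_comm g ⟨0, h0⟩ l
      ⟨fun h => h1 (congrArg σ (Fin.ext h)), fun h => h2 (congrArg σ (Fin.ext h))⟩)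
    simp only [map_mul] at this
    exact congrArg _ this.symm
  · intro p q g h
    obtain ⟨h0, σ, rfl, rfl⟩ := red p q h
    apply U_cancel U σ
    rw [cmul σ _ _ _ _ (UT σ _ _) (conj σ _ _).symm,
      cmul σ _ _ _ _ (UT σ _ _) (conj σ _ _).symm, gen 0 h0, ht, ht]
    have := qrel k G ρ n δ (.cap_slide_l g ⟨0, h0⟩ (genPos ⟨0, h0⟩) (genPos' ⟨0, h0⟩) rfl rfl)
    simp only [map_mul] at this
    exact congrArg _ this
  · intro p q g h
    obtain ⟨h0, σ, rfl, rfl⟩ := red p q h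
    apply U_cancel U σ
    rw [cmul σ _ _ _ _ (conj σ _ _).symm (UT σ _ _),
      cmul σ _ _ _ _ (conj σ _ _).symm (UT σ _ _), gen 0 h0, ht, ht]
    have := qrel k G ρ n δ (.cap_slide_r g ⟨0, h0⟩ (genPos ⟨0, h0⟩) (genPos' ⟨0, h0⟩) rfl rfl)
    simp only [map_mul] at this
    exact congrArg _ this
  · intro p q g h
    obtain ⟨h0, σ, rfl, rfl⟩ := red p q h
    apply U_cancel U σ
    rw [cmul σ _ _ _ _ (cmul σ _ _ _ _ (conj σ _ _).symm (UT σ _ _)) (conj σ _ _).symm,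
      smul_mul_assoc, ← conj, ← mul_smul_comm, gen 0 h0, ht]
    have := qrel k G ρ n δ (.loop g ⟨0, h0⟩ (genPos ⟨0, h0⟩) rfl)
    simp only [map_mul, map_smul] at this
    exact congrArg _ this
  · intro x
    cases x with
    | s i => exact hs i
    | e i => exact gen i.1 i.2
    | t g j => exact ht j g

end AlgData3

section Diagrams
set_option linter.unusedSimpArgs false

/-- labelled perfect matchings on a set of nodes -/
@[ext]
structure Dg (N G : Type) where
  μ : N → N
  l : N → G
  inv : ∀ z, μ (μ z) = z
  ne : ∀ z, μ z ≠ z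
  ll : ∀ z, l (μ z) = l z

namespace Dg

variable {N G : Type} [CommGroup G] [DecidableEq N]

/-- the hook operation -/
def hook (p q : N) (h : p ≠ q) (x : Dg N G) : Dg N G where
  μ z := if z = p then q else if z = q then p else if z = x.μ p then x.μ q
    else if z = x.μ q then x.μ p else x.μ z
  l z := if z = p then 1 else if z = q then 1 else if z = x.μ p then x.l p * x.l q
    else if z = x.μ q then x.l p * x.l q else x.l z
  inv z := by
    have := x.inv
    have := x.ne
    grind
  ne z := by
    have := x.inv
    have := x.ne
    grind
  ll z := by
    have := x.inv
    have := x.ne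
    have := x.ll
    grind

/-- permuting the nodes -/
def perm (σ : Equiv.Perm N) (x : Dg N G) : Dg N G where
  μ z := σ (x.μ (σ.symm z))
  l z := x.l (σ.symm z)
  inv z := by simp [x.inv]
  ne z := by
    intro h
    exact x.ne (σ.symm z) (by rw [Equiv.eq_symm_apply]; exact h)
  ll z := by simp [x.ll]

/-- changing the labels -/
def lab (f : N → G) (x : Dg N G) : Dg N G where
  μ := x.μ
  l z := f z * f (x.μ z) * x.l z
  inv := x.inv
  ne := x.ne
  ll z := by rw [x.inv, x.ll, mul_comm (f (x.μ z))]

lemma hook_symm (p q : N) (h : p ≠ q) (x : Dg N G) : hook p q h x = hook q p h.symm x := by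
  have := x.inv
  have := x.ne
  have := x.ll
  ext z
  · simp only [hook]; grind
  · simp only [hook]; grind

lemma hook_perm (p q : N) (h : p ≠ q) (σ : Equiv.Perm N) (x : Dg N G) :
    perm σ (hook p q h x) = hook (σ p) (σ q) (fun h' => h (σ.injective h')) (perm σ x) := by
  ext z
  · simp only [hook, perm, Equiv.symm_apply_eq, Equiv.symm_apply_apply]
    split_ifs <;> rfl
  · simp only [hook, perm, Equiv.symm_apply_eq, Equiv.symm_apply_apply]

lemma hook_absorb (p q : N) (h : p ≠ q) (x : Dg N G) :
    hook p q h (perm (Equiv.swap p q) x) = hook p q h x := by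
  have := x.inv
  have := x.ne
  have := x.ll
  ext z
  · simp only [hook, perm, Equiv.symm_swap, Equiv.swap_apply_def]; grind
  · simp only [hook, perm, Equiv.symm_swap, Equiv.swap_apply_def]; grind

lemma hook_hook (p q r : N) (h1 : p ≠ q) (h2 : p ≠ r) (h3 : q ≠ r) (x : Dg N G) :
    hook p q h1 (hook p r h2 x) = hook p q h1 (perm (Equiv.swap q r) x) := by
  have := x.inv
  have := x.ne
  have := x.ll
  ext z
  · simp only [hook, perm, Equiv.symm_swap, Equiv.swap_apply_def, h1, h1.symm, h2, h2.symm, h3,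
      h3.symm, if_true, if_false]; grind (splits := 40)
  · simp only [hook, perm, Equiv.symm_swap, Equiv.swap_apply_def, h1, h1.symm, h2, h2.symm, h3,
      h3.symm, if_true, if_false]; grind (splits := 40)

lemma hook_comm (p q r s : N) (h1 : p ≠ q) (h2 : p ≠ r) (h3 : p ≠ s) (h4 : q ≠ r) (h5 : q ≠ s)
    (h6 : r ≠ s) (x : Dg N G) :
    hook p q h1 (hook r s h6 x) = hook r s h6 (hook p q h1 x) := by
  have := x.inv
  have := x.ne
  have := x.ll
  ext z
  · simp only [hook, h1, h1.symm, h2, h2.symm, h3, h3.symm, h4, h5, h6, h4.symm, h5.symm, h6.symm,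
      if_true, if_false]; grind (splits := 40)
  · simp only [hook, h1, h1.symm, h2, h2.symm, h3, h3.symm, h4, h5, h6, h4.symm, h5.symm, h6.symm,
      if_true, if_false]; grind (splits := 40)

lemma hook_lab (p q : N) (h : p ≠ q) (f : N → G) (hp : f p = 1) (hq : f q = 1) (x : Dg N G) :
    hook p q h (lab f x) = lab f (hook p q h x) := by
  have := x.inv
  have := x.ne
  have := x.ll
  ext z
  · rfl
  · simp only [hook, lab]; grind

lemma hook_tr (p q : N) (h : p ≠ q) (g : G) (x : Dg N G) :
    hook p q h (lab (Pi.mulSingle p g) x) = hook p q h (lab (Pi.mulSingle q g) x) := by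
  have := x.inv
  have := x.ne
  have := x.ll
  ext z
  · rfl
  · simp only [hook, lab, Pi.mulSingle_apply]; grind

lemma hook_tl (p q : N) (h : p ≠ q) (g : G) (x : Dg N G) :
    lab (Pi.mulSingle p g) (hook p q h x) = lab (Pi.mulSingle q g) (hook p q h x) := by
  have := x.inv
  have := x.ne
  have := x.ll
  ext z
  · rfl
  · simp only [hook, lab, Pi.mulSingle_apply]; grind

lemma hook_loop (p q : N) (h : p ≠ q) (g : G) (x : Dg N G) :
    hook p q h (lab (Pi.mulSingle p g) (hook p q h x)) = hook p q h x := by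
  have := x.inv
  have := x.ne
  have := x.ll
  ext z
  · simp only [hook, lab, Pi.mulSingle_apply]; grind
  · simp only [hook, lab, Pi.mulSingle_apply]; grind

lemma lab_lab (f f' : N → G) (x : Dg N G) : lab f (lab f' x) = lab (f * f') x := by
  ext z
  · rfl
  · simp only [lab, Pi.mul_apply]
    exact by
      rw [← mul_assoc, mul_mul_mul_comm]

lemma perm_perm (σ τ : Equiv.Perm N) (x : Dg N G) : perm σ (perm τ x) = perm (σ * τ) x := rfl

lemma perm_lab (σ : Equiv.Perm N) (f : N → G) (x : Dg N G) :
    perm σ (lab f x) = lab (f ∘ σ.symm) (perm σ x) := by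
  ext z
  · rfl
  · simp [lab, perm]

lemma perm_one (x : Dg N G) : perm 1 x = x := rfl
lemma lab_one (x : Dg N G) : lab 1 x = x := by
  ext z
  · rfl
  · simp [lab]

section coef
variable {k : Type} [CommRing k] (ρ : G →* RingAut k) (δ : k)

/-- loop coefficient -/
def coef (p q : N) (x : Dg N G) : k := if x.μ p = q then ρ (x.l p) δ else 1

lemma coef_symm (p q : N) (x : Dg N G) : coef ρ δ p q x = coef ρ δ q p x := by
  have := x.inv
  have := x.ll
  simp only [coef]; grind

lemma coef_perm (p q : N) (σ : Equiv.Perm N) (x : Dg N G) :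
    coef ρ δ (σ p) (σ q) (perm σ x) = coef ρ δ p q x := by
  simp [coef, perm]

lemma coef_hook (p q r : N) (h1 : p ≠ q) (h2 : p ≠ r) (h3 : q ≠ r) (x : Dg N G) :
    coef ρ δ p q (hook p r h2 x) * coef ρ δ p r x
      = coef ρ δ p q (perm (Equiv.swap q r) x) := by
  have := x.inv
  have := x.ne
  have := x.ll
  simp only [coef, hook, perm, Equiv.symm_swap, Equiv.swap_apply_def, h1, h1.symm, h2, h2.symm, h3,
      h3.symm, if_true, if_false]; grind (splits := 40)

lemma coef_comm (p q r s : N) (h1 : p ≠ q) (h2 : p ≠ r) (h3 : p ≠ s) (h4 : q ≠ r) (h5 : q ≠ s)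
    (h6 : r ≠ s) (x : Dg N G) :
    coef ρ δ p q (hook r s h6 x) * coef ρ δ r s x
      = coef ρ δ r s (hook p q h1 x) * coef ρ δ p q x := by
  have := x.inv
  have := x.ne
  have := x.ll
  simp only [coef, hook, h1, h1.symm, h2, h2.symm, h3, h3.symm, h4, h5, h6, h4.symm, h5.symm,
      h6.symm, if_true, if_false]; grind (splits := 40)

lemma coef_lab (p q : N) (f : N → G) (hp : f p = 1) (hq : f q = 1) (x : Dg N G) :
    coef ρ δ p q (lab f x) = coef ρ δ p q x := by
  by_cases h : x.μ p = q
  · simp [coef, lab, h, hp, hq]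
  · simp [coef, lab, h]

lemma coef_tr (p q : N) (h : p ≠ q) (g : G) (x : Dg N G) :
    coef ρ δ p q (lab (Pi.mulSingle p g) x) = coef ρ δ p q (lab (Pi.mulSingle q g) x) := by
  by_cases h' : x.μ p = q
  · simp [coef, lab, h', h, h.symm]
  · simp [coef, lab, h']

lemma coef_loop (p q : N) (h : p ≠ q) (g : G) (x : Dg N G) :
    coef ρ δ p q (lab (Pi.mulSingle p g) (hook p q h x)) = ρ g δ := by
  simp [coef, lab, hook, h.symm]

end coef

end Dg
end Diagrams

section DiagRep

variable {k G : Type} [CommRing k] [CommGroup G] {n : ℕ}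

/-- diagrams -/
abbrev DX (G : Type) [CommGroup G] (n : ℕ) : Type := Dg (Fin n ⊕ Fin n) G

/-- the action of the wreath product on the left nodes -/
def act (w : GW G n) (x : DX G n) : DX G n :=
  Dg.lab (Sum.elim w.left 1) (Dg.perm (Equiv.sumCongr w.right 1) x)

lemma act_one (x : DX G n) : act 1 x = x := by
  have h1 : (Sum.elim (1 : GW G n).left 1 : Fin n ⊕ Fin n → G) = 1 := by
    funext z
    cases z <;> rfl
  have h2 : Equiv.sumCongr (1 : GW G n).right (1 : Equiv.Perm (Fin n)) = 1 := by
    ext z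
    cases z <;> rfl
  rw [act, h1, h2, Dg.perm_one, Dg.lab_one]

lemma act_mul (w w' : GW G n) (x : DX G n) : act (w * w') x = act w (act w' x) := by
  rw [act, act, act, Dg.perm_lab, Dg.lab_lab, Dg.perm_perm]
  congr 1
  · funext z
    cases z with
    | inl i => rfl
    | inr i => simp [Equiv.sumCongr]
  · congr 1
    ext z
    cases z <;> rfl

instance : MulAction (GW G n) (DX G n) where
  smul := act
  one_smul := act_one
  mul_smul := act_mul

lemma smul_def' (w : GW G n) (x : DX G n) : w • x = act w x := rfl

lemma wS_smul (σ : Equiv.Perm (Fin n)) (x : DX G n) :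
    wS G σ • x = Dg.perm (Equiv.sumCongr σ 1) x := by
  have h1 : (Sum.elim (wS G σ).left 1 : Fin n ⊕ Fin n → G) = 1 := by
    funext z
    cases z <;> rfl
  rw [smul_def', act, h1, Dg.lab_one]
  rfl

lemma wT_smul (p : Fin n) (g : G) (x : DX G n) :
    wT p g • x = Dg.lab (Pi.mulSingle (Sum.inl p) g) x := by
  have h1 : (Sum.elim (wT p g).left 1 : Fin n ⊕ Fin n → G) = Pi.mulSingle (Sum.inl p) g := by
    funext z
    cases z with
    | inl i =>
      change (Pi.mulSingle p g : Fin n → G) i = _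
      by_cases h : i = p
      · subst h; simp
      · rw [Pi.mulSingle_eq_of_ne h, Pi.mulSingle_eq_of_ne]
        simpa using h
    | inr i => simp
  have h2 : Equiv.sumCongr (wT p g).right (1 : Equiv.Perm (Fin n)) = 1 := by
    ext z
    cases z <;> rfl
  rw [smul_def', act, h1, h2, Dg.perm_one]

/-- hook on the left -/
def hk (p q : Fin n) (h : p ≠ q) (x : DX G n) : DX G n :=
  Dg.hook (Sum.inl p) (Sum.inl q) (fun h' => h (Sum.inl_injective h')) x

/-- no left-to-right connections -/
def Blank (x : DX G n) : Prop := ∀ p : Fin n, ∃ q : Fin n, x.μ (Sum.inl p) = Sum.inl q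

lemma Blank.smul {x : DX G n} (h : Blank x) (w : GW G n) : Blank (w • x) := by
  intro p
  obtain ⟨q, hq⟩ := h (w.right.symm p)
  refine ⟨w.right q, ?_⟩
  change Equiv.sumCongr w.right 1 (x.μ (Sum.inl (w.right.symm p))) = _
  rw [hq]
  rfl

lemma Blank.hk {x : DX G n} (h : Blank x) (p q : Fin n) (hpq : p ≠ q) : Blank (hk p q hpq x) := by
  intro z
  simp only [_root_.hk, Dg.hook]
  split_ifs
  · exact ⟨q, rfl⟩
  · exact ⟨p, rfl⟩
  · exact h _
  · exact h _
  · exact h _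

/-- the space spanned by the non-blank diagrams -/
abbrev VV (k G : Type) [CommRing k] [CommGroup G] (n : ℕ) : Type := {x : DX G n // ¬ Blank x} →₀ k

open Classical in
/-- the vector of a diagram -/
def dv (k : Type) [CommRing k] (x : DX G n) : VV k G n :=
  if h : Blank x then 0 else Finsupp.single ⟨x, h⟩ 1

lemma dv_blank {x : DX G n} (h : Blank x) : dv k x = 0 := dif_pos h
lemma dv_of {x : DX G n} (h : ¬ Blank x) : dv k x = Finsupp.single ⟨x, h⟩ 1 := dif_neg h

/-- operator -/
def op (c : DX G n → k) (f : DX G n → DX G n) : Module.End k (VV k G n) :=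
  Finsupp.lsum k fun x => LinearMap.toSpanSingleton k _ (c x.1 • dv k (f x.1))

lemma op_dv (c : DX G n → k) (f : DX G n → DX G n) (hf : ∀ x, Blank x → Blank (f x)) (x : DX G n) :
    op c f (dv k x) = c x • dv k (f x) := by
  by_cases h : Blank x
  · rw [dv_blank h, dv_blank (hf x h), map_zero, smul_zero]
  · rw [dv_of h, op]
    simp

lemma end_ext {a b : Module.End k (VV k G n)} (h : ∀ x, a (dv k x) = b (dv k x)) : a = b := by
  apply Finsupp.lhom_ext'
  intro x
  apply LinearMap.ext_ring
  have := h x.1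
  rw [dv_of x.2] at this
  exact this

/-- wreath product operators -/
def opU (k G : Type) [CommRing k] [CommGroup G] (n : ℕ) : GW G n →* Module.End k (VV k G n) where
  toFun w := op (fun _ => 1) (fun x => w • x)
  map_one' := by
    apply end_ext
    intro x
    rw [op_dv _ _ (fun x h => h.smul _), one_smul, one_smul]
    rfl
  map_mul' w w' := by
    apply end_ext
    intro x
    rw [Module.End.mul_apply, op_dv _ _ (fun x h => h.smul _), op_dv _ _ (fun x h => h.smul _),
      map_smul, op_dv _ _ (fun x h => h.smul _), mul_smul, one_smul, one_smul]

@[simp] lemma opU_dv (w : GW G n) (x : DX G n) : opU k G n w (dv k x) = dv k (w • x) := by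
  have h1 : opU k G n w = op (fun _ => 1) (fun x => w • x) := rfl
  rw [h1, op_dv _ _ (fun x h => h.smul _), one_smul]

variable (ρ : G →* RingAut k) (δ : k)

/-- loop coefficient -/
def cf (p q : Fin n) (x : DX G n) : k := Dg.coef ρ δ (Sum.inl p) (Sum.inl q) x

/-- hook operators -/
def opE (p q : Fin n) : Module.End k (VV k G n) :=
  if h : p = q then 0 else op (cf ρ δ p q) (hk p q h)

lemma opE_dv (p q : Fin n) (h : p ≠ q) (x : DX G n) :
    opE ρ δ p q (dv k x) = cf ρ δ p q x • dv k (hk p q h x) := by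
  rw [opE, dif_neg h, op_dv _ _ (fun x hx => hx.hk p q h)]

lemma wS_hk (σ : Equiv.Perm (Fin n)) (p q : Fin n) (h : p ≠ q) (x : DX G n) :
    wS G σ • hk p q h x = hk (σ p) (σ q) (fun h' => h (σ.injective h')) (wS G σ • x) := by
  rw [wS_smul, wS_smul, hk, Dg.hook_perm]
  rfl

lemma sumCongr_swap (p q : Fin n) : Equiv.sumCongr (Equiv.swap p q) (1 : Equiv.Perm (Fin n))
    = Equiv.swap (Sum.inl p) (Sum.inl q) := by
  ext z
  cases z with
  | inl i =>
    simp only [Equiv.swap_apply_def, Equiv.sumCongr_apply, Sum.map_inl, Sum.inl.injEq]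
    split_ifs <;> rfl
  | inr i => simp [Equiv.swap_apply_def]

/-- diagrams carry Brauer data -/
def brV (n : ℕ) : BrData k G ρ n δ (Module.End k (VV k G n)) where
  U := opU k G n
  e := opE ρ δ
  conj σ p q := by
    by_cases h : p = q
    · subst h; simp [opE]
    apply end_ext
    intro x
    rw [Module.End.mul_apply, Module.End.mul_apply, opE_dv _ _ _ _ h, map_smul, opU_dv, opU_dv,
      opE_dv _ _ _ _ (fun h' => h (σ.injective h')), wS_hk]
    congr 1
    rw [wS_smul]
    exact (Dg.coef_perm ρ δ _ _ (Equiv.sumCongr σ 1) x).symm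
  symm p q := by
    by_cases h : p = q
    · subst h; rfl
    apply end_ext
    intro x
    rw [opE_dv _ _ _ _ h, opE_dv _ _ _ _ (Ne.symm h), cf, Dg.coef_symm, hk, Dg.hook_symm]
    rfl
  absorb p q h := by
    apply end_ext
    intro x
    rw [Module.End.mul_apply, opU_dv, opE_dv _ _ _ _ h, opE_dv _ _ _ _ h, wS_smul, hk, sumCongr_swap,
      Dg.hook_absorb, cf, Dg.coef_symm]
    congr 1
    have := Dg.coef_perm ρ δ (Sum.inl p) (Sum.inl q) (Equiv.swap (Sum.inl p) (Sum.inl q)) x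
    rwa [Equiv.swap_apply_left, Equiv.swap_apply_right] at this
  comm p q r s h1 h2 h3 h4 h5 h6 := by
    apply end_ext
    intro x
    rw [Module.End.mul_apply, Module.End.mul_apply, opE_dv _ _ _ _ h1, opE_dv _ _ _ _ h6,
      map_smul, map_smul, opE_dv _ _ _ _ h1, opE_dv _ _ _ _ h6, smul_smul, smul_smul]
    have hi : ∀ {a b : Fin n}, a ≠ b → (Sum.inl a : Fin n ⊕ Fin n) ≠ Sum.inl b :=
      fun h h' => h (Sum.inl_injective h')
    congr 1
    · rw [mul_comm, mul_comm (cf ρ δ p q x)]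
      exact Dg.coef_comm ρ δ _ _ _ _ (hi h1) (hi h2) (hi h3) (hi h4) (hi h5) (hi h6) x
    · congr 1
      exact Dg.hook_comm _ _ _ _ (hi h1) (hi h2) (hi h3) (hi h4) (hi h5) (hi h6) x
  hook p q r h1 h2 h3 := by
    apply end_ext
    intro x
    rw [Module.End.mul_apply, Module.End.mul_apply, opE_dv _ _ _ _ h2, map_smul, opU_dv,
      opE_dv _ _ _ _ h1, opE_dv _ _ _ _ h1, smul_smul, wS_smul, sumCongr_swap]
    have hi : ∀ {a b : Fin n}, a ≠ b → (Sum.inl a : Fin n ⊕ Fin n) ≠ Sum.inl b :=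
      fun h h' => h (Sum.inl_injective h')
    congr 1
    · rw [mul_comm]
      exact Dg.coef_hook ρ δ _ _ _ (hi h1) (hi h2) (hi h3) x
    · congr 1
      exact Dg.hook_hook _ _ _ (hi h1) (hi h2) (hi h3) x
  tcomm l p q g h1 h2 h := by
    apply end_ext
    intro x
    rw [Module.End.mul_apply, Module.End.mul_apply, opE_dv _ _ _ _ h, map_smul, opU_dv, opU_dv,
      opE_dv _ _ _ _ h, wT_smul, wT_smul]
    have e1 : (Pi.mulSingle (Sum.inl l) g : Fin n ⊕ Fin n → G) (Sum.inl p) = 1 :=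
      Pi.mulSingle_eq_of_ne (fun h' => h1 (Sum.inl_injective h'.symm)) _
    have e2 : (Pi.mulSingle (Sum.inl l) g : Fin n ⊕ Fin n → G) (Sum.inl q) = 1 :=
      Pi.mulSingle_eq_of_ne (fun h' => h2 (Sum.inl_injective h'.symm)) _
    rw [cf, cf, Dg.coef_lab _ _ _ _ _ e1 e2, hk, hk, Dg.hook_lab _ _ _ _ e1 e2]
  tl p q g h := by
    apply end_ext
    intro x
    rw [Module.End.mul_apply, Module.End.mul_apply, opE_dv _ _ _ _ h, map_smul, opU_dv, map_smul,
      opU_dv, wT_smul, wT_smul, hk, Dg.hook_tl]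
  tr p q g h := by
    apply end_ext
    intro x
    rw [Module.End.mul_apply, Module.End.mul_apply, opU_dv, opU_dv, opE_dv _ _ _ _ h,
      opE_dv _ _ _ _ h, wT_smul, wT_smul, hk, Dg.hook_tr, cf, Dg.coef_tr]
    · rfl
    · exact fun h' => h (Sum.inl_injective h')
  loop p q g h := by
    apply end_ext
    intro x
    rw [Module.End.mul_apply, Module.End.mul_apply, LinearMap.smul_apply, opE_dv _ _ _ _ h,
      map_smul, map_smul, opU_dv, opE_dv _ _ _ _ h, wT_smul, smul_comm, hk, hk, Dg.hook_loop, cf,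
      Dg.coef_loop]

end DiagRep

section RepSec
set_option linter.unusedSimpArgs false

variable {k G : Type} [CommRing k] [CommGroup G] {ρ : G →* RingAut k} {n : ℕ} {δ : k}

/-! ### the diagram side -/

lemma hk_μ (p q : Fin n) (h : p ≠ q) (x : DX G n) (z : Fin n ⊕ Fin n) :
    (hk p q h x).μ z = if z = Sum.inl p then Sum.inl q else if z = Sum.inl q then Sum.inl p else
      if z = x.μ (Sum.inl p) then x.μ (Sum.inl q)
      else if z = x.μ (Sum.inl q) then x.μ (Sum.inl p) else x.μ z := rfl

lemma hk_l (p q : Fin n) (h : p ≠ q) (x : DX G n) (z : Fin n ⊕ Fin n) :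
    (hk p q h x).l z = if z = Sum.inl p then 1 else if z = Sum.inl q then 1 else
      if z = x.μ (Sum.inl p) then x.l (Sum.inl p) * x.l (Sum.inl q)
      else if z = x.μ (Sum.inl q) then x.l (Sum.inl p) * x.l (Sum.inl q) else x.l z := rfl

lemma wT_μ (p : Fin n) (g : G) (x : DX G n) (z : Fin n ⊕ Fin n) : (wT p g • x).μ z = x.μ z := by
  rw [wT_smul]; rfl

lemma wT_l (p : Fin n) (g : G) (x : DX G n) (z : Fin n ⊕ Fin n) :
    (wT p g • x).l z = (if z = Sum.inl p then g else 1) * (if x.μ z = Sum.inl p then g else 1)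
      * x.l z := by
  rw [wT_smul]; simp only [Dg.lab, Pi.mulSingle_apply]

lemma wS_μ_inl (σ : Equiv.Perm (Fin n)) (x : DX G n) (i : Fin n) :
    (wS G σ • x).μ (Sum.inl (σ i)) = Sum.map σ id (x.μ (Sum.inl i)) := by
  rw [wS_smul]; simp [Dg.perm]

lemma wS_μ_inr (σ : Equiv.Perm (Fin n)) (x : DX G n) (i : Fin n) :
    (wS G σ • x).μ (Sum.inr i) = Sum.map σ id (x.μ (Sum.inr i)) := by
  rw [wS_smul]; rfl

lemma wS_l_inl (σ : Equiv.Perm (Fin n)) (x : DX G n) (i : Fin n) :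
    (wS G σ • x).l (Sum.inl (σ i)) = x.l (Sum.inl i) := by
  rw [wS_smul]; simp [Dg.perm]

lemma wS_l_inr (σ : Equiv.Perm (Fin n)) (x : DX G n) (i : Fin n) :
    (wS G σ • x).l (Sum.inr i) = x.l (Sum.inr i) := by
  rw [wS_smul]; rfl

lemma inl_ne {p q : Fin n} (h : p ≠ q) : (Sum.inl p : Fin n ⊕ Fin n) ≠ Sum.inl q :=
  fun h' => h (Sum.inl_injective h')

lemma wT_hk_ne (l p q : Fin n) (h : p ≠ q) (h1 : l ≠ p) (h2 : l ≠ q) (g : G) (x : DX G n) :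
    hk p q h (wT l g • x) = wT l g • hk p q h x := by
  rw [wT_smul, wT_smul, hk, Dg.hook_lab]
  · rfl
  · exact Pi.mulSingle_eq_of_ne (inl_ne h1.symm) _
  · exact Pi.mulSingle_eq_of_ne (inl_ne h2.symm) _

lemma wT_hk_tl (p q : Fin n) (h : p ≠ q) (g : G) (x : DX G n) :
    wT p g • hk p q h x = wT q g • hk p q h x := by
  rw [wT_smul, wT_smul, hk, Dg.hook_tl]

lemma hk_tr (p q : Fin n) (h : p ≠ q) (g : G) (x : DX G n) :
    hk p q h (wT p g • x) = hk p q h (wT q g • x) := by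
  rw [wT_smul, wT_smul, hk, Dg.hook_tr]; rfl

lemma hk_symm (p q : Fin n) (h : p ≠ q) (x : DX G n) : hk p q h x = hk q p h.symm x :=
  Dg.hook_symm _ _ _ _

lemma hk_comm (p q r s : Fin n) (h1 : p ≠ q) (h2 : p ≠ r) (h3 : p ≠ s) (h4 : q ≠ r) (h5 : q ≠ s)
    (h6 : r ≠ s) (x : DX G n) : hk p q h1 (hk r s h6 x) = hk r s h6 (hk p q h1 x) :=
  Dg.hook_comm _ _ _ _ (inl_ne h1) (inl_ne h2) (inl_ne h3) (inl_ne h4) (inl_ne h5) (inl_ne h6) x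

lemma hk_absorb (p q : Fin n) (h : p ≠ q) (x : DX G n) :
    hk p q h (wS G (Equiv.swap p q) • x) = hk p q h x := by
  rw [wS_smul, sumCongr_swap]
  exact Dg.hook_absorb _ _ _ _

lemma hk_hook (p q r : Fin n) (h1 : p ≠ q) (h2 : p ≠ r) (h3 : q ≠ r) (x : DX G n) :
    hk p q h1 (hk p r h2 x) = hk p q h1 (wS G (Equiv.swap q r) • x) := by
  rw [wS_smul, sumCongr_swap]
  exact Dg.hook_hook _ _ _ (inl_ne h1) (inl_ne h2) (inl_ne h3) x

lemma hk_hook_l (p q r : Fin n) (h1 : p ≠ q) (h2 : p ≠ r) (h3 : q ≠ r) (x : DX G n) :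
    hk p q h1 (hk p r h2 x) = wS G (Equiv.swap q r) • hk p r h2 x := by
  rw [hk_hook p q r h1 h2 h3, wS_hk]
  simp only [Equiv.swap_apply_of_ne_of_ne h1 h2, Equiv.swap_apply_right]

lemma hk_ee (p q r : Fin n) (h1 : p ≠ q) (h2 : p ≠ r) (h3 : q ≠ r) (x : DX G n) :
    hk p q h1 (hk p r h2 (hk p q h1 x)) = hk p q h1 x := by
  rw [hk_hook_l p q r h1 h2 h3, hk_hook_l p r q h2 h1 h3.symm, ← mul_smul, Equiv.swap_comm r q,
    wS_swap_sq, one_smul]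

/-- `s_42 s_13 e_12 e_34 = e_34 e_12` -/
lemma hk_dbl (p q c d : Fin n) (h1 : p ≠ q) (h2 : p ≠ c) (h3 : p ≠ d) (h4 : q ≠ c) (h5 : q ≠ d)
    (h6 : c ≠ d) (x : DX G n) :
    wS G (Equiv.swap d q) • wS G (Equiv.swap c p) • hk p q h1 (hk c d h6 x)
      = hk p q h1 (hk c d h6 x) := by
  rw [hk_symm p q, ← hk_hook_l q c p h4 h1.symm h2.symm, hk_symm q c,
    ← hk_hook_l c d q h6 h4.symm h5.symm, hk_symm q p,
    hk_comm p q c d h1 h2 h3 h4 h5 h6, hk_ee c d q h6 h4.symm h5.symm]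

lemma hk_dbl_r (p q c d : Fin n) (h1 : p ≠ q) (h2 : p ≠ c) (h3 : p ≠ d) (h4 : q ≠ c) (h5 : q ≠ d)
    (h6 : c ≠ d) (x : DX G n) :
    hk p q h1 (hk c d h6 (wS G (Equiv.swap d q) • wS G (Equiv.swap c p) • x))
      = hk p q h1 (hk c d h6 x) := by
  rw [← hk_dbl p q c d h1 h2 h3 h4 h5 h6 x, wS_hk, wS_hk, wS_hk, wS_hk, hk_comm p q c d h1 h2 h3 h4 h5 h6]
  simp only [Equiv.swap_apply_of_ne_of_ne h2 h1, Equiv.swap_apply_right, Equiv.swap_apply_left,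
    Equiv.swap_apply_of_ne_of_ne h4 h1.symm, Equiv.swap_apply_of_ne_of_ne h3 h1,
    Equiv.swap_apply_of_ne_of_ne h6.symm h3.symm, Equiv.swap_apply_of_ne_of_ne h6 h4.symm]

variable {B : Type} [Ring B] [Algebra k B] (D : BrData k G ρ n δ B)

lemma BrData.dbl_r (p q c d : Fin n) (h1 : p ≠ q) (h2 : p ≠ c) (h3 : p ≠ d) (h4 : q ≠ c)
    (h5 : q ≠ d) (h6 : c ≠ d) :
    D.e p q * D.e c d * (D.U (wS G (Equiv.swap d q)) * D.U (wS G (Equiv.swap c p)))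
      = D.e p q * D.e c d := by
  have key : D.U (wS G (Equiv.swap d q)) * (D.U (wS G (Equiv.swap c p)) * (D.e p q * D.e c d))
      = D.e p q * D.e c d := by
    rw [← mul_assoc (D.U (wS G (Equiv.swap c p))), D.symm p q,
      ← D.hook_l q c p h4 h1.symm h2.symm, D.symm q c, mul_assoc, ← mul_assoc,
      ← D.hook_l c d q h6 h4.symm h5.symm, D.symm q p,
      D.comm p q c d h1 h2 h3 h4 h5 h6, ← mul_assoc, D.eee c d q h6 h4.symm h5.symm]
  have h7 : D.U (wS G (Equiv.swap d q)) * (D.U (wS G (Equiv.swap c p)) * (D.e p q * D.e c d))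
      = D.e c d * D.e p q * (D.U (wS G (Equiv.swap d q)) * D.U (wS G (Equiv.swap c p))) := by
    rw [← mul_assoc (D.U (wS G (Equiv.swap c p))), D.conj, mul_assoc, D.conj, ← mul_assoc, D.conj,
      mul_assoc, ← mul_assoc (D.U _), D.conj]
    simp only [Equiv.swap_apply_of_ne_of_ne h2 h1, Equiv.swap_apply_right, Equiv.swap_apply_left,
      Equiv.swap_apply_of_ne_of_ne h4 h1.symm, Equiv.swap_apply_of_ne_of_ne h3 h1,
      Equiv.swap_apply_of_ne_of_ne h6.symm h3.symm, Equiv.swap_apply_of_ne_of_ne h6 h4.symm,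
      mul_assoc]
  rw [D.comm p q c d h1 h2 h3 h4 h5 h6, ← h7, key, D.comm p q c d h1 h2 h3 h4 h5 h6]

/-- through nodes -/
def Th (x : DX G n) (p : Fin n) : Prop := ∃ b : Fin n, x.μ (Sum.inl p) = Sum.inr b

/-- the identity diagram -/
def dgOne (G : Type) [CommGroup G] (n : ℕ) : DX G n where
  μ := Sum.swap
  l _ := 1
  inv := Sum.swap_swap
  ne z := by cases z <;> simp
  ll _ := rfl

/-- elements representing diagrams -/
inductive BRep : DX G n → B → Prop
  | one : BRep (dgOne G n) 1
  | wS (σ : Equiv.Perm (Fin n)) {x : DX G n} {a : B} (h : BRep x a) :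
      BRep (wS G σ • x) (D.U (wS G σ) * a)
  | wT (p : Fin n) (g : G) {x : DX G n} {a : B} (h : BRep x a) :
      BRep (wT p g • x) (D.U (wT p g) * a)
  | hk (p q : Fin n) (hpq : p ≠ q) {x : DX G n} {a : B} (h : BRep x a) (hp : Th x p)
      (hq : Th x q) : BRep (hk p q hpq x) (D.e p q * a)

end RepSec

section RepSec2
set_option linter.unusedSimpArgs false

variable {k G : Type} [CommRing k] [CommGroup G] {ρ : G →* RingAut k} {n : ℕ} {δ : k}
variable {B : Type} [Ring B] [Algebra k B] {D : BrData k G ρ n δ B}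

lemma GW_ind (P : Submonoid (GW G n)) (hS : ∀ σ, wS G σ ∈ P) (hT : ∀ l g, wT l g ∈ P) (w : GW G n) :
    w ∈ P := by
  rw [← SemidirectProduct.inl_left_mul_inr_right w]
  refine P.mul_mem ?_ (hS _)
  have h : w.left ∈ P.comap (SemidirectProduct.inl : (Fin n → G) →* GW G n) := by
    rw [← Finset.univ_prod_mulSingle w.left]
    exact Submonoid.prod_mem _ (fun i _ => hT i _)
  exact h

lemma BRep.smul {x : DX G n} {a : B} (h : BRep D x a) (w : GW G n) : BRep D (w • x) (D.U w * a) := by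
  let P : Submonoid (GW G n) :=
    { carrier := {w | ∀ x a, BRep D x a → BRep D (w • x) (D.U w * a)}
      one_mem' := by
        intro x a h
        rwa [one_smul, map_one, one_mul]
      mul_mem' := by
        intro w w' hw hw' x a h
        rw [mul_smul, map_mul, mul_assoc]
        exact hw _ _ (hw' _ _ h) }
  exact GW_ind P (fun σ _ _ h => h.wS σ) (fun l g _ _ h => h.wT l g) w x a h

lemma Th.wS {x : DX G n} {p : Fin n} (h : Th x p) (σ : Equiv.Perm (Fin n)) :
    Th (wS G σ • x) (σ p) := by
  obtain ⟨b, hb⟩ := h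
  exact ⟨b, by rw [wS_μ_inl, hb]; rfl⟩

lemma Th.wT {x : DX G n} {p : Fin n} (h : Th x p) (l : Fin n) (g : G) :
    Th (wT l g • x) p := by
  obtain ⟨b, hb⟩ := h
  exact ⟨b, by rw [wT_μ, hb]⟩

lemma hk_μ_ne {x : DX G n} {r s : Fin n} (hrs : r ≠ s) (hr : Th x r) (hs : Th x s) {p : Fin n}
    (h1 : p ≠ r) (h2 : p ≠ s) : (hk r s hrs x).μ (Sum.inl p) = x.μ (Sum.inl p) ∧
      (hk r s hrs x).l (Sum.inl p) = x.l (Sum.inl p) := by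
  obtain ⟨b, hb⟩ := hr
  obtain ⟨c, hc⟩ := hs
  rw [hk_μ, hk_l, hb, hc]
  simp [h1, h2]

lemma hk_μ_left {x : DX G n} {r s : Fin n} (hrs : r ≠ s) :
    (hk r s hrs x).μ (Sum.inl r) = Sum.inl s := by
  simp [hk_μ]

lemma hk_μ_right {x : DX G n} {r s : Fin n} (hrs : r ≠ s) :
    (hk r s hrs x).μ (Sum.inl s) = Sum.inl r := by
  simp [hk_μ, hrs.symm]

lemma BRep.factor {x : DX G n} {a : B} (h : BRep D x a) : ∀ (p q : Fin n) (hpq : p ≠ q)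
    (_ : x.μ (Sum.inl p) = Sum.inl q) (g : G) (_ : x.l (Sum.inl p) = g),
    ∃ y b, BRep D y b ∧ Th y p ∧ Th y q ∧ x = _root_.wT p g • _root_.hk p q hpq y ∧
      a = D.U (_root_.wT p g) * (D.e p q * b) := by
  induction h with
  | one =>
    intro p q hpq hx
    exact absurd hx (by simp [dgOne])
  | @wS σ x a h ih =>
    intro p q hpq hx g hg
    obtain ⟨p, rfl⟩ := σ.surjective p
    obtain ⟨q, rfl⟩ := σ.surjective q
    rw [wS_μ_inl] at hx
    have hx' : x.μ (Sum.inl p) = Sum.inl q := by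
      generalize x.μ (Sum.inl p) = z at hx
      cases z <;> simp_all
    rw [wS_l_inl] at hg
    have hpq' : p ≠ q := fun h => hpq (congrArg σ h)
    obtain ⟨y, b, h1, h2, h3, h4, h5⟩ := ih p q hpq' hx' g hg
    refine ⟨_, _, h1.wS σ, h2.wS σ, h3.wS σ, ?_, ?_⟩
    · rw [h4, ← mul_smul, wS_wT, mul_smul, wS_hk]
    · rw [h5, ← mul_assoc, ← map_mul, wS_wT, map_mul, mul_assoc, ← mul_assoc (D.U (_root_.wS G σ)),
        D.conj, mul_assoc (D.e _ _)]
  | @wT l c x a h ih =>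
    intro p q hpq hx g hg
    rw [wT_μ] at hx
    rw [wT_l, hx] at hg
    obtain ⟨y, b, h1, h2, h3, h4, h5⟩ := ih p q hpq hx _ rfl
    generalize x.l (Sum.inl p) = m at *
    by_cases hp : l = p
    · subst hp
      have hg' : g = c * m := by simpa [hpq.symm] using hg.symm
      refine ⟨_, _, h1, h2, h3, ?_, ?_⟩
      · rw [h4, hg', wT_mul, mul_smul]
      · rw [h5, hg', wT_mul, map_mul, mul_assoc]
    by_cases hq : l = q
    · subst hq
      have hg' : g = c * m := by simpa [hpq, Ne.symm hp] using hg.symm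
      refine ⟨_, _, h1, h2, h3, ?_, ?_⟩
      · rw [h4, hg', mul_comm, wT_mul, mul_smul, ← mul_smul, wT_comm, mul_smul, wT_hk_tl p l]
      · rw [h5, hg', mul_comm, wT_mul, map_mul, ← mul_assoc, ← map_mul, wT_comm, map_mul,
          mul_assoc, ← mul_assoc (D.U (_root_.wT l c)), ← D.tl p l c hpq, mul_assoc, mul_assoc]
    · have hg' : g = m := by simpa [Ne.symm hp, Ne.symm hq] using hg.symm
      refine ⟨_, _, h1.wT l c, h2.wT l c, h3.wT l c, ?_, ?_⟩
      · rw [h4, hg', ← mul_smul, wT_comm, mul_smul, wT_hk_ne l p q hpq hp hq]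
      · rw [h5, hg', ← mul_assoc, ← map_mul, wT_comm, map_mul, mul_assoc,
          ← mul_assoc (D.U (_root_.wT l c)), D.tcomm l p q c hp hq hpq, mul_assoc]
  | @hk r s hrs x a h hr hs ih =>
    intro p q hpq hx g hg
    by_cases hp : p = r
    · subst hp
      rw [hk_μ_left] at hx
      have hx := Sum.inl_injective hx
      subst hx
      have hg' : g = 1 := by rw [← hg, hk_l]; simp
      refine ⟨_, _, h, hr, hs, ?_, ?_⟩
      · rw [hg', wT_one, one_smul]
      · rw [hg', wT_one, map_one, one_mul]
    by_cases hp2 : p = s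
    · subst hp2
      rw [hk_μ_right] at hx
      have hx := Sum.inl_injective hx
      subst hx
      have hg' : g = 1 := by rw [← hg, hk_l]; simp
      refine ⟨_, _, h, hs, hr, ?_, ?_⟩
      · rw [hg', wT_one, one_smul, hk_symm]
      · rw [hg', wT_one, map_one, one_mul, D.symm]
    obtain ⟨e1, e2⟩ := hk_μ_ne hrs hr hs hp hp2
    rw [e1] at hx
    rw [e2] at hg
    have hq : q ≠ r := by
      rintro rfl
      obtain ⟨c, hc⟩ := hr
      rw [← hx, x.inv] at hc
      simp at hc
    have hq2 : q ≠ s := by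
      rintro rfl
      obtain ⟨c, hc⟩ := hs
      rw [← hx, x.inv] at hc
      simp at hc
    obtain ⟨y, b, h1, h2, h3, h4, h5⟩ := ih p q hpq hx _ hg
    have k1 : ∀ z, z ≠ p → z ≠ q → Th x z → Th y z := by
      rintro z z1 z2 ⟨c, hc⟩
      rw [h4, wT_μ, (hk_μ_ne hpq h2 h3 z1 z2).1] at hc
      exact ⟨c, hc⟩
    have hr' := k1 r (Ne.symm hp) hq.symm hr
    have hs' := k1 s (Ne.symm hp2) hq2.symm hs
    have k2 : ∀ z, z ≠ r → z ≠ s → Th y z → Th (_root_.hk r s hrs y) z := by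
      rintro z z1 z2 ⟨c, hc⟩
      exact ⟨c, by rw [(hk_μ_ne hrs hr' hs' z1 z2).1, hc]⟩
    refine ⟨_, _, h1.hk r s hrs hr' hs', k2 p hp hp2 h2, k2 q hq hq2 h3, ?_, ?_⟩
    · rw [h4, wT_hk_ne p r s hrs hp hp2, hk_comm p q r s hpq hp hp2 hq hq2 hrs]
    · rw [h5, ← mul_assoc, ← D.tcomm p r s g hp hp2 hrs, mul_assoc, ← mul_assoc (D.e r s),
        ← D.comm p q r s hpq hp hp2 hq hq2 hrs, mul_assoc]

/-- the labelled hooks -/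
def BrData.el (D : BrData k G ρ n δ B) (p q : Fin n) (m : G) : B :=
  D.U (wT p m⁻¹) * D.e p q * D.U (wT p m)

lemma BrData.el_symm (D : BrData k G ρ n δ B) {p q : Fin n} (h : p ≠ q) (m : G) :
    D.el p q m = D.el q p m := by
  rw [el, el, D.tl p q _ h, mul_assoc, D.tr p q _ h, ← mul_assoc, D.symm]

/-- Moving hooks from the left to the right. -/
lemma BRep.move {x : DX G n} {a : B} (h : BRep D x a) : ∀ (p q : Fin n) (_ : p ≠ q)
    (b c : Fin n) (_ : x.μ (Sum.inl p) = Sum.inr b) (_ : x.μ (Sum.inl q) = Sum.inr c) (m : G),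
    D.el p q m * a = a * D.el b c (m * (x.l (Sum.inl p) * x.l (Sum.inl q))) := by
  induction h with
  | one =>
    intro p q hpq b c hb hc m
    have hb' : p = b := by simpa [dgOne] using hb
    have hc' : q = c := by simpa [dgOne] using hc
    subst hb' hc'
    simp [dgOne]
  | @wS σ x a h ih =>
    intro p q hpq b c hb hc m
    obtain ⟨p, rfl⟩ := σ.surjective p
    obtain ⟨q, rfl⟩ := σ.surjective q
    rw [wS_μ_inl] at hb hc
    have hb' : x.μ (Sum.inl p) = Sum.inr b := by
      generalize x.μ (Sum.inl p) = z at hb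
      cases z <;> simp_all
    have hc' : x.μ (Sum.inl q) = Sum.inr c := by
      generalize x.μ (Sum.inl q) = z at hc
      cases z <;> simp_all
    rw [wS_l_inl, wS_l_inl, mul_assoc, ← ih p q (fun h => hpq (congrArg σ h)) b c hb' hc' m,
      ← mul_assoc, ← mul_assoc]
    congr 1
    have e1 : ∀ u : G, D.U (_root_.wT (σ p) u) * D.U (_root_.wS G σ)
        = D.U (_root_.wS G σ) * D.U (_root_.wT p u) := by
      intro u
      rw [← map_mul, ← map_mul, wS_wT]
    rw [BrData.el, BrData.el, mul_assoc, e1, ← mul_assoc, mul_assoc (D.U _) (D.e _ _), ← D.conj,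
      ← mul_assoc, e1]
    simp only [mul_assoc]
  | @wT l g x a h ih =>
    intro p q hpq b c hb hc m
    rw [wT_μ] at hb hc
    have hl : (_root_.wT l g • x).l (Sum.inl p) * (_root_.wT l g • x).l (Sum.inl q)
        = (if l = p ∨ l = q then g else 1) * (x.l (Sum.inl p) * x.l (Sum.inl q)) := by
      rw [wT_l, wT_l, hb, hc]
      by_cases hp : l = p
      · subst hp
        simp [hpq.symm, mul_assoc]
      by_cases hq : l = q
      · subst hq
        simp [hpq, mul_left_comm]
      · simp [hp, hq, Ne.symm hp, Ne.symm hq]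
    rw [hl, ← mul_assoc m, mul_assoc, ← ih p q hpq b c hb hc, ← mul_assoc, ← mul_assoc]
    congr 1
    have e1 : ∀ (p q : Fin n), D.el p q m * D.U (_root_.wT p g)
        = D.U (_root_.wT p g) * D.el p q (m * g) := by
      intro p q
      have h1 : D.U (_root_.wT p g) * D.U (_root_.wT p (m * g)⁻¹) = D.U (_root_.wT p m⁻¹) := by
        rw [← map_mul, ← wT_mul]
        congr 2
        simp
      have h2 : D.U (_root_.wT p (m * g)) = D.U (_root_.wT p m) * D.U (_root_.wT p g) := by
        rw [← map_mul, ← wT_mul]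
      rw [BrData.el, BrData.el, ← mul_assoc, ← mul_assoc, h1, h2, mul_assoc (_ * _), ]
    by_cases hp : l = p
    · subst hp
      simp only [true_or, if_true]
      exact e1 l q
    by_cases hq : l = q
    · subst hq
      simp only [or_true, if_true]
      rw [D.el_symm hpq, e1, D.el_symm hpq.symm]
    · simp only [hp, hq, or_self, if_false, mul_one]
      rw [BrData.el, mul_assoc, ← map_mul, wT_comm, map_mul, ← mul_assoc, mul_assoc (D.U _),
        ← D.tcomm l p q g hp hq hpq, ← mul_assoc, ← map_mul, wT_comm, map_mul]
      simp only [mul_assoc]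
  | @hk r s hrs x a h hr hs ih =>
    intro p q hpq b c hb hc m
    have k1 : ∀ z d, (_root_.hk r s hrs x).μ (Sum.inl z) = Sum.inr d → z ≠ r ∧ z ≠ s := by
      intro z d hz
      constructor
      · rintro rfl
        rw [hk_μ_left] at hz
        simp at hz
      · rintro rfl
        rw [hk_μ_right] at hz
        simp at hz
    obtain ⟨p1, p2⟩ := k1 p b hb
    obtain ⟨q1, q2⟩ := k1 q c hc
    obtain ⟨e1, e2⟩ := hk_μ_ne hrs hr hs p1 p2
    obtain ⟨e3, e4⟩ := hk_μ_ne hrs hr hs q1 q2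
    rw [e1] at hb
    rw [e3] at hc
    rw [e2, e4, mul_assoc, ← ih p q hpq b c hb hc, ← mul_assoc, ← mul_assoc]
    congr 1
    rw [BrData.el, mul_assoc, D.tcomm p r s _ p1 p2 hrs, ← mul_assoc, mul_assoc (D.U _),
      D.comm p q r s hpq p1 p2 q1 q2 hrs, ← mul_assoc, D.tcomm p r s _ p1 p2 hrs]
    simp only [mul_assoc]

end RepSec2

section RepSec3
set_option linter.unusedSimpArgs false

variable {k G : Type} [CommRing k] [CommGroup G] {ρ : G →* RingAut k} {n : ℕ} {δ : k}
variable {B : Type} [Ring B] [Algebra k B] {D : BrData k G ρ n δ B}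

lemma th_or (x : DX G n) (p : Fin n) : Th x p ∨ ∃ q, x.μ (Sum.inl p) = Sum.inl q := by
  rcases h : x.μ (Sum.inl p) with q | b
  · exact Or.inr ⟨q, rfl⟩
  · exact Or.inl ⟨b, h⟩

lemma Th.not {x : DX G n} {p q : Fin n} (h : Th x p) (h' : x.μ (Sum.inl p) = Sum.inl q) : False := by
  obtain ⟨b, hb⟩ := h
  rw [hb] at h'
  cases h'

lemma hook_ne {x : DX G n} {p q : Fin n} (h : x.μ (Sum.inl p) = Sum.inl q) : p ≠ q := by
  rintro rfl
  exact x.ne _ h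

lemma hook_ne_r {x : DX G n} {p q : Fin n} (h : x.μ (Sum.inr p) = Sum.inr q) : p ≠ q := by
  rintro rfl
  exact x.ne _ h

lemma exists_right_hook {x : DX G n} {p q : Fin n} (h : x.μ (Sum.inl p) = Sum.inl q) :
    ∃ b c, x.μ (Sum.inr b) = Sum.inr c := by
  by_contra hc
  push Not at hc
  have h1 : ∀ b, ∃ a, x.μ (Sum.inr b) = Sum.inl a := by
    intro b
    rcases hb : x.μ (Sum.inr b) with q | c
    · exact ⟨q, rfl⟩
    · exact absurd hb (hc b c)
  choose f hf using h1
  have hinj : Function.Injective f := by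
    intro b c hbc
    have := hf b
    rw [hbc, ← hf c] at this
    have := congrArg x.μ this
    rw [x.inv, x.inv] at this
    exact Sum.inr_injective this
  obtain ⟨b, rfl⟩ := (Finite.injective_iff_surjective.1 hinj) p
  rw [← hf b, x.inv] at h
  cases h

lemma exists_left_hook {x : DX G n} {p q : Fin n} (h : x.μ (Sum.inr p) = Sum.inr q) :
    ∃ b c, x.μ (Sum.inl b) = Sum.inl c := by
  by_contra hc
  push Not at hc
  have h1 : ∀ b, ∃ a, x.μ (Sum.inl b) = Sum.inr a := by
    intro b
    rcases hb : x.μ (Sum.inl b) with q | c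
    · exact absurd hb (hc b q)
    · exact ⟨c, rfl⟩
  choose f hf using h1
  have hinj : Function.Injective f := by
    intro b c hbc
    have := hf b
    rw [hbc, ← hf c] at this
    have := congrArg x.μ this
    rw [x.inv, x.inv] at this
    exact Sum.inl_injective this
  obtain ⟨b, rfl⟩ := (Finite.injective_iff_surjective.1 hinj) p
  rw [← hf b, x.inv] at h
  cases h

open Classical in
/-- the number of left nodes on left hooks -/
def lk (x : DX G n) : ℕ := (Finset.univ.filter (fun p : Fin n => ¬ Th x p)).card

lemma th_hk {x : DX G n} {r s : Fin n} (hrs : r ≠ s) (hr : Th x r) (hs : Th x s) (p : Fin n) :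
    Th (hk r s hrs x) p ↔ p ≠ r ∧ p ≠ s ∧ Th x p := by
  constructor
  · intro h
    have h1 : p ≠ r := by
      rintro rfl
      exact h.not (hk_μ_left hrs)
    have h2 : p ≠ s := by
      rintro rfl
      exact h.not (hk_μ_right hrs)
    refine ⟨h1, h2, ?_⟩
    obtain ⟨b, hb⟩ := h
    rw [(hk_μ_ne hrs hr hs h1 h2).1] at hb
    exact ⟨b, hb⟩
  · rintro ⟨h1, h2, b, hb⟩
    exact ⟨b, by rw [(hk_μ_ne hrs hr hs h1 h2).1, hb]⟩

lemma th_wT (l : Fin n) (g : G) (x : DX G n) (p : Fin n) : Th (wT l g • x) p ↔ Th x p := by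
  simp only [Th, wT_μ]

lemma lk_lt {x : DX G n} {r s : Fin n} (hrs : r ≠ s) (hr : Th x r) (hs : Th x s) (l : Fin n) (g : G) :
    lk x < lk (wT l g • hk r s hrs x) := by
  classical
  apply Finset.card_lt_card
  rw [Finset.ssubset_iff_of_subset]
  · refine ⟨r, ?_, ?_⟩
    · simp [th_wT, th_hk hrs hr hs]
    · simp [hr]
  · intro p
    simp only [Finset.mem_filter, Finset.mem_univ, true_and, th_wT, th_hk hrs hr hs]
    tauto

lemma hk_right {y : DX G n} {p q : Fin n} (hpq : p ≠ q) {b c : Fin n}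
    (hb : y.μ (Sum.inl p) = Sum.inr b) (hc : y.μ (Sum.inl q) = Sum.inr c) :
    (hk p q hpq y).μ (Sum.inr b) = Sum.inr c ∧ (hk p q hpq y).μ (Sum.inr c) = Sum.inr b ∧
    (hk p q hpq y).l (Sum.inr b) = y.l (Sum.inl p) * y.l (Sum.inl q) ∧
    (hk p q hpq y).l (Sum.inr c) = y.l (Sum.inl p) * y.l (Sum.inl q) ∧
    ∀ z, z ≠ b → z ≠ c → (hk p q hpq y).μ (Sum.inr z) = y.μ (Sum.inr z) ∧
      (hk p q hpq y).l (Sum.inr z) = y.l (Sum.inr z) := by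
  simp only [hk_μ, hk_l, hb, hc]
  have : b ≠ c := by
    rintro rfl
    rw [← hc] at hb
    have := congrArg y.μ hb
    rw [y.inv, y.inv] at this
    exact hpq (Sum.inl_injective this)
  refine ⟨by simp, by simp [this.symm], by simp, by simp, ?_⟩
  intro z h1 h2
  simp [h1, h2]

lemma wT_l_inr (l : Fin n) (g : G) (x : DX G n) {b c : Fin n} (h : x.μ (Sum.inr b) = Sum.inr c) :
    (wT l g • x).l (Sum.inr b) = x.l (Sum.inr b) := by
  rw [wT_l, h]; simp

/-- Controlled factorization. -/
lemma BRep.norm {y : DX G n} {b : B} (h : BRep D y b) {p q β β' : Fin n} (hpq : p ≠ q)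
    (h1 : y.μ (Sum.inl p) = Sum.inr β) (h2 : y.μ (Sum.inl q) = Sum.inr β') :
    ∃ y' b', BRep D y' b' ∧ y'.μ (Sum.inl p) = Sum.inr β ∧ y'.μ (Sum.inl q) = Sum.inr β' ∧
      y'.l (Sum.inl p) = 1 ∧ _root_.hk p q hpq y = _root_.hk p q hpq y' ∧ D.e p q * b = D.e p q * b' := by
  refine ⟨_, _, (h.wT q (y.l (Sum.inl p))).wT p (y.l (Sum.inl p))⁻¹, ?_, ?_, ?_, ?_, ?_⟩
  · rw [wT_μ, wT_μ, h1]
  · rw [wT_μ, wT_μ, h2]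
  · rw [wT_l, wT_l, wT_μ, h1]
    simp [hpq]
  · rw [hk_tr, ← mul_smul, wT_inv', one_smul]
  · rw [← mul_assoc, D.tr p q _ hpq, mul_assoc, ← mul_assoc (D.U _), ← map_mul, wT_inv', map_one,
      one_mul]

lemma BRep.norm_swap {y : DX G n} {b : B} (h : BRep D y b) {p q β β' : Fin n} (hpq : p ≠ q)
    (h1 : y.μ (Sum.inl p) = Sum.inr β') (h2 : y.μ (Sum.inl q) = Sum.inr β) :
    ∃ y' b', BRep D y' b' ∧ y'.μ (Sum.inl p) = Sum.inr β ∧ y'.μ (Sum.inl q) = Sum.inr β' ∧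
      y'.l (Sum.inl p) = 1 ∧ _root_.hk p q hpq y = _root_.hk p q hpq y' ∧ D.e p q * b = D.e p q * b' := by
  have h3 : (_root_.wS G (Equiv.swap p q) • y).μ (Sum.inl p) = Sum.inr β := by
    have := wS_μ_inl (Equiv.swap p q) y q
    rw [Equiv.swap_apply_right, h2] at this
    exact this
  have h4 : (_root_.wS G (Equiv.swap p q) • y).μ (Sum.inl q) = Sum.inr β' := by
    have := wS_μ_inl (Equiv.swap p q) y p
    rw [Equiv.swap_apply_left, h1] at this
    exact this
  obtain ⟨y', b', k1, k2, k3, k4, k5, k6⟩ := (h.wS (Equiv.swap p q)).norm hpq h3 h4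
  refine ⟨y', b', k1, k2, k3, k4, ?_, ?_⟩
  · rw [← k5, hk_absorb]
  · rw [← k6, ← mul_assoc, D.absorb p q hpq]

lemma BRep.factor2 (N : ℕ) : ∀ {x : DX G n} {a : B} (_ : BRep D x a) (_ : lk x ≤ N)
    {p q β β' : Fin n} (hpq : p ≠ q)
    (_ : x.μ (Sum.inl p) = Sum.inl q) (_ : x.μ (Sum.inr β) = Sum.inr β') (g : G)
    (_ : x.l (Sum.inl p) = g),
    ∃ y b, BRep D y b ∧ y.μ (Sum.inl p) = Sum.inr β ∧ y.μ (Sum.inl q) = Sum.inr β' ∧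
      y.l (Sum.inl p) = 1 ∧ x = _root_.wT p g • _root_.hk p q hpq y ∧
      a = D.U (_root_.wT p g) * (D.e p q * b) := by
  induction N with
  | zero =>
    intro x a h hN p q β β' hpq hx
    exfalso
    classical
    rw [Nat.le_zero, lk, Finset.card_eq_zero, Finset.filter_eq_empty_iff] at hN
    have := hN (Finset.mem_univ p)
    rw [not_not] at this
    exact this.not hx
  | succ N ih =>
    intro x a h hN p q β β' hpq hx hβ g hg
    obtain ⟨y, b, h1, ⟨c1, h2⟩, ⟨c2, h3⟩, h4, h5⟩ := h.factor p q hpq hx g hg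
    obtain ⟨r1, r2, -, -, r5⟩ := hk_right hpq h2 h3
    by_cases e1 : β = c1
    · subst e1
      rw [h4, wT_μ, r1] at hβ
      have hβ := Sum.inr_injective hβ
      subst hβ
      obtain ⟨y', b', k1, k2, k3, k4, k5, k6⟩ := h1.norm hpq h2 h3
      exact ⟨y', b', k1, k2, k3, k4, by rw [h4, k5], by rw [h5, k6]⟩
    by_cases e2 : β = c2
    · subst e2
      rw [h4, wT_μ, r2] at hβ
      have hβ := Sum.inr_injective hβ
      subst hβ
      obtain ⟨y', b', k1, k2, k3, k4, k5, k6⟩ := h1.norm_swap hpq h2 h3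
      exact ⟨y', b', k1, k2, k3, k4, by rw [h4, k5], by rw [h5, k6]⟩
    have hβ' : y.μ (Sum.inr β) = Sum.inr β' := by
      rw [← hβ, h4, wT_μ, (r5 β e1 e2).1]
    have hlt : lk y < lk x := by
      rw [h4]
      exact lk_lt hpq ⟨_, h2⟩ ⟨_, h3⟩ _ _
    obtain ⟨c, d, hcd⟩ := exists_left_hook hβ'
    have hcd' := hook_ne hcd
    have hdc : y.μ (Sum.inl d) = Sum.inl c := by rw [← hcd, y.inv]
    obtain ⟨z, b1, k1, k2, k3, k4, k5, k6⟩ := ih h1 (by omega) hcd' hcd hβ' _ rfl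
    have hpc : p ≠ c := by rintro rfl; exact Th.not ⟨_, h2⟩ hcd
    have hpd : p ≠ d := by rintro rfl; exact Th.not ⟨_, h2⟩ hdc
    have hqc : q ≠ c := by rintro rfl; exact Th.not ⟨_, h3⟩ hcd
    have hqd : q ≠ d := by rintro rfl; exact Th.not ⟨_, h3⟩ hdc
    generalize y.l (Sum.inl c) = t at *
    have zp : Th z p := by
      have : Th y p := ⟨_, h2⟩
      rw [k5, th_wT, th_hk hcd' ⟨_, k2⟩ ⟨_, k3⟩] at this
      exact this.2.2
    have zq : Th z q := by
      have : Th y q := ⟨_, h3⟩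
      rw [k5, th_wT, th_hk hcd' ⟨_, k2⟩ ⟨_, k3⟩] at this
      exact this.2.2
    set z' := _root_.wS G (Equiv.swap d q) • _root_.wS G (Equiv.swap c p) • z with hz'
    have m1 : z'.μ (Sum.inl p) = Sum.inr β := by
      have := wS_μ_inl (Equiv.swap d q) (_root_.wS G (Equiv.swap c p) • z) (Equiv.swap c p c)
      rw [wS_μ_inl (Equiv.swap c p) z, k2] at this
      simp only [Equiv.swap_apply_left, Equiv.swap_apply_of_ne_of_ne hpd hpq] at this
      exact this
    have m1' : z'.l (Sum.inl p) = 1 := by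
      have := wS_l_inl (Equiv.swap d q) (_root_.wS G (Equiv.swap c p) • z) (Equiv.swap c p c)
      rw [wS_l_inl (Equiv.swap c p) z, k4] at this
      simp only [Equiv.swap_apply_left, Equiv.swap_apply_of_ne_of_ne hpd hpq] at this
      exact this
    have m2 : z'.μ (Sum.inl q) = Sum.inr β' := by
      have := wS_μ_inl (Equiv.swap d q) (_root_.wS G (Equiv.swap c p) • z) (Equiv.swap c p d)
      rw [wS_μ_inl (Equiv.swap c p) z, k3] at this
      simp only [Equiv.swap_apply_left, Equiv.swap_apply_of_ne_of_ne hcd'.symm hpd.symm] at this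
      exact this
    have m3 : Th z' c := by
      have := (zp.wS (Equiv.swap c p)).wS (Equiv.swap d q)
      simpa only [Equiv.swap_apply_right, Equiv.swap_apply_of_ne_of_ne hcd' hqc.symm] using this
    have m4 : Th z' d := by
      have := (zq.wS (Equiv.swap c p)).wS (Equiv.swap d q)
      simpa only [Equiv.swap_apply_right, Equiv.swap_apply_of_ne_of_ne hqc hpq.symm] using this
    have k1' : BRep D z' _ := (k1.wS (Equiv.swap c p)).wS (Equiv.swap d q)
    have f1 := hk_μ_ne hcd' m3 m4 hpc hpd
    have f2 := hk_μ_ne hcd' m3 m4 hqc hqd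
    refine ⟨_, _, (k1'.hk c d hcd' m3 m4).wT c t, ?_, ?_, ?_, ?_, ?_⟩
    · rw [wT_μ, f1.1, m1]
    · rw [wT_μ, f2.1, m2]
    · rw [wT_l, f1.1, f1.2, m1, m1']
      simp [hpc]
    · rw [h4, k5, wT_hk_ne c p q hpq hpc.symm hqc.symm, wT_hk_ne c p q hpq hpc.symm hqc.symm, hz',
        hk_dbl_r p q c d hpq hpc hpd hqc hqd hcd']
    · rw [h5, k6]
      congr 1
      rw [← mul_assoc, ← D.tcomm c p q t hpc.symm hqc.symm hpq, ← mul_assoc (D.e p q),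
        ← D.tcomm c p q t hpc.symm hqc.symm hpq, mul_assoc, mul_assoc]
      congr 1
      rw [← mul_assoc, ← mul_assoc (D.e p q) (D.e c d), ← mul_assoc (D.U _) (D.U _) b1,
        ← mul_assoc (D.e p q * D.e c d), D.dbl_r p q c d hpq hpc hpd hqc hqd hcd']

/-- cutting hooks open -/
def cut (p β : Fin n) (x : DX G n) : DX G n :=
  Dg.hook (Sum.inl p) (Sum.inr β) (by simp) x

lemma cut_hk {y : DX G n} {p q β β' : Fin n} (hpq : p ≠ q) (h1 : y.μ (Sum.inl p) = Sum.inr β)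
    (h2 : y.μ (Sum.inl q) = Sum.inr β') (h3 : y.l (Sum.inl p) = 1) :
    cut p β (hk p q hpq y) = y := by
  have i1 := y.inv
  have i2 := y.ne
  have i3 := y.ll
  ext z
  · simp only [cut, Dg.hook, hk]
    grind (splits := 40)
  · simp only [cut, Dg.hook, hk]
    grind (splits := 40)

lemma hk_cut {x : DX G n} {p q β β' : Fin n} (hpq : p ≠ q) (h1 : x.μ (Sum.inl p) = Sum.inl q)
    (h2 : x.μ (Sum.inr β) = Sum.inr β') (h3 : x.l (Sum.inl p) = 1) :
    hk p q hpq (cut p β x) = x ∧ (cut p β x).μ (Sum.inl p) = Sum.inr β ∧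
      (cut p β x).μ (Sum.inl q) = Sum.inr β' := by
  have i1 := x.inv
  have i2 := x.ne
  have i3 := x.ll
  refine ⟨?_, ?_, ?_⟩
  · ext z
    · simp only [cut, Dg.hook, hk]
      grind (splits := 40)
    · simp only [cut, Dg.hook, hk]
      grind (splits := 40)
  · simp [cut, Dg.hook]
  · simp only [cut, Dg.hook]
    grind

end RepSec3

section RepSec4
set_option linter.unusedSimpArgs false

variable {k G : Type} [CommRing k] [CommGroup G] {ρ : G →* RingAut k} {n : ℕ} {δ : k}
variable {B : Type} [Ring B] [Algebra k B] {D : BrData k G ρ n δ B}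

lemma pure_exists {x : DX G n} (h : ∀ p, Th x p) : ∃ w : GW G n, x = w • dgOne G n := by
  choose f hf using h
  have hinj : Function.Injective f := by
    intro b c hbc
    have := hf b
    rw [hbc, ← hf c] at this
    have := congrArg x.μ this
    rw [x.inv, x.inv] at this
    exact Sum.inl_injective this
  let σ := Equiv.ofBijective f (Finite.injective_iff_bijective.1 hinj)
  have hσ : ∀ p, x.μ (Sum.inl p) = Sum.inr (σ p) := hf
  have hσ' : ∀ b, x.μ (Sum.inr b) = Sum.inl (σ.symm b) := by
    intro b
    obtain ⟨p, rfl⟩ := σ.surjective b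
    rw [← hσ, x.inv, σ.symm_apply_apply]
  refine ⟨⟨fun p => x.l (Sum.inl p), σ.symm⟩, ?_⟩
  rw [smul_def', act]
  ext z
  · cases z with
    | inl p => rw [hσ]; rfl
    | inr b => rw [hσ']; rfl
  · cases z with
    | inl p => simp [Dg.lab, Dg.perm, dgOne]
    | inr b =>
      rw [← x.ll, hσ']
      simp [Dg.lab, Dg.perm, dgOne]
      rfl

lemma dgOne_free {w w' : GW G n} (h : w • dgOne G n = w' • dgOne G n) : w = w' := by
  have hr : w.right = w'.right := by
    apply Equiv.symm_bijective.injective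
    ext p
    have := congrFun (congrArg Dg.μ h) (Sum.inl p)
    exact congrArg Fin.val (Sum.inr_injective this)
  have hl : w.left = w'.left := by
    funext p
    have := congrFun (congrArg Dg.l h) (Sum.inl p)
    simpa [smul_def', act, Dg.lab, Dg.perm, dgOne] using this
  exact SemidirectProduct.ext hl hr

lemma th_dgOne (p : Fin n) : Th (dgOne G n) p := ⟨p, rfl⟩

lemma th_wS (σ : Equiv.Perm (Fin n)) (x : DX G n) (p : Fin n) :
    Th (wS G σ • x) (σ p) ↔ Th x p := by
  refine ⟨fun h => ?_, fun h => h.wS σ⟩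
  have := h.wS σ⁻¹
  rw [← mul_smul, ← wS_mul, inv_mul_cancel, wS_one, one_smul] at this
  simpa using this

lemma BRep.pure {x : DX G n} {a : B} (h : BRep D x a) (hx : ∀ p, Th x p) :
    ∃ w, x = w • dgOne G n ∧ a = D.U w := by
  induction h with
  | one => exact ⟨1, by rw [one_smul], by rw [map_one]⟩
  | @wS σ x a h ih =>
    obtain ⟨w, h1, h2⟩ := ih (fun p => (th_wS σ x p).1 (hx _))
    exact ⟨_root_.wS G σ * w, by rw [mul_smul, h1], by rw [map_mul, h2]⟩
  | @wT l g x a h ih =>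
    obtain ⟨w, h1, h2⟩ := ih (fun p => (th_wT l g x p).1 (hx _))
    exact ⟨_root_.wT l g * w, by rw [mul_smul, h1], by rw [map_mul, h2]⟩
  | @hk p q hpq x a h hp hq ih =>
    exact (Th.not (hx p) (hk_μ_left hpq)).elim

lemma all_th_or (x : DX G n) : (∀ p, Th x p) ∨ ∃ p q, x.μ (Sum.inl p) = Sum.inl q := by
  by_cases h : ∀ p, Th x p
  · exact Or.inl h
  · push Not at h
    obtain ⟨p, hp⟩ := h
    exact Or.inr ⟨p, (th_or x p).resolve_left hp⟩

lemma exists_BRep_aux (D : BrData k G ρ n δ B) (N : ℕ) : ∀ x : DX G n, lk x = N → ∃ a, BRep D x a := by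
  induction N using Nat.strong_induction_on with
  | _ N ih =>
  rintro x rfl
  rcases all_th_or x with h | ⟨p, q, hx⟩
  · obtain ⟨w, rfl⟩ := pure_exists h
    exact ⟨_, BRep.one.smul w⟩
  · obtain ⟨β, β', hβ⟩ := exists_right_hook hx
    have hpq := hook_ne hx
    set g := x.l (Sum.inl p) with hg
    have e1 : (wT p g⁻¹ • x).μ (Sum.inl p) = Sum.inl q := by rw [wT_μ, hx]
    have e2 : (wT p g⁻¹ • x).μ (Sum.inr β) = Sum.inr β' := by rw [wT_μ, hβ]
    have e3 : (wT p g⁻¹ • x).l (Sum.inl p) = 1 := by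
      rw [wT_l, hx]
      simp [hpq.symm, ← hg]
    obtain ⟨h1, h2, h3⟩ := hk_cut hpq e1 e2 e3
    set y := cut p β (wT p g⁻¹ • x)
    have h4 : x = wT p g • hk p q hpq y := by
      rw [h1, ← mul_smul, wT_inv, one_smul]
    have hlt : lk y < lk x := by
      rw [h4]
      exact lk_lt hpq ⟨_, h2⟩ ⟨_, h3⟩ _ _
    obtain ⟨b, hb⟩ := ih _ hlt y rfl
    refine ⟨D.U (wT p g) * (D.e p q * b), ?_⟩
    rw [h4]
    exact (hb.hk p q hpq ⟨_, h2⟩ ⟨_, h3⟩).wT p g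

lemma exists_BRep (D : BrData k G ρ n δ B) (x : DX G n) : ∃ a, BRep D x a :=
  exists_BRep_aux D _ x rfl

lemma BRep.unique_aux (N : ℕ) : ∀ {x : DX G n} {a a' : B}, lk x = N → BRep D x a → BRep D x a' → a = a' := by
  induction N using Nat.strong_induction_on with
  | _ N ih =>
  rintro x a a' rfl ha ha'
  rcases all_th_or x with h | ⟨p, q, hx⟩
  · obtain ⟨w, h1, rfl⟩ := ha.pure h
    obtain ⟨w', h1', rfl⟩ := ha'.pure h
    rw [dgOne_free (h1.symm.trans h1')]
  · obtain ⟨β, β', hβ⟩ := exists_right_hook hx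
    have hpq := hook_ne hx
    obtain ⟨y, b, h1, h2, h3, h4, h5, h6⟩ := ha.factor2 _ le_rfl hpq hx hβ _ rfl
    obtain ⟨y', b', h1', h2', h3', h4', h5', h6'⟩ := ha'.factor2 _ le_rfl hpq hx hβ _ rfl
    have hlt : lk y < lk x := by
      rw [h5]
      exact lk_lt hpq ⟨_, h2⟩ ⟨_, h3⟩ _ _
    have e1 : _root_.hk p q hpq y = _root_.hk p q hpq y' := by
      exact MulAction.injective _ (h5.symm.trans h5')
    have e2 : y = y' := by
      rw [← cut_hk hpq h2 h3 h4, e1, cut_hk hpq h2' h3' h4']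
    subst e2
    rw [h6, h6', ih _ hlt rfl h1 h1']

lemma BRep.unique {x : DX G n} {a a' : B} (h : BRep D x a) (h' : BRep D x a') : a = a' :=
  BRep.unique_aux _ rfl h h'

/-- right hooks are preserved -/
def RH (x x' : DX G n) : Prop := ∀ b c, x.μ (Sum.inr b) = Sum.inr c →
  x'.μ (Sum.inr b) = Sum.inr c ∧ x'.l (Sum.inr b) = x.l (Sum.inr b)

lemma RH.trans {x y z : DX G n} (h : RH x y) (h' : RH y z) : RH x z := fun b c hb =>
  ⟨(h' b c (h b c hb).1).1, by rw [(h' b c (h b c hb).1).2, (h b c hb).2]⟩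

lemma RH.refl (x : DX G n) : RH x x := fun _ _ hb => ⟨hb, rfl⟩

lemma RH.wS (σ : Equiv.Perm (Fin n)) (x : DX G n) : RH x (wS G σ • x) := fun b c hb =>
  ⟨by rw [wS_μ_inr, hb]; rfl, wS_l_inr _ _ _⟩

lemma RH.wT (l : Fin n) (g : G) (x : DX G n) : RH x (wT l g • x) := fun b c hb =>
  ⟨by rw [wT_μ, hb], by rw [wT_l, hb]; simp⟩

lemma RH.smul (w : GW G n) (x : DX G n) : RH x (w • x) := by
  let P : Submonoid (GW G n) :=
    { carrier := {w | ∀ x : DX G n, RH x (w • x)}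
      one_mem' := by
        intro x
        rw [one_smul]
        exact RH.refl x
      mul_mem' := by
        intro w w' hw hw' x
        rw [mul_smul]
        exact (hw' _).trans (hw _) }
  exact GW_ind P RH.wS RH.wT w x

lemma RH.hk (p q : Fin n) (h : p ≠ q) (x : DX G n) : RH x (hk p q h x) := by
  intro b c hb
  have h1 : Sum.inr b ≠ x.μ (Sum.inl p) := by
    intro h
    rw [h, x.inv] at hb
    cases hb
  have h2 : Sum.inr b ≠ x.μ (Sum.inl q) := by
    intro h
    rw [h, x.inv] at hb
    cases hb
  rw [hk_μ, hk_l]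
  simp [h1, h2, hb]

lemma BRep.e_mul_hooked {x : DX G n} {a : B} (h : BRep D x a) {p q r : Fin n} (hpq : p ≠ q)
    (hr : x.μ (Sum.inl p) = Sum.inl r) :
    ∃ x' a' c, BRep D x' a' ∧ RH x x' ∧ D.e p q * a = (c : k) • a' := by
  have hpr := hook_ne hr
  obtain ⟨y, b, h1, h2, h3, h4, h5⟩ := h.factor p r hpr hr _ rfl
  set g := x.l (Sum.inl p)
  by_cases hrq : q = r
  · subst hrq
    refine ⟨_, _, ρ g δ, h.wT p g⁻¹, RH.wT _ _ _, ?_⟩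
    rw [h5, ← mul_assoc (D.U _) (D.U _), ← map_mul, wT_inv', map_one, one_mul, ← mul_assoc,
      ← mul_assoc, D.loop p q g hpr, smul_mul_assoc]
  · refine ⟨_, _, 1, h.smul (_root_.wT r g * _root_.wS G (Equiv.swap q r) * _root_.wT p g⁻¹), RH.smul _ _, ?_⟩
    rw [h5, one_smul, map_mul, mul_assoc, ← mul_assoc (D.U (_root_.wT p _)) (D.U _), ← map_mul, wT_inv',
      map_one, one_mul, map_mul, ← mul_assoc (D.U _) (D.e p r), D.tl p r g hpr,
      mul_assoc (D.U _) (D.e p r), ← mul_assoc (D.e p q), ← D.tcomm r p q g hpr.symm (Ne.symm hrq) hpq,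
      mul_assoc, ← mul_assoc (D.e p q), D.hook_l p q r hpq hpr hrq, mul_assoc, mul_assoc]

lemma BRep.e_mul {x : DX G n} {a : B} (h : BRep D x a) {p q : Fin n} (hpq : p ≠ q) :
    ∃ x' a' c, BRep D x' a' ∧ RH x x' ∧ D.e p q * a = (c : k) • a' := by
  rcases th_or x p with hp | ⟨r, hr⟩
  · rcases th_or x q with hq | ⟨r, hr⟩
    · exact ⟨_, _, 1, h.hk p q hpq hp hq, RH.hk _ _ _ _, by rw [one_smul]⟩
    · rw [D.symm]
      exact h.e_mul_hooked hpq.symm hr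
  · exact h.e_mul_hooked hpq hr

end RepSec4

section BlankSec
set_option linter.unusedSimpArgs false

variable {k G : Type} [CommRing k] [CommGroup G] {ρ : G →* RingAut k} {n : ℕ} {δ : k}
variable {B : Type} [Ring B] [Algebra k B] {D : BrData k G ρ n δ B}

/-- even nodes -/
def nE (i : Fin (n / 2)) : Fin n := ⟨2 * (i : ℕ), by have := i.2; omega⟩
/-- odd nodes -/
def nO (i : Fin (n / 2)) : Fin n := ⟨2 * (i : ℕ) + 1, by have := i.2; omega⟩

lemma nE_ne_nO (i j : Fin (n / 2)) : nE i ≠ nO j := by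
  simp only [nE, nO, ne_eq, Fin.mk.injEq]; omega

lemma nE_ne {i j : Fin (n / 2)} (h : i ≠ j) : nE i ≠ nE j := by
  simp only [nE, ne_eq, Fin.mk.injEq]
  intro h'
  exact h (Fin.ext (by omega))

lemma nO_ne {i j : Fin (n / 2)} (h : i ≠ j) : nO i ≠ nO j := by
  simp only [nO, ne_eq, Fin.mk.injEq]
  intro h'
  exact h (Fin.ext (by omega))

lemma BrData.blk_eq (D : BrData k G ρ n δ B) (h : Even n) :
    D.blk h = ((List.finRange (n / 2)).map (fun i => D.e (nE i) (nO i))).prod := by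
  rw [BrData.blk, List.ofFn_eq_map]
  rfl

lemma hk_keep {p q r s : Fin n} (h : p ≠ q) {x : DX G n} (hr : x.μ (Sum.inl r) = Sum.inl s)
    (h1 : r ≠ p) (h2 : r ≠ q) (h3 : s ≠ p) (h4 : s ≠ q) :
    (hk p q h x).μ (Sum.inl r) = Sum.inl s := by
  have h5 : Sum.inl r ≠ x.μ (Sum.inl p) := by
    intro h
    rw [h, x.inv] at hr
    exact h3 (Sum.inl_injective hr).symm
  have h6 : Sum.inl r ≠ x.μ (Sum.inl q) := by
    intro h
    rw [h, x.inv] at hr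
    exact h4 (Sum.inl_injective hr).symm
  rw [hk_μ]
  simp [h1, h2, h5, h6, hr]

lemma brV_list (ρ : G →* RingAut k) (δ : k) (x : DX G n) : ∀ L : List (Fin (n / 2)), L.Nodup →
    ∃ (c : k) (y : DX G n), (L.map (fun i => (brV ρ δ n).e (nE i) (nO i))).prod (dv k x) = c • dv k y ∧
      ∀ i ∈ L, y.μ (Sum.inl (nE i)) = Sum.inl (nO i)
  | [], _ => ⟨1, x, by simp, by simp⟩
  | i :: L, hL => by
    rw [List.nodup_cons] at hL
    obtain ⟨c, y, h1, h2⟩ := brV_list ρ δ x L hL.2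
    refine ⟨c * cf ρ δ (nE i) (nO i) y, hk (nE i) (nO i) (nE_ne_nO i i) y, ?_, ?_⟩
    · rw [List.map_cons, List.prod_cons, Module.End.mul_apply, h1, map_smul]
      change c • opE ρ δ (nE i) (nO i) (dv k y) = _
      rw [opE_dv _ _ _ _ (nE_ne_nO i i), smul_smul]
    · intro j hj
      rw [List.mem_cons] at hj
      by_cases hij : j = i
      · subst hij
        exact hk_μ_left _
      · exact hk_keep _ (h2 j (hj.resolve_left hij)) (nE_ne hij) (nE_ne_nO _ _) (nE_ne_nO _ _).symm (nO_ne hij)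

lemma blank_of_std {y : DX G n} (hn : Even n)
    (h : ∀ i : Fin (n / 2), y.μ (Sum.inl (nE i)) = Sum.inl (nO i)) : Blank y := by
  intro p
  have hp := p.2
  obtain ⟨m, hm⟩ := hn
  let i : Fin (n / 2) := ⟨p / 2, by omega⟩
  rcases Nat.even_or_odd' (p : ℕ) with ⟨c, hc | hc⟩
  · have : p = nE i := by
      ext
      simp only [nE, i]
      omega
    exact ⟨_, by rw [this, h i]⟩
  · have : p = nO i := by
      ext
      simp only [nO, i]
      omega
    exact ⟨nE i, by rw [this, ← h i, y.inv]⟩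

lemma brV_blk (ρ : G →* RingAut k) (δ : k) (n : ℕ) (h : Even n) : (brV (G := G) ρ δ n).blk h = 0 := by
  apply end_ext
  intro x
  rw [BrData.blk_eq]
  obtain ⟨c, y, h1, h2⟩ := brV_list ρ δ x _ (List.nodup_finRange (n / 2))
  rw [h1, dv_blank (blank_of_std h (fun i => h2 i (List.mem_finRange i))), smul_zero]
  rfl

lemma BRep.list : ∀ (L : List (Fin (n / 2))) (_ : L.Nodup) {x : DX G n} {a : B} (_ : BRep D x a)
    (_ : ∀ i ∈ L, x.μ (Sum.inl (nE i)) = Sum.inl (nO i) ∧ x.l (Sum.inl (nE i)) = 1),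
    ∃ b, a = (L.map (fun i => D.e (nE i) (nO i))).prod * b
  | [], _, x, a, _, _ => ⟨a, by simp⟩
  | i :: L, hL, x, a, h, hx => by
    rw [List.nodup_cons] at hL
    obtain ⟨h1, h2⟩ := hx i List.mem_cons_self
    obtain ⟨y, b, k1, k2, k3, k4, k5⟩ := h.factor _ _ (nE_ne_nO i i) h1 _ h2
    rw [wT_one, map_one, one_mul] at k5
    rw [wT_one, one_smul] at k4
    have hy : ∀ j ∈ L, y.μ (Sum.inl (nE j)) = Sum.inl (nO j) ∧ y.l (Sum.inl (nE j)) = 1 := by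
      intro j hj
      have hij : j ≠ i := by
        rintro rfl
        exact hL.1 hj
      have := hx j (List.mem_cons_of_mem _ hj)
      obtain ⟨e1, e2⟩ := hk_μ_ne (nE_ne_nO i i) k2 k3 (nE_ne hij) (nE_ne_nO _ _)
      rw [k4, e1, e2] at this
      exact this
    obtain ⟨b', hb'⟩ := BRep.list L hL.2 k1 hy
    exact ⟨b', by rw [k5, hb', List.map_cons, List.prod_cons, mul_assoc]⟩

lemma blank_std {x : DX G n} (hx : Blank x) : ∀ j : ℕ, j ≤ n / 2 → ∃ w : GW G n,
    ∀ i : Fin (n / 2), (i : ℕ) < j → (w • x).μ (Sum.inl (nE i)) = Sum.inl (nO i) ∧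
      (w • x).l (Sum.inl (nE i)) = 1
  | 0, _ => ⟨1, by simp⟩
  | j + 1, hj => by
    obtain ⟨w, hw⟩ := blank_std hx j (by omega)
    have hb := hx.smul w
    generalize hwy : w • x = y at *
    let t : Fin (n / 2) := ⟨j, by omega⟩
    obtain ⟨r, hr⟩ := hb (nE t)
    have hrn := hook_ne hr
    have hri : ∀ i : Fin (n / 2), (i : ℕ) < j → r ≠ nE i ∧ r ≠ nO i := by
      intro i hi
      have h1 := (hw i hi).1
      constructor
      · rintro rfl
        rw [← hr, y.inv] at h1
        exact nE_ne_nO _ _ (Sum.inl_injective h1)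
      · rintro rfl
        rw [← h1] at hr
        have := congrArg y.μ hr
        rw [y.inv, y.inv] at this
        have := Sum.inl_injective this
        simp only [nE, t, Fin.mk.injEq] at this
        omega
    set σ := Equiv.swap r (nO t) with hσ
    have hlt : ∀ i : Fin (n / 2), (i : ℕ) < j → i ≠ t := by
      rintro i hi rfl
      simp [t] at hi
    have s1 : σ (nE t) = nE t := Equiv.swap_apply_of_ne_of_ne hrn (nE_ne_nO _ _)
    have s2 : ∀ i : Fin (n / 2), (i : ℕ) < j → σ (nE i) = nE i := fun i hi =>
      Equiv.swap_apply_of_ne_of_ne (hri i hi).1.symm (nE_ne_nO _ _)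
    have s3 : ∀ i : Fin (n / 2), (i : ℕ) < j → σ (nO i) = nO i := fun i hi =>
      Equiv.swap_apply_of_ne_of_ne (hri i hi).2.symm (nO_ne (hlt i hi))
    have m1 : (wS G σ • y).μ (Sum.inl (nE t)) = Sum.inl (nO t) := by
      have := wS_μ_inl σ y (nE t)
      rw [s1, hr, Sum.map_inl, hσ, Equiv.swap_apply_left] at this
      exact this
    have m2 : (wS G σ • y).l (Sum.inl (nE t)) = y.l (Sum.inl (nE t)) := by
      have := wS_l_inl σ y (nE t)
      rwa [s1] at this
    refine ⟨wT (nE t) (y.l (Sum.inl (nE t)))⁻¹ * wS G σ * w, ?_⟩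
    intro i hi
    rw [mul_smul, mul_smul, hwy]
    by_cases hit : i = t
    · subst hit
      rw [wT_μ, wT_l, m1, m2]
      simp [(nE_ne_nO _ _).symm]
    · have hi' : (i : ℕ) < j := by
        have : (i : ℕ) ≠ j := fun h => hit (Fin.ext h)
        omega
      have m3 := wS_μ_inl σ y (nE i)
      rw [s2 i hi', (hw i hi').1, Sum.map_inl, s3 i hi'] at m3
      have m4 := wS_l_inl σ y (nE i)
      rw [s2 i hi', (hw i hi').2] at m4
      rw [wT_μ, wT_l, m3, m4]
      simp [(nE_ne_nO _ _).symm, nE_ne hit]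

lemma blank_even {x : DX G n} (hx : Blank x) : Even n := by
  by_contra ho
  rw [Nat.not_even_iff_odd] at ho
  obtain ⟨m, hm⟩ := ho
  obtain ⟨w, hw⟩ := blank_std hx (n / 2) le_rfl
  have hb := hx.smul w
  generalize w • x = y at *
  obtain ⟨r, hr⟩ := hb ⟨2 * m, by omega⟩
  have hne := hook_ne hr
  have hne' : (r : ℕ) ≠ 2 * m := fun h => hne (Fin.ext h.symm)
  have hlt := r.2
  let i : Fin (n / 2) := ⟨r / 2, by omega⟩
  have h1 := (hw i i.2).1
  rcases Nat.even_or_odd' (r : ℕ) with ⟨c, hc | hc⟩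
  · have : r = nE i := by
      ext
      simp only [nE, i]
      omega
    rw [← this, ← hr, y.inv] at h1
    have := congrArg Fin.val (Sum.inl_injective h1)
    simp only [nO, i] at this
    omega
  · have : r = nO i := by
      ext
      simp only [nO, i]
      omega
    rw [← this, ← hr] at h1
    have h1 := congrArg y.μ h1
    rw [y.inv, y.inv] at h1
    have := congrArg Fin.val (Sum.inl_injective h1)
    simp only [nE, i] at this
    omega

lemma BRep.blank_zero (hn : 0 < n) (hD : ∀ h : Even n, 0 < n → D.blk h = 0) {x : DX G n} {a : B}
    (h : BRep D x a) (hx : Blank x) : a = 0 := by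
  have he := blank_even hx
  obtain ⟨w, hw⟩ := blank_std hx (n / 2) le_rfl
  obtain ⟨b, hb⟩ := BRep.list _ (List.nodup_finRange (n / 2)) (h.smul w) (fun i _ => hw i i.2)
  rw [← D.blk_eq he, hD he hn, zero_mul] at hb
  have : D.U w⁻¹ * (D.U w * a) = 0 := by rw [hb, mul_zero]
  rwa [← mul_assoc, ← map_mul, inv_mul_cancel, map_one, one_mul] at this

end BlankSec

section BasisSec
set_option linter.unusedSimpArgs false

variable {k G : Type} [CommRing k] [CommGroup G] {ρ : G →* RingAut k} {n : ℕ} {δ : k}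
variable {B : Type} [Ring B] [Algebra k B] {D : BrData k G ρ n δ B}

/-- the Brauer data of the quotient algebra -/
def qD (k G : Type) [CommRing k] [CommGroup G] (ρ : G →* RingAut k) (n : ℕ) (δ : k) :
    BrData k G ρ n δ (GBQAlg k G ρ n δ) := (exists_brData k G ρ n δ).choose

lemma qD_gen (x : GBGen n G) : (qD k G ρ n δ).gen x = qgen k G ρ n δ x :=
  (exists_brData k G ρ n δ).choose_spec x

lemma qD_blk (h : Even n) (hn : 0 < n) : (qD k G ρ n δ).blk h = 0 := by
  have := RingQuot.mkAlgHom_rel k (GBQRel.blank (k := k) (G := G) (ρ := ρ) (δ := δ) hn h)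
  rw [map_zero, map_list_prod, List.map_ofFn] at this
  rw [← this, BrData.blk]
  congr 2
  funext i
  exact qD_gen (k := k) (G := G) (ρ := ρ) (n := n) (δ := δ)
    (GBGen.e ⟨2 * (i : ℕ), by have h2 := i.2; obtain ⟨m, hm⟩ := h; omega⟩)

section
variable (D) (hD : ∀ h : Even n, 0 < n → D.blk h = 0)

lemma hom_U (w : GW G n) : D.hom hD ((qD k G ρ n δ).U w) = D.U w := by
  have hS : ∀ σ, D.hom hD ((qD k G ρ n δ).U (wS G σ)) = D.U (wS G σ) := by
    let P : Submonoid (Equiv.Perm (Fin n)) :=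
      { carrier := {σ | D.hom hD ((qD k G ρ n δ).U (wS G σ)) = D.U (wS G σ)}
        one_mem' := by simp
        mul_mem' := by
          intro σ τ h1 h2
          simp only [Set.mem_ofPred_eq] at *
          rw [wS_mul, map_mul, map_mul, map_mul, h1, h2] }
    refine perm_ind P ?_
    intro i
    have h1 := D.hom_gen hD (GBGen.s i)
    rw [← qD_gen] at h1
    exact h1
  have hT : ∀ l g, D.hom hD ((qD k G ρ n δ).U (wT l g)) = D.U (wT l g) := by
    intro l g
    have h1 := D.hom_gen hD (GBGen.t g l)
    rw [← qD_gen] at h1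
    exact h1
  let P : Submonoid (GW G n) :=
      { carrier := {w | D.hom hD ((qD k G ρ n δ).U w) = D.U w}
        one_mem' := by simp
        mul_mem' := by
          intro σ τ h1 h2
          simp only [Set.mem_ofPred_eq] at *
          rw [map_mul, map_mul, map_mul, h1, h2] }
  exact GW_ind P hS hT w

lemma BrData.e_conj (D : BrData k G ρ n δ B) (σ : Equiv.Perm (Fin n)) (p q : Fin n) :
    D.e (σ p) (σ q) = D.U (wS G σ) * D.e p q * D.U (wS G σ⁻¹) := by
  rw [D.conj, mul_assoc, ← map_mul, ← wS_mul, mul_inv_cancel, wS_one, map_one, mul_one]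

lemma hom_e (p q : Fin n) (h : p ≠ q) : D.hom hD ((qD k G ρ n δ).e p q) = D.e p q := by
  have hn : 2 ≤ n := by
    have hp := p.2
    have hq := q.2
    by_contra hc
    exact h (Fin.ext (by omega))
  let i : Fin (n - 1) := ⟨0, by omega⟩
  obtain ⟨σ, rfl, rfl⟩ := exists_perm2 (genPos_ne i) h
  have h1 := D.hom_gen hD (GBGen.e i)
  rw [← qD_gen] at h1
  have h2 : D.hom hD ((qD k G ρ n δ).e (genPos i) (genPos' i)) = D.e (genPos i) (genPos' i) := h1
  rw [BrData.e_conj, BrData.e_conj, map_mul, map_mul, hom_U, hom_U, h2]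

lemma BRep.map {x : DX G n} {a : GBQAlg k G ρ n δ} (h : BRep (qD k G ρ n δ) x a) :
    BRep D x (D.hom hD a) := by
  induction h with
  | one => rw [map_one]; exact .one
  | @wS σ x a h ih => rw [map_mul, hom_U]; exact ih.wS σ
  | @wT l g x a h ih => rw [map_mul, hom_U]; exact ih.wT l g
  | @hk p q hpq x a h hp hq ih => rw [map_mul, hom_e _ _ _ _ hpq]; exact ih.hk p q hpq hp hq

end

lemma brV_rep {x : DX G n} {a : Module.End k (VV k G n)} (h : BRep (brV ρ δ n) x a) :
    a (dv k (dgOne G n)) = dv k x := by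
  induction h with
  | one => rfl
  | @wS σ x a h ih =>
    rw [Module.End.mul_apply, ih]
    exact opU_dv _ _
  | @wT l g x a h ih =>
    rw [Module.End.mul_apply, ih]
    exact opU_dv _ _
  | @hk p q hpq x a h hp hq ih =>
    rw [Module.End.mul_apply, ih]
    refine (opE_dv ρ δ p q hpq x).trans ?_
    have : cf ρ δ p q x = 1 := by
      obtain ⟨b, hb⟩ := hp
      rw [cf, Dg.coef, if_neg]
      rw [hb]
      simp
    rw [this, one_smul]

lemma gen_ind (P : Subalgebra k (GBQAlg k G ρ n δ)) (hU : ∀ w, (qD k G ρ n δ).U w ∈ P)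
    (he : ∀ p q, p ≠ q → (qD k G ρ n δ).e p q ∈ P) (a : GBQAlg k G ρ n δ) : a ∈ P := by
  obtain ⟨f, rfl⟩ := RingQuot.mkAlgHom_surjective k (GBQRel k G ρ n δ) a
  induction f using FreeAlgebra.induction with
  | grade0 r =>
    rw [AlgHom.commutes]
    exact P.algebraMap_mem r
  | grade1 x =>
    change qgen k G ρ n δ x ∈ P
    rw [← qD_gen]
    cases x with
    | s i => exact hU _
    | e i => exact he _ _ (genPos_ne i)
    | t g j => exact hU _
  | mul a b ha hb => rw [map_mul]; exact P.mul_mem ha hb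
  | add a b ha hb => rw [map_add]; exact P.add_mem ha hb

variable (k ρ δ) in
/-- the basis vectors -/
def bx (x : DX G n) : GBQAlg k G ρ n δ := (exists_BRep (qD k G ρ n δ) x).choose

lemma bx_rep (x : DX G n) : BRep (qD k G ρ n δ) x (bx k ρ δ x) :=
  (exists_BRep (qD k G ρ n δ) x).choose_spec

lemma bx_eq {x : DX G n} {a : GBQAlg k G ρ n δ} (h : BRep (qD k G ρ n δ) x a) : a = bx k ρ δ x :=
  h.unique (bx_rep x)

lemma bx_blank (hn : 0 < n) {x : DX G n} (h : Blank x) : bx k ρ δ x = 0 :=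
  (bx_rep x).blank_zero hn qD_blk h

variable (k ρ δ) in
/-- filtration of the algebra -/
def fS (x : DX G n) : Submodule k (GBQAlg k G ρ n δ) :=
  Submodule.span k ((fun y : {y : DX G n // ¬ Blank y} => bx k ρ δ y.1) '' {y | RH x y.1})

lemma bx_mem_fS (hn : 0 < n) {x y : DX G n} (h : RH x y) : bx k ρ δ y ∈ fS k ρ δ x := by
  by_cases hy : Blank y
  · rw [bx_blank hn hy]
    exact Submodule.zero_mem _
  · exact Submodule.subset_span ⟨⟨y, hy⟩, h, rfl⟩

lemma mul_mem_fS (hn : 0 < n) (x : DX G n) (a z : GBQAlg k G ρ n δ) (hz : z ∈ fS k ρ δ x) :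
    a * z ∈ fS k ρ δ x := by
  let P : Subalgebra k (GBQAlg k G ρ n δ) :=
    { carrier := {a | ∀ z ∈ fS k ρ δ x, a * z ∈ fS k ρ δ x}
      mul_mem' := by
        intro a b ha hb z hz
        rw [mul_assoc]
        exact ha _ (hb _ hz)
      add_mem' := by
        intro a b ha hb z hz
        rw [add_mul]
        exact Submodule.add_mem _ (ha _ hz) (hb _ hz)
      algebraMap_mem' := by
        intro r z hz
        rw [← Algebra.smul_def]
        exact Submodule.smul_mem _ _ hz }
  have key : ∀ b : GBQAlg k G ρ n δ, (∀ y, RH x y → b * bx k ρ δ y ∈ fS k ρ δ x) → b ∈ P := by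
    intro b hb z hz
    induction hz using Submodule.span_induction with
    | mem z hz =>
      obtain ⟨y, hy, rfl⟩ := hz
      exact hb _ hy
    | zero => rw [mul_zero]; exact Submodule.zero_mem _
    | add z z' _ _ h h' => rw [mul_add]; exact Submodule.add_mem _ h h'
    | smul c z _ h => rw [mul_smul_comm]; exact Submodule.smul_mem _ _ h
  refine gen_ind P ?_ ?_ a z hz
  · intro w
    refine key _ fun y hy => ?_
    rw [bx_eq ((bx_rep y).smul w)]
    exact bx_mem_fS hn (hy.trans (RH.smul w y))
  · intro p q hpq
    refine key _ fun y hy => ?_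
    obtain ⟨x', a', c, h1, h2, h3⟩ := (bx_rep (k := k) (ρ := ρ) (δ := δ) y).e_mul hpq
    rw [h3, bx_eq h1]
    exact Submodule.smul_mem _ _ (bx_mem_fS hn (hy.trans h2))

lemma bx_one : bx k ρ δ (dgOne G n) = 1 := (bx_eq .one).symm

lemma bx_pure (w : GW G n) : bx k ρ δ (w • dgOne G n) = (qD k G ρ n δ).U w := by
  rw [← bx_eq (BRep.one.smul w), mul_one]

lemma not_blank_pure (hn : 0 < n) {x : DX G n} (h : ∀ p, Th x p) : ¬ Blank x := fun hb =>
  (h ⟨0, hn⟩).not (hb _).choose_spec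

/-- the diagram basis -/
def dB (k : Type) {G : Type} [CommRing k] [CommGroup G] (ρ : G →* RingAut k) {n : ℕ} (hn : 0 < n) (δ : k) :
    Module.Basis {x : DX G n // ¬ Blank x} k (GBQAlg k G ρ n δ) :=
  Module.Basis.mk (v := fun x => bx k ρ δ x.1) (by
    let φ := (brV (k := k) (G := G) ρ δ n).hom (fun h _ => brV_blk ρ δ n h)
    let ev : GBQAlg k G ρ n δ →ₗ[k] VV k G n :=
      (LinearMap.applyₗ (dv k (dgOne G n))).comp φ.toLinearMap
    apply LinearIndependent.of_comp ev
    have : (ev ∘ fun x : {x : DX G n // ¬ Blank x} => bx k ρ δ x.1)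
        = fun x => Finsupp.single x 1 := by
      funext x
      change φ (bx k ρ δ x.1) (dv k (dgOne G n)) = _
      rw [brV_rep ((bx_rep x.1).map (brV (k := k) (G := G) ρ δ n) (fun h _ => brV_blk ρ δ n h)), dv_of x.2]
    rw [this]
    exact Finsupp.linearIndependent_single_one k _) (by
    intro a _
    have h1 : (1 : GBQAlg k G ρ n δ) ∈ fS k ρ δ (dgOne G n) := by
      rw [← bx_one]
      exact bx_mem_fS hn (RH.refl _)
    have := mul_mem_fS hn _ a _ h1
    rw [mul_one] at this
    exact Submodule.span_mono (Set.image_subset_range _ _) this)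

lemma dB_apply (hn : 0 < n) (x : {x : DX G n // ¬ Blank x}) : dB k ρ hn δ x = bx k ρ δ x.1 := by
  rw [dB, Module.Basis.mk_apply]

lemma dB_up (hn : 0 < n) (a : GBQAlg k G ρ n δ) (x x' : {x : DX G n // ¬ Blank x})
    (h : (dB k ρ hn δ).repr (a * dB k ρ hn δ x) x' ≠ 0) : RH x.1 x'.1 := by
  have h1 : a * dB k ρ hn δ x ∈ Submodule.span k (dB k ρ hn δ '' {y | RH x.1 y.1}) := by
    have := mul_mem_fS hn x.1 a _ (bx_mem_fS (k := k) (ρ := ρ) (δ := δ) hn (RH.refl x.1))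
    rw [dB_apply]
    have e : (dB k ρ hn δ : _ → GBQAlg k G ρ n δ) = fun x => bx k ρ δ x.1 := by
      funext x
      exact dB_apply hn x
    rw [e]
    exact this
  rw [Module.Basis.mem_span_image] at h1
  exact h1 (Finsupp.mem_support_iff.2 h)

end BasisSec

section FiltSec
set_option linter.unusedSimpArgs false

variable {k G : Type} [CommRing k] [CommGroup G] {ρ : G →* RingAut k} {n : ℕ} {δ : k}
variable {B : Type} [Ring B] [Algebra k B] {D : BrData k G ρ n δ B}

lemma BrData.el_one (D : BrData k G ρ n δ B) (p q : Fin n) : D.el p q 1 = D.e p q := by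
  simp [el]

lemma BRep.move_e {x : DX G n} {a : B} (h : BRep D x a) {p q b c : Fin n} (hpq : p ≠ q)
    (h1 : x.μ (Sum.inl p) = Sum.inr b) (h2 : x.μ (Sum.inl q) = Sum.inr c)
    (h3 : x.l (Sum.inl p) = 1) : D.e p q * a = a * D.el b c (x.l (Sum.inl q)) := by
  have := h.move p q hpq b c h1 h2 1
  rwa [D.el_one, h3, one_mul, one_mul] at this

/-- Removing a pair of hooks. -/
lemma BRep.peel {x : DX G n} {a : B} (h : BRep D x a) {p q β β' : Fin n}
    (hx : x.μ (Sum.inl p) = Sum.inl q) (hβ : x.μ (Sum.inr β) = Sum.inr β') :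
    ∃ (x0 : DX G n) (a0 : B) (w : GW G n) (hpq : p ≠ q), BRep D x0 a0 ∧ x0.μ (Sum.inl p) = Sum.inr β ∧
      x0.μ (Sum.inl q) = Sum.inr β' ∧ x0.l (Sum.inl p) = 1 ∧ lk x0 < lk x ∧
      a = D.U w * (D.e p q * a0) ∧ a = D.U w * (a0 * D.el β β' (x.l (Sum.inr β))) ∧
      (∀ b c, x0.μ (Sum.inr b) = Sum.inr c ↔ b ≠ β ∧ b ≠ β' ∧ x.μ (Sum.inr b) = Sum.inr c) ∧
      (∀ b c, x0.μ (Sum.inr b) = Sum.inr c → x0.l (Sum.inr b) = x.l (Sum.inr b)) ∧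
      (∀ r, Th x r → Th x0 r ∧ r ≠ p ∧ r ≠ q) := by
  have hpq := hook_ne hx
  obtain ⟨y, b, h1, h2, h3, h4, h5, h6⟩ := h.factor2 _ le_rfl hpq hx hβ _ rfl
  generalize x.l (Sum.inl p) = g at *
  obtain ⟨r1, r2, r3, r4, r5⟩ := hk_right hpq h2 h3
  have hl : x.l (Sum.inr β) = y.l (Sum.inl q) := by
    rw [h5, wT_l_inr _ _ _ r1, r3, h4, one_mul]
  have key : ∀ b c, y.μ (Sum.inr b) = Sum.inr c → b ≠ β ∧ b ≠ β' := by
    intro b c hb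
    constructor
    · rintro rfl
      rw [← h2, y.inv] at hb
      cases hb
    · rintro rfl
      rw [← h3, y.inv] at hb
      cases hb
  refine ⟨y, b, _root_.wT p g, hpq, h1, h2, h3, h4, ?_, h6, ?_, ?_, ?_, ?_⟩
  · rw [h5]
    exact lk_lt hpq ⟨_, h2⟩ ⟨_, h3⟩ _ _
  · rw [h6, h1.move_e hpq h2 h3 h4, hl]
  · intro b c
    constructor
    · intro hb
      obtain ⟨k1, k2⟩ := key b c hb
      refine ⟨k1, k2, ?_⟩
      rw [h5, wT_μ, (r5 b k1 k2).1, hb]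
    · rintro ⟨k1, k2, hb⟩
      rwa [h5, wT_μ, (r5 b k1 k2).1] at hb
  · intro b c hb
    obtain ⟨k1, k2⟩ := key b c hb
    rw [h5, wT_l_inr _ _ _ ((r5 b k1 k2).1.trans hb), (r5 b k1 k2).2]
  · intro r hr
    rw [h5, th_wT, th_hk hpq ⟨_, h2⟩ ⟨_, h3⟩] at hr
    exact ⟨hr.2.2, hr.1, hr.2.1⟩

lemma U_inv_mul (w : GW G n) (a : B) : D.U w⁻¹ * (D.U w * a) = a := by
  rw [← mul_assoc, ← map_mul, inv_mul_cancel, map_one, one_mul]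

lemma BRep.gen_aux (N : ℕ) : ∀ {x y : DX G n} {a b : B}, lk y = N → BRep D x a → BRep D y b → RH y x →
    ∃ c, a = c * b := by
  induction N using Nat.strong_induction_on with
  | _ N ih =>
  rintro x y a b rfl ha hb hR
  rcases all_th_or y with h | ⟨p, q, hy⟩
  · obtain ⟨w, h1, rfl⟩ := hb.pure h
    refine ⟨a * D.U w⁻¹, ?_⟩
    rw [mul_assoc, ← map_mul, inv_mul_cancel, map_one, mul_one]
  · obtain ⟨β, β', hβ⟩ := exists_right_hook hy
    obtain ⟨hβx, hlx⟩ := hR β β' hβ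
    obtain ⟨p', q', hx⟩ := exists_left_hook hβx
    obtain ⟨y0, b0, w, -, y1, y2, y3, y4, y5, y6, y7, y8, y9, -⟩ := hb.peel hy hβ
    obtain ⟨x0, a0, w', -, x1, x2, x3, x4, x5, x6, x7, x8, x9, -⟩ := ha.peel hx hβx
    have hR0 : RH y0 x0 := by
      intro c d hc
      obtain ⟨z1, z2, z3⟩ := (y8 c d).1 hc
      have hc' := (x8 c d).2 ⟨z1, z2, (hR c d z3).1⟩
      refine ⟨hc', ?_⟩
      rw [x9 c d hc', y9 c d hc, (hR c d z3).2]
    obtain ⟨c0, rfl⟩ := ih _ y5 rfl x1 y1 hR0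
    refine ⟨D.U w' * c0 * D.U w⁻¹, ?_⟩
    rw [x7, y7, hlx, mul_assoc _ (D.U w⁻¹), U_inv_mul]
    simp only [mul_assoc]

lemma BRep.gen {x y : DX G n} {a b : B} (ha : BRep D x a) (hb : BRep D y b) (h : RH y x) :
    ∃ c, a = c * b := BRep.gen_aux _ rfl ha hb h

lemma BRep.idem_aux (N : ℕ) : ∀ {y : DX G n} {b : B}, lk y = N → BRep D y b → ¬ Blank y →
    ∃ c, b * c * b = b := by
  induction N using Nat.strong_induction_on with
  | _ N ih =>
  rintro y b rfl hb hy0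
  rcases all_th_or y with h | ⟨p, q, hy⟩
  · obtain ⟨w, h1, rfl⟩ := hb.pure h
    refine ⟨D.U w⁻¹, ?_⟩
    rw [← map_mul, mul_inv_cancel, map_one, one_mul]
  · obtain ⟨β, β', hβ⟩ := exists_right_hook hy
    obtain ⟨y0, b0, w, hpq, y1, y2, y3, y4, y5, y6, y7, -, -, y10⟩ := hb.peel hy hβ
    have hth : ∃ r, Th y r := by
      by_contra hc
      push Not at hc
      exact hy0 fun p => (th_or y p).resolve_left (hc p)
    obtain ⟨r, hr⟩ := hth
    obtain ⟨⟨z, hz⟩, r2, r3⟩ := y10 r hr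
    have hnb : ¬ Blank y0 := fun hB => Th.not ⟨_, y2⟩ (hB p).choose_spec
    obtain ⟨c0, hc0⟩ := ih _ y5 rfl y1 hnb
    have m := y1.move_e r2.symm y2 hz y4
    set E := D.el β β' (y.l (Sum.inr β))
    set E' := D.el β z (y0.l (Sum.inl r))
    have hEE : D.e p q * b0 = b0 * E := by
      have := congrArg (fun t => D.U w⁻¹ * t) (y6.symm.trans y7)
      simpa only [U_inv_mul] using this
    refine ⟨E' * c0 * D.U w⁻¹, ?_⟩
    have e1 : b * E' = D.U w * (D.e p q * (D.e p r * b0)) := by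
      rw [y6, m]
      simp only [mul_assoc]
    have e2 : D.U w⁻¹ * b = b0 * E := by rw [y7, U_inv_mul]
    calc b * (E' * c0 * D.U w⁻¹) * b = (b * E') * c0 * (D.U w⁻¹ * b) := by simp only [mul_assoc]
      _ = D.U w * (D.e p q * (D.e p r * (b0 * c0 * b0 * E))) := by
        rw [e1, e2]
        simp only [mul_assoc]
      _ = D.U w * ((D.e p q * D.e p r * D.e p q) * b0) := by
        rw [hc0, ← hEE]
        simp only [mul_assoc]
      _ = b := by rw [D.eee p q r hpq r2.symm r3.symm, y6]

lemma BRep.idem {y : DX G n} {b : B} (hb : BRep D y b) (hy : ¬ Blank y) : ∃ c, b * c * b = b :=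
  BRep.idem_aux _ rfl hb hy

open Classical in
/-- the set of right hooks -/
def rT (x : DX G n) : Finset (Fin n × (Fin n ⊕ Fin n) × G) :=
  (Finset.univ.filter (fun b => ∃ c, x.μ (Sum.inr b) = Sum.inr c)).image
    (fun b => (b, x.μ (Sum.inr b), x.l (Sum.inr b)))

lemma mem_rT (x : DX G n) (b : Fin n) (z : Fin n ⊕ Fin n) (g : G) : (b, z, g) ∈ rT x ↔
    (∃ c, x.μ (Sum.inr b) = Sum.inr c) ∧ x.μ (Sum.inr b) = z ∧ x.l (Sum.inr b) = g := by
  classical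
  simp only [rT, Finset.mem_image, Finset.mem_filter, Finset.mem_univ, true_and, Prod.mk.injEq]
  constructor
  · rintro ⟨c, h, rfl, rfl, rfl⟩
    exact ⟨h, rfl, rfl⟩
  · rintro ⟨h, rfl, rfl⟩
    exact ⟨b, h, rfl, rfl, rfl⟩

lemma rT_card (x : DX G n) : (rT x).card ≤ n := by
  classical
  refine Finset.card_image_le.trans ((Finset.card_filter_le _ _).trans ?_)
  simp

lemma rT_sub (x y : DX G n) : rT x ⊆ rT y ↔ RH x y := by
  constructor
  · intro h b c hb
    have := h ((mem_rT x b (Sum.inr c) _).2 ⟨⟨c, hb⟩, hb, rfl⟩)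
    exact ((mem_rT _ _ _ _).1 this).2
  · rintro h ⟨b, z, g⟩ hb
    obtain ⟨⟨c, hc⟩, rfl, rfl⟩ := (mem_rT _ _ _ _).1 hb
    obtain ⟨h1, h2⟩ := h b c hc
    exact (mem_rT _ _ _ _).2 ⟨⟨c, h1⟩, by rw [h1, hc], h2⟩

lemma rT_empty (x : DX G n) : rT x = ∅ ↔ ∀ p, Th x p := by
  rw [← not_iff_not, ← ne_eq, ← Finset.nonempty_iff_ne_empty]
  constructor
  · rintro ⟨⟨b, z, g⟩, hb⟩ h
    obtain ⟨⟨c, hc⟩, -, -⟩ := (mem_rT _ _ _ _).1 hb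
    obtain ⟨p, q, hx⟩ := exists_left_hook hc
    exact (h p).not hx
  · intro h
    obtain ⟨p, q, hx⟩ := (all_th_or x).resolve_left h
    obtain ⟨b, c, hc⟩ := exists_right_hook hx
    exact ⟨_, (mem_rT x b _ _).2 ⟨⟨c, hc⟩, rfl, rfl⟩⟩

end FiltSec

section FinalSec
set_option linter.unusedSimpArgs false

variable {k G : Type} [CommRing k] [CommGroup G] {ρ : G →* RingAut k} {n : ℕ} {δ : k}

variable (k G ρ n δ) in
/-- the Brauer data on the group algebra with zero hooks -/
def brW : BrData k G ρ n δ (MonoidAlgebra k (GW G n)) where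
  U := MonoidAlgebra.of k (GW G n)
  e := fun _ _ => 0
  conj := by intros; simp
  symm := by intros; rfl
  absorb := by intros; simp
  comm := by intros; simp
  hook := by intros; simp
  tcomm := by intros; simp
  tl := by intros; simp
  tr := by intros; simp
  loop := by intros; simp

lemma brW_blk (h : Even n) (hn : 0 < n) : (brW k G ρ n δ).blk h = 0 := by
  rw [BrData.blk]
  apply List.prod_eq_zero
  rw [List.mem_ofFn]
  exact ⟨⟨0, by obtain ⟨m, hm⟩ := h; omega⟩, rfl⟩

variable (k G ρ n δ) in
/-- the projection to the group algebra -/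
def piW : GBQAlg k G ρ n δ →ₐ[k] MonoidAlgebra k (GW G n) :=
  (brW k G ρ n δ).hom brW_blk

lemma piW_U (w : GW G n) : piW k G ρ n δ ((qD k G ρ n δ).U w) = MonoidAlgebra.of k (GW G n) w :=
  hom_U (brW k G ρ n δ) brW_blk w

lemma brW_rep {x : DX G n} {a : MonoidAlgebra k (GW G n)} (h : BRep (brW k G ρ n δ) x a) :
    (∀ p, Th x p) ∨ a = 0 := by
  induction h with
  | one => exact Or.inl th_dgOne
  | @wS σ x a h ih =>
    rcases ih with ih | ih
    · exact Or.inl fun p => by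
        have := (ih (σ⁻¹ p)).wS σ
        simpa using this
    · exact Or.inr (by rw [ih, mul_zero])
  | @wT l g x a h ih =>
    rcases ih with ih | ih
    · exact Or.inl fun p => (th_wT _ _ _ _).2 (ih _)
    · exact Or.inr (by rw [ih, mul_zero])
  | @hk p q hpq x a h hp hq ih => exact Or.inr (zero_mul _)

lemma piW_bx {x : DX G n} (h : ¬ ∀ p, Th x p) : piW k G ρ n δ (bx k ρ δ x) = 0 :=
  (brW_rep ((bx_rep x).map (brW k G ρ n δ) brW_blk)).resolve_left h

lemma piW_surj : Function.Surjective (piW k G ρ n δ) := by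
  intro f
  induction f using MonoidAlgebra.induction_on with
  | of w => exact ⟨_, piW_U w⟩
  | add f g hf hg =>
    obtain ⟨a, rfl⟩ := hf
    obtain ⟨b, rfl⟩ := hg
    exact ⟨a + b, map_add _ _ _⟩
  | smul r f hf =>
    obtain ⟨a, rfl⟩ := hf
    exact ⟨r • a, map_smul _ _ _⟩

lemma piW_aug (a : GBQAlg k G ρ n δ) :
    groupAug k (GW G n) (piW k G ρ n δ a) = GBQaug k G ρ n δ a := by
  have : (groupAug k (GW G n)).comp (piW k G ρ n δ) = GBQaug k G ρ n δ := by
    apply RingQuot.ringQuot_ext'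
    apply FreeAlgebra.hom_ext
    funext x
    change groupAug k (GW G n) (piW k G ρ n δ (qgen k G ρ n δ x)) =
      GBQaug k G ρ n δ (RingQuot.mkAlgHom k (GBQRel k G ρ n δ) (FreeAlgebra.ι k x))
    rw [piW, BrData.hom_gen, GBQaug, RingQuot.liftAlgHom_mkAlgHom_apply, FreeAlgebra.lift_ι_apply]
    cases x <;> simp [BrData.gen, brW, groupAug]
  exact DFunLike.congr_fun this a

/-- the filtered basis -/
def filtB (hn : 0 < n) : FiltBasis (GBQaug k G ρ n δ) {x : DX G n // ¬ Blank x}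
    (Fin n × (Fin n ⊕ Fin n) × G) where
  b := dB k ρ hn δ
  T := fun x => rT x.1
  bound := n
  card_le := fun x => rT_card x.1
  up := fun a x x' h => (rT_sub _ _).2 (dB_up hn a x x' h)
  gen := fun x y h => by
    rw [dB_apply, dB_apply]
    exact (bx_rep x.1).gen (bx_rep y.1) ((rT_sub _ _).1 h)
  idem := fun y _ => by
    rw [dB_apply]
    exact (bx_rep y.1).idem y.2
  aug := fun y h => by
    rw [dB_apply, ← piW_aug, piW_bx (fun h' => h ((rT_empty _).2 h')), map_zero]

lemma pure_th (w : GW G n) : ∀ p, Th (w • dgOne G n) p := by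
  have h := (bx_rep (k := ℤ) (ρ := 1) (δ := 0) (w • dgOne G n)).map (brW ℤ G 1 n 0) brW_blk
  rcases brW_rep h with h | h
  · exact h
  · exfalso
    have h2 : piW ℤ G 1 n 0 (bx ℤ 1 0 (w • dgOne G n)) = 0 := h
    rw [bx_pure, piW_U] at h2
    have h3 := congrArg (fun f => f.coeff w) h2
    simp [MonoidAlgebra.of_apply] at h3

lemma piW_coef (hn : 0 < n) (w : GW G n) (hw : ¬ Blank (w • dgOne G n)) (a : GBQAlg k G ρ n δ) :
    (dB k ρ hn δ).repr a ⟨w • dgOne G n, hw⟩ = (piW k G ρ n δ a).coeff w := by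
  classical
  have key : (dB k ρ hn δ).coord ⟨w • dgOne G n, hw⟩ =
      (Finsupp.lapply w).comp ((MonoidAlgebra.coeffLinearEquiv k).toLinearMap.comp
        (piW k G ρ n δ).toLinearMap) := by
    apply (dB k ρ hn δ).ext
    intro x
    rw [Module.Basis.coord_apply, Module.Basis.repr_self, dB_apply]
    change _ = (piW k G ρ n δ (bx k ρ δ x.1)).coeff w
    by_cases hx : ∀ p, Th x.1 p
    · obtain ⟨v, hv⟩ := pure_exists hx
      rw [hv, bx_pure, piW_U, MonoidAlgebra.of_apply, MonoidAlgebra.coeff_single,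
        Finsupp.single_apply, Finsupp.single_apply]
      congr 1
      rw [Subtype.ext_iff, hv, eq_iff_iff]
      exact ⟨dgOne_free, fun h => by rw [h]⟩
    · rw [piW_bx hx, Finsupp.single_apply, if_neg]
      · simp
      · rintro rfl
        apply hx
        exact pure_th w
  exact LinearMap.congr_fun key a

lemma piW_ker (hn : 0 < n) (a : GBQAlg k G ρ n δ) :
    piW k G ρ n δ a = 0 ↔ ∀ x, (dB k ρ hn δ).repr a x ≠ 0 → rT x.1 ≠ ∅ := by
  constructor
  · rintro h ⟨x, hx⟩ h1 h2
    obtain ⟨w, rfl⟩ := pure_exists ((rT_empty _).1 h2)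
    rw [piW_coef, h] at h1
    simp at h1
  · intro h
    apply MonoidAlgebra.coeff_injective
    ext w
    have hw := not_blank_pure hn (pure_th (n := n) w)
    rw [← piW_coef hn w hw]
    by_contra h0
    exact h _ h0 ((rT_empty _).2 (pure_th w))

lemma GBQ_free (hn : 0 < n) : Module.Free k (GBQAlg k G ρ n δ) := Module.Free.of_basis (dB k ρ hn δ)

theorem GBQ_main (hn : 0 < n) (q : ℕ) :
    Nonempty (barTor k (GBQAlg k G ρ n δ) (GBQaug k G ρ n δ) q ≃ₗ[k] groupTor k (GW G n) q) := by
  have := GBQ_free (k := k) (G := G) (ρ := ρ) (δ := δ) hn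
  have : Module.Free k (MonoidAlgebra k (GW G n)) :=
    Module.Free.of_equiv (MonoidAlgebra.coeffLinearEquiv (S := k) (M := GW G n) k).symm
  refine barTor_compare (piW k G ρ n δ) _ _ piW_aug piW_surj ?_ q
  intro Y P hP
  refine (filtB hn).good Y P ?_
  intro f
  rw [hP]
  exact forall_congr' fun y => piW_ker hn (f y)

lemma GB_odd_exists (ho : Odd n) : ∃ f : GBAlg k G ρ n δ ≃ₐ[k] GBQAlg k G ρ n δ,
    ∀ a, GBQaug k G ρ n δ (f a) = GBaug k G ρ n δ a := by
  let f : GBAlg k G ρ n δ →ₐ[k] GBQAlg k G ρ n δ :=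
    RingQuot.liftAlgHom k ⟨RingQuot.mkAlgHom k (GBQRel k G ρ n δ), fun _ _ h =>
      RingQuot.mkAlgHom_rel k (GBQRel.base h)⟩
  let g : GBQAlg k G ρ n δ →ₐ[k] GBAlg k G ρ n δ :=
    RingQuot.liftAlgHom k ⟨RingQuot.mkAlgHom k (GBRel k G ρ n δ), fun _ _ h => by
      cases h with
      | base h => exact RingQuot.mkAlgHom_rel k h
      | blank h0 h1 => exact absurd h1 (Nat.not_even_iff_odd.2 ho)⟩
  have hf : ∀ x, f (RingQuot.mkAlgHom k (GBRel k G ρ n δ) x) =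
      RingQuot.mkAlgHom k (GBQRel k G ρ n δ) x := fun x => RingQuot.liftAlgHom_mkAlgHom_apply _ _ _ _
  have hg : ∀ x, g (RingQuot.mkAlgHom k (GBQRel k G ρ n δ) x) =
      RingQuot.mkAlgHom k (GBRel k G ρ n δ) x := fun x => RingQuot.liftAlgHom_mkAlgHom_apply _ _ _ _
  refine ⟨AlgEquiv.ofAlgHom f g ?_ ?_, ?_⟩
  · refine AlgHom.ext fun a => ?_
    obtain ⟨x, rfl⟩ := RingQuot.mkAlgHom_surjective k (GBQRel k G ρ n δ) a
    simp only [AlgHom.comp_apply, hf, hg, AlgHom.id_apply]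
  · refine AlgHom.ext fun a => ?_
    obtain ⟨x, rfl⟩ := RingQuot.mkAlgHom_surjective k (GBRel k G ρ n δ) a
    simp only [AlgHom.comp_apply, hf, hg, AlgHom.id_apply]
  · intro a
    obtain ⟨x, rfl⟩ := RingQuot.mkAlgHom_surjective k (GBRel k G ρ n δ) a
    change GBQaug k G ρ n δ (f _) = _
    rw [hf, GBQaug, GBaug, RingQuot.liftAlgHom_mkAlgHom_apply, RingQuot.liftAlgHom_mkAlgHom_apply]

theorem barTor_equiv {A Q : Type} [Ring A] [Algebra k A] [Ring Q] [Algebra k Q] (f : A ≃ₐ[k] Q)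
    (εA : A →ₐ[k] k) (εQ : Q →ₐ[k] k) (hf : ∀ a, εQ (f a) = εA a) [Module.Flat k A]
    [Module.Flat k Q] (q : ℕ) : Nonempty (barTor k A εA q ≃ₗ[k] barTor k Q εQ q) := by
  refine barTor_compare f.toAlgHom εA εQ hf f.surjective ?_ q
  intro Y P hP
  have : Subsingleton P := by
    have h0 : ∀ x : P, x = 0 := by
      rintro ⟨x, hx⟩
      have := (hP x).1 hx
      apply Subtype.ext
      ext y
      exact f.injective ((this y).trans (map_zero f).symm)
    exact ⟨fun x y => by rw [h0 x, h0 y]⟩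
  exact good_of_subsingleton

theorem GB_odd (hn : 0 < n) (ho : Odd n) (q : ℕ) :
    Nonempty (barTor k (GBAlg k G ρ n δ) (GBaug k G ρ n δ) q ≃ₗ[k] groupTor k (GW G n) q) := by
  have := GBQ_free (k := k) (G := G) (ρ := ρ) (δ := δ) hn
  obtain ⟨f, hf⟩ := GB_odd_exists (k := k) (G := G) (ρ := ρ) (δ := δ) ho
  have : Module.Free k (GBAlg k G ρ n δ) := Module.Free.of_equiv f.symm.toLinearEquiv
  obtain ⟨e1⟩ := barTor_equiv f (GBaug k G ρ n δ) (GBQaug k G ρ n δ) hf q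
  obtain ⟨e2⟩ := GBQ_main (k := k) (G := G) (ρ := ρ) (δ := δ) hn q
  exact ⟨e1.trans e2⟩

end FinalSec

/-- **A Sroka-type theorem for `G`-equivariant Brauer algebras** (no invertibility).
Let `G` be an abelian group, `k` a commutative `G`-ring, and `n` a positive integer.
If `n` is odd then, for any `δ ∈ k`, there is an isomorphism of graded `k`-modules
`Tor_*^{GB_n(δ)}(𝟙,𝟙) ≅ Tor_*^{k[G^n ⋊ Σ_n]}(k,k) = H_*(G^n ⋊ Σ_n; k)`.
More generally, for any positive `n`, writing `I₀` for the two-sided ideal of `GB_n(δ)`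
which is free as a `k`-module on the diagrams with no left-to-right connections,
`Tor_*^{GB_n(δ)/I₀}(𝟙,𝟙) ≅ H_*(G^n ⋊ Σ_n; k)`. -/
theorem equivariant_brauer_sroka (k G : Type) [CommRing k] [CommGroup G]
    (ρ : G →* RingAut k) (n : ℕ) (hn : 0 < n) (δ : k) :
    (Odd n → ∀ q : ℕ,
      Nonempty ((barTor k (GBAlg k G ρ n δ) (GBaug k G ρ n δ) q) ≃ₗ[k]
        (groupTor k ((Fin n → G) ⋊[permMulAut G n] Equiv.Perm (Fin n)) q))) ∧
    (∀ q : ℕ,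
      Nonempty ((barTor k (GBQAlg k G ρ n δ) (GBQaug k G ρ n δ) q) ≃ₗ[k]
        (groupTor k ((Fin n → G) ⋊[permMulAut G n] Equiv.Perm (Fin n)) q))) := by
  exact ⟨fun ho q => GB_odd hn ho q, fun q => GBQ_main hn q⟩
end
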